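/- Let M be a connected manifold of odd dimension 2m+1 with finite-dimensional total rational cohomology. Then M satisfies the shifted stability condition for its unordered configuration spaces (for some range r ≥ 1, shift σ ≥ 1 and length q ≥ 1) if and only if the top positive even Betti number of M equals one, i.e. there exists a ≥ 1 with β_{2a}(M) = 1 and β_{2i}(M) = 0 for all i > a. -/

import Mathlib

open CategoryTheory

/-- The singular chain complex of a topological space with rational coefficients:
the alternating face map complex of the free simplicial `ℚ`-module on the singular
simplicial set. -/
noncomputable def singularChainComplexQ (X : Type) [TopologicalSpace X] :
    ChainComplex (ModuleCat ℚ) ℕ :=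
  (AlgebraicTopology.alternatingFaceMapComplex (ModuleCat ℚ)).obj
    (((CategoryTheory.SimplicialObject.whiskering _ _).obj (ModuleCat.free ℚ)).obj
      (TopCat.toSSet.obj (TopCat.of X)))

/-- Singular homology with rational coefficients. -/
noncomputable def singularHomologyQ (X : Type) [TopologicalSpace X] (n : ℕ) : ModuleCat ℚ :=
  (singularChainComplexQ X).homology n

/-- Singular cohomology with rational coefficients.  Since `ℚ` is a field, by the universal
coefficient theorem `H^n(X;ℚ)` is naturally isomorphic to the linear dual of `H_n(X;ℚ)`,
which we take as the definition. -/
noncomputable def singularCohomologyQ (X : Type) [TopologicalSpace X] (n : ℕ) : Type :=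
  Module.Dual ℚ (singularHomologyQ X n)

noncomputable instance (X : Type) [TopologicalSpace X] (n : ℕ) :
    AddCommGroup (singularCohomologyQ X n) :=
  inferInstanceAs (AddCommGroup (Module.Dual ℚ (singularHomologyQ X n)))

noncomputable instance (X : Type) [TopologicalSpace X] (n : ℕ) :
    Module ℚ (singularCohomologyQ X n) :=
  inferInstanceAs (Module ℚ (Module.Dual ℚ (singularHomologyQ X n)))

/-- The `i`-th rational Betti number `β_i(X) = dim_ℚ H^i(X;ℚ)`. -/
noncomputable def bettiQ (X : Type) [TopologicalSpace X] (i : ℕ) : ℕ :=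
  Module.finrank ℚ (singularCohomologyQ X i)

/-- The ordered configuration space `F_k(X)` of `k` distinct points of `X`,
with the subspace topology from `X^k`. -/
def orderedConfig (X : Type) [TopologicalSpace X] (k : ℕ) : Type :=
  {f : Fin k → X // Function.Injective f}

instance (X : Type) [TopologicalSpace X] (k : ℕ) : TopologicalSpace (orderedConfig X k) :=
  inferInstanceAs (TopologicalSpace {f : Fin k → X // Function.Injective f})

/-- The unordered configuration space `C_k(X) = F_k(X)/S_k`, the quotient of the ordered
configuration space by the permutation action of the symmetric group, with the quotient
topology. -/
def unorderedConfig (X : Type) [TopologicalSpace X] (k : ℕ) : Type :=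
  Quot (fun f g : orderedConfig X k => ∃ σ : Equiv.Perm (Fin k), g.1 = f.1 ∘ σ)

instance (X : Type) [TopologicalSpace X] (k : ℕ) : TopologicalSpace (unorderedConfig X k) :=
  inferInstanceAs (TopologicalSpace (Quot _))

/-- `M` has the strong stability property with range `r`:
`H^i(C_k(M);ℚ) ≅ H^i(C_{k+1}(M);ℚ)` for all `i ≥ 0` and all `k ≥ r`. -/
def StrongStabilityRange (M : Type) [TopologicalSpace M] (r : ℕ) : Prop :=
  ∀ k : ℕ, r ≤ k → ∀ i : ℕ,
    Nonempty (singularCohomologyQ (unorderedConfig M k) i ≃ₗ[ℚ]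
      singularCohomologyQ (unorderedConfig M (k + 1)) i)

/-- `M` has the strong stability property: for some `r ≥ 1`, the rational cohomology of its
unordered configuration spaces is constant from `C_r(M)` on. -/
def StrongStability (M : Type) [TopologicalSpace M] : Prop :=
  ∃ r : ℕ, 1 ≤ r ∧ StrongStabilityRange M r

/-- `X` has finite-dimensional total rational cohomology: each `H^i(X;ℚ)` is
finite-dimensional and all but finitely many vanish. -/
def FiniteTotalCohomologyQ (X : Type) [TopologicalSpace X] : Prop :=
  (∀ i : ℕ, FiniteDimensional ℚ (singularCohomologyQ X i)) ∧
  ∃ N : ℕ, ∀ i : ℕ, N ≤ i → Subsingleton (singularCohomologyQ X i)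

/-- `M` is a rational homology `n`-sphere: `H^*(M;ℚ) ≅ H^*(S^n;ℚ)`, i.e.
`H^i(M;ℚ)` is one-dimensional for `i ∈ {0, n}` and vanishes otherwise (`n ≥ 1`). -/
def RatHomologySphere (M : Type) [TopologicalSpace M] (n : ℕ) : Prop :=
  ∀ i : ℕ, Module.rank ℚ (singularCohomologyQ M i) = if i = 0 ∨ i = n then 1 else 0

/-- `M` (of dimension `4m`) is a homology projective plane:
`β_0 = β_{2m} = β_{4m} = 1` and all other Betti numbers vanish. -/
def HomologyProjPlane (M : Type) [TopologicalSpace M] (m : ℕ) : Prop :=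
  ∀ i : ℕ, bettiQ M i = if i = 0 ∨ i = 2 * m ∨ i = 4 * m then 1 else 0

/-- The rational cohomological dimension: the largest `i` with `H^i(X;ℚ) ≠ 0`. -/
noncomputable def cohomDimQ (X : Type) [TopologicalSpace X] : ℕ :=
  sSup {i : ℕ | bettiQ X i ≠ 0}

/-- The `q`-truncated Poincaré polynomial
`P^{[q]}_X(t) = β_{τ-q+1} t^{τ-q+1} + ⋯ + β_τ t^τ` where `τ = cd(X)`. -/
noncomputable def truncPoincareQ (X : Type) [TopologicalSpace X] (q : ℕ) : Polynomial ℕ :=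
  ∑ j ∈ Finset.range q,
    if j ≤ cohomDimQ X then
      Polynomial.monomial (cohomDimQ X - j) (bettiQ X (cohomDimQ X - j))
    else 0

/-- The Poincaré polynomial `P_X(t) = ∑ᵢ β_i(X) tⁱ` (of a space with finite-dimensional
total cohomology). -/
noncomputable def poincarePolyQ (X : Type) [TopologicalSpace X] : Polynomial ℕ :=
  ∑ i ∈ Finset.range (cohomDimQ X + 1), Polynomial.monomial i (bettiQ X i)

/-- `M` satisfies the shifted stability condition with range `r`, shift `σ` and length `q`:
`P^{[q]}_{C_{k+1}(M)}(t) = t^σ P^{[q]}_{C_k(M)}(t)` for all `k ≥ r`. -/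
def ShiftedStabilityQ (M : Type) [TopologicalSpace M] (r σ q : ℕ) : Prop :=
  ∀ k : ℕ, r ≤ k →
    truncPoincareQ (unorderedConfig M (k + 1)) q =
      Polynomial.X ^ σ * truncPoincareQ (unorderedConfig M k) q

/-- `M` satisfies the Poincaré-polynomial shifted stability condition with range `r`,
shift `σ` and ratio `R`:  `P_{C_{k+1}(M)}(t) = P_{C_k(M)}(t) + t^{(k+1-r)σ} R(t)` for all
`k ≥ r`. -/
def PoincarePolyShiftedStability (M : Type) [TopologicalSpace M] (r σ : ℕ)
    (R : Polynomial ℕ) : Prop :=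
  ∀ k : ℕ, r ≤ k →
    poincarePolyQ (unorderedConfig M (k + 1)) =
      poincarePolyQ (unorderedConfig M k) + Polynomial.X ^ ((k + 1 - r) * σ) * R

/-- `M` satisfies the extended shifted stability condition with range `r` and shift `σ`:
`P^{[(k-r+1)σ]}_{C_{k+1}(M)}(t) = t^σ P^{[(k-r+1)σ]}_{C_k(M)}(t)` for all `k ≥ r`. -/
def ExtendedShiftedStability (M : Type) [TopologicalSpace M] (r σ : ℕ) : Prop :=
  ∀ k : ℕ, r ≤ k →
    truncPoincareQ (unorderedConfig M (k + 1)) ((k - r + 1) * σ) =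
      Polynomial.X ^ σ * truncPoincareQ (unorderedConfig M k) ((k - r + 1) * σ)

namespace SingularQ

open Finset

/-- The standard topological simplex. -/
abbrev Simplex (n : ℕ) : Type := stdSimplex ℝ (Fin (n + 1))

/-- A natural number truncated to a vertex of the standard simplex. -/
def clip (n j : ℕ) : Fin (n + 1) := ⟨min j n, by omega⟩

lemma clip_val {n : ℕ} (j : Fin (n + 1)) : clip n j.1 = j := by
  ext; simp only [clip]; omega

/-- The affine map of simplices induced by a map of vertices. -/
noncomputable def vertexMap (m n : ℕ) (f : ℕ → ℕ) : C(Simplex m, Simplex n) :=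
  ⟨stdSimplex.map fun j : Fin (m + 1) => clip n (f j), stdSimplex.continuous_map _⟩

lemma vertexMap_apply (m n : ℕ) (f : ℕ → ℕ) (x : Simplex m) (i : Fin (n + 1)) :
    vertexMap m n f x i = ∑ j : Fin (m + 1), if clip n (f j) = i then x j else 0 := by
  simp [vertexMap, FunOnFinite.linearMap_apply_apply, Finset.sum_filter]

lemma vertexMap_comp (l m n : ℕ) (f g : ℕ → ℕ) :
    (vertexMap m n f).comp (vertexMap l m g) = vertexMap l n fun j => f (min (g j) m) := by
  ext1 x
  simp only [vertexMap, ContinuousMap.comp_apply, ContinuousMap.coe_mk,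
    stdSimplex.map_comp_apply]
  rfl

lemma vertexMap_congr {m n : ℕ} {f g : ℕ → ℕ} (h : ∀ j ≤ m, min (f j) n = min (g j) n) :
    vertexMap m n f = vertexMap m n g := by
  have : (fun j : Fin (m + 1) => clip n (f j)) = fun j : Fin (m + 1) => clip n (g j) := by
    funext j
    ext
    exact h j (by omega)
  simp only [vertexMap, this]

lemma vertexMap_id (n : ℕ) : vertexMap n n id = ContinuousMap.id _ := by
  ext1 x
  have : (fun j : Fin (n + 1) => clip n (id j.1)) = id := by
    funext j
    exact clip_val j
  simp only [vertexMap, this, ContinuousMap.coe_mk, stdSimplex.map_id_apply,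
    ContinuousMap.id_apply]

/-- The singular simplices of all dimensions of a space. -/
structure Sing (X : Type) [TopologicalSpace X] where
  /-- the dimension -/
  dim : ℕ
  /-- the underlying map -/
  map : C(Simplex dim, X)

lemma Sing.mk_congr {X : Type} [TopologicalSpace X] {n : ℕ} {f g : C(Simplex n, X)}
    (h : ∀ x, f x = g x) : (⟨n, f⟩ : Sing X) = ⟨n, g⟩ := by
  rw [ContinuousMap.ext h]

/-- Rational singular chains. -/
abbrev Chain (X : Type) [TopologicalSpace X] : Type := Sing X →₀ ℚ

variable {X Y Z : Type} [TopologicalSpace X] [TopologicalSpace Y] [TopologicalSpace Z]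

/-- The simplex obtained from a singular simplex by a map of vertices. -/
noncomputable def sub (σ : Sing X) (m : ℕ) (f : ℕ → ℕ) : Sing X :=
  ⟨m, σ.map.comp (vertexMap m σ.dim f)⟩

lemma sub_mk (n : ℕ) (s : C(Simplex n, X)) (m : ℕ) (f : ℕ → ℕ) :
    sub ⟨n, s⟩ m f = ⟨m, s.comp (vertexMap m n f)⟩ := rfl

@[simp] lemma sub_dim (σ : Sing X) (m : ℕ) (f : ℕ → ℕ) : (sub σ m f).dim = m := rfl

lemma sub_sub (σ : Sing X) (m : ℕ) (f : ℕ → ℕ) (l : ℕ) (g : ℕ → ℕ) :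
    sub (sub σ m f) l g = sub σ l fun j => f (min (g j) m) := by
  obtain ⟨n, s⟩ := σ
  simp only [sub_mk, ContinuousMap.comp_assoc, vertexMap_comp]

lemma sub_congr (σ : Sing X) {m m' : ℕ} {f g : ℕ → ℕ} (hm : m = m')
    (h : ∀ j ≤ m, min (f j) σ.dim = min (g j) σ.dim) : sub σ m f = sub σ m' g := by
  subst hm
  simp only [sub, vertexMap_congr h]

lemma sub_eq_self (σ : Sing X) {m : ℕ} {f : ℕ → ℕ} (hm : m = σ.dim)
    (h : ∀ j ≤ m, min (f j) σ.dim = j) : sub σ m f = σ := by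
  subst hm
  have : vertexMap σ.dim σ.dim f = vertexMap σ.dim σ.dim id :=
    vertexMap_congr fun j hj => by simp [h j hj, hj]
  simp only [sub, this, vertexMap_id, ContinuousMap.comp_id]

/-- Composition of a singular simplex with a continuous map. -/
def pushS (g : C(X, Y)) (σ : Sing X) : Sing Y := ⟨σ.dim, g.comp σ.map⟩

@[simp] lemma pushS_dim (g : C(X, Y)) (σ : Sing X) : (pushS g σ).dim = σ.dim := rfl

lemma pushS_sub (g : C(X, Y)) (σ : Sing X) (m : ℕ) (f : ℕ → ℕ) :
    pushS g (sub σ m f) = sub (pushS g σ) m f := rfl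

lemma pushS_comp (h : C(Y, Z)) (g : C(X, Y)) (σ : Sing X) :
    pushS (h.comp g) σ = pushS h (pushS g σ) := rfl

lemma pushS_id (σ : Sing X) : pushS (ContinuousMap.id X) σ = σ := rfl

/-- The linear extension of a map on basis elements. -/
noncomputable abbrev lext {α V : Type} [AddCommGroup V] [Module ℚ V] (f : α → V) :
    (α →₀ ℚ) →ₗ[ℚ] V := Finsupp.linearCombination ℚ f

/-- A basis element. -/
noncomputable abbrev bas {α : Type} (a : α) : α →₀ ℚ := Finsupp.single a 1

lemma lext_bas {α V : Type} [AddCommGroup V] [Module ℚ V] (f : α → V) (a : α) :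
    lext f (bas a) = f a := by simp

lemma hom_ext {α V : Type} [AddCommGroup V] [Module ℚ V] {f g : (α →₀ ℚ) →ₗ[ℚ] V}
    (h : ∀ a, f (bas a) = g (bas a)) : f = g := by
  refine Finsupp.lhom_ext' fun a => LinearMap.ext_ring ?_
  exact h a

/-- Push-forward of chains. -/
noncomputable def push (g : C(X, Y)) : Chain X →ₗ[ℚ] Chain Y := lext fun σ => bas (pushS g σ)

@[simp] lemma push_bas (g : C(X, Y)) (σ : Sing X) : push g (bas σ) = bas (pushS g σ) :=
  lext_bas _ _

lemma push_comp (h : C(Y, Z)) (g : C(X, Y)) (c : Chain X) :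
    push (h.comp g) c = push h (push g c) := by
  have : push (h.comp g) = (push h).comp (push g) := hom_ext fun σ => by
    simp only [push_bas, LinearMap.comp_apply, pushS_comp]
  rw [this]; rfl

lemma push_id (c : Chain X) : push (ContinuousMap.id X) c = c := by
  have : push (ContinuousMap.id X) = LinearMap.id := hom_ext fun σ => by
    simp only [push_bas, LinearMap.id_apply, pushS_id]
  rw [this]; rfl

/-- The vertex map omitting the vertex `i`. -/
def coface (i j : ℕ) : ℕ := if j < i then j else j + 1

/-- The boundary of a singular simplex. -/
noncomputable def bdS (σ : Sing X) : Chain X :=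
  if σ.dim = 0 then 0 else
    ∑ i ∈ range (σ.dim + 1), (-1 : ℚ) ^ i • bas (sub σ (σ.dim - 1) (coface i))

/-- The boundary operator on chains. -/
noncomputable def bd : Chain X →ₗ[ℚ] Chain X := lext bdS

@[simp] lemma bd_bas (σ : Sing X) : bd (bas σ) = bdS σ := lext_bas _ _

lemma bd_sub (σ : Sing X) (m : ℕ) (f : ℕ → ℕ) : bdS (sub σ (m + 1) f) =
    ∑ i ∈ range (m + 2), (-1 : ℚ) ^ i • bas (sub σ m fun j => f (coface i j)) := by
  simp only [bdS, sub_dim, Nat.add_one_sub_one, sub_sub]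
  rw [if_neg (by omega)]
  refine Finset.sum_congr rfl fun i _ => ?_
  congr 2
  refine sub_congr _ rfl fun j hj => ?_
  congr 2
  simp only [coface]; split_ifs <;> omega

lemma bdS_of_dim_zero {σ : Sing X} (h : σ.dim = 0) : bdS σ = 0 := if_pos h

lemma bdS_of_dim_succ {σ : Sing X} {n : ℕ} (h : σ.dim = n + 1) : bdS σ =
    ∑ i ∈ range (n + 2), (-1 : ℚ) ^ i • bas (sub σ n (coface i)) := by
  rw [bdS, if_neg (by omega), h]; rfl

lemma bd_bd (c : Chain X) : bd (bd c) = 0 := by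
  have : (bd : Chain X →ₗ[ℚ] Chain X).comp bd = 0 := by
    refine hom_ext fun σ => ?_
    simp only [LinearMap.comp_apply, bd_bas, LinearMap.zero_apply]
    obtain h | ⟨n, h⟩ : σ.dim = 0 ∨ ∃ n, σ.dim = n + 1 := by
      cases h : σ.dim <;> simp
    · rw [bdS_of_dim_zero h, map_zero]
    rw [bdS_of_dim_succ h, map_sum]
    obtain rfl | ⟨m, rfl⟩ : n = 0 ∨ ∃ m, n = m + 1 := by
      cases n <;> simp
    · refine Finset.sum_eq_zero fun i _ => ?_
      rw [map_smul, bd_bas, bdS_of_dim_zero rfl, smul_zero]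
    simp only [map_smul, bd_bas, bd_sub, Finset.smul_sum, smul_smul, ← pow_add]
    rw [← Finset.sum_product']
    refine Finset.sum_involution
      (fun p _ => if p.2 < p.1 then (p.2, p.1 - 1) else (p.2 + 1, p.1)) ?_ ?_ ?_ ?_
    · rintro ⟨i, j⟩ hp
      simp only
      split_ifs with hij
      · have e1 : i + j = (j + (i - 1)) + 1 := by omega
        have e2 : sub σ m (fun k => coface j (coface (i - 1) k)) =
            sub σ m fun k => coface i (coface j k) := by
          refine sub_congr _ rfl fun k _ => ?_
          congr 1
          simp only [coface]; split_ifs <;> omega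
        simp only [e1, e2, pow_succ]
        rw [← add_smul]; simp
      · have e1 : j + 1 + i = (i + j) + 1 := by omega
        have e2 : sub σ m (fun k => coface (j + 1) (coface i k)) =
            sub σ m fun k => coface i (coface j k) := by
          refine sub_congr _ rfl fun k _ => ?_
          congr 1
          simp only [coface]; split_ifs <;> omega
        simp only [e1, e2, pow_succ]
        rw [← add_smul]; simp
    · rintro ⟨i, j⟩ hp _ heq
      simp only at heq
      split_ifs at heq with hij <;> simp only [Prod.mk.injEq] at heq <;> omega
    · rintro ⟨i, j⟩ hp
      simp only [mem_product, mem_range] at hp ⊢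
      split_ifs with hij <;> simp <;> omega
    · rintro ⟨i, j⟩ hp
      simp only [mem_product, mem_range] at hp ⊢
      split_ifs <;> simp <;> omega
  exact LinearMap.congr_fun this c

lemma push_bdS (g : C(X, Y)) (σ : Sing X) : push g (bdS σ) = bdS (pushS g σ) := by
  obtain h | ⟨n, h⟩ : σ.dim = 0 ∨ ∃ n, σ.dim = n + 1 := by
    cases h : σ.dim <;> simp
  · rw [bdS_of_dim_zero h, bdS_of_dim_zero (σ := pushS g σ) h, map_zero]
  · rw [bdS_of_dim_succ h, bdS_of_dim_succ (σ := pushS g σ) h]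
    simp only [map_sum, map_smul, push_bas, pushS_sub]

lemma push_bd (g : C(X, Y)) (c : Chain X) : push g (bd c) = bd (push g c) := by
  have : (push g).comp bd = bd.comp (push g) := hom_ext fun σ => by
    simp only [LinearMap.comp_apply, bd_bas, push_bas, push_bdS]
  exact LinearMap.congr_fun this c

/-- The augmentation. -/
noncomputable def aug : Chain X →ₗ[ℚ] ℚ := lext fun σ => if σ.dim = 0 then 1 else 0

@[simp] lemma aug_bas (σ : Sing X) : aug (bas σ) = if σ.dim = 0 then 1 else 0 := lext_bas _ _

lemma aug_bd (c : Chain X) : aug (bd c) = 0 := by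
  have : (aug : Chain X →ₗ[ℚ] ℚ).comp bd = 0 := hom_ext fun σ => by
    simp only [LinearMap.comp_apply, bd_bas, LinearMap.zero_apply]
    obtain h | ⟨n, h⟩ : σ.dim = 0 ∨ ∃ n, σ.dim = n + 1 := by
      cases h : σ.dim <;> simp
    · rw [bdS_of_dim_zero h, map_zero]
    · rw [bdS_of_dim_succ h]
      simp only [map_sum, map_smul, aug_bas, sub_dim]
      cases n
      · simp [Finset.sum_range_succ]
      · simp
  exact LinearMap.congr_fun this c

lemma aug_push (g : C(X, Y)) (c : Chain X) : aug (push g c) = aug c := by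
  have : (aug : Chain Y →ₗ[ℚ] ℚ).comp (push g) = aug := hom_ext fun σ => by
    simp only [LinearMap.comp_apply, push_bas, aug_bas, pushS_dim]
    rfl
  exact LinearMap.congr_fun this c

section Cone

/-- Auxiliary function for `coneMap`. -/
noncomputable def coneFun (n : ℕ) (p : Simplex n × unitInterval) : Simplex (n + 1) :=
  ⟨Fin.cons p.2.1 fun i => (1 - p.2.1) * p.1.1 i, by
    constructor
    · intro i
      refine Fin.cases ?_ (fun i => ?_) i
      · simpa using p.2.2.1
      · simpa using mul_nonneg (sub_nonneg.2 p.2.2.2) (p.1.2.1 i)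
    · rw [Fin.sum_univ_succ]
      simp only [Fin.cons_zero, Fin.cons_succ, ← Finset.mul_sum]
      rw [p.1.2.2]; ring⟩

lemma continuous_coneFun (n : ℕ) : Continuous (coneFun n) := by
  refine Continuous.subtype_mk (continuous_pi fun i => ?_) _
  refine Fin.cases ?_ (fun i => ?_) i
  · simp only [Fin.cons_zero]; fun_prop
  · simp only [Fin.cons_succ]
    exact (by fun_prop : Continuous fun p : Simplex n × unitInterval => 1 - p.2.1).mul
      ((continuous_apply i).comp (continuous_subtype_val.comp continuous_fst))

/-- The map exhibiting the simplex as a cone over its face opposite to the vertex `0`. -/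
noncomputable def coneMap (n : ℕ) : C(Simplex n × unitInterval, Simplex (n + 1)) :=
  ⟨coneFun n, continuous_coneFun n⟩

lemma coneMap_zero (n : ℕ) (p : Simplex n × unitInterval) : coneMap n p 0 = p.2 := rfl

lemma coneMap_succ (n : ℕ) (p : Simplex n × unitInterval) (i : Fin (n + 1)) :
    coneMap n p i.succ = (1 - p.2.1) * p.1 i := rfl

lemma coneMap_surjective (n : ℕ) : Function.Surjective (coneMap n) := by
  intro x
  have hx : ∑ i : Fin (n + 1), x i.succ = 1 - x 0 := by
    have := stdSimplex.sum_eq_one x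
    rw [Fin.sum_univ_succ] at this
    linarith
  by_cases h : x 0 = 1
  · refine ⟨(Classical.arbitrary _, 1), ?_⟩
    ext i
    refine Fin.cases ?_ (fun i => ?_) i
    · rw [coneMap_zero, h]; rfl
    · rw [coneMap_succ]
      rw [h, sub_self, Finset.sum_eq_zero_iff_of_nonneg (fun _ _ => stdSimplex.zero_le _ _)] at hx
      rw [hx i (mem_univ _)]
      simp
  · have h1 : 1 - x 0 ≠ 0 := sub_ne_zero.2 (Ne.symm h)
    have h0 : 0 ≤ 1 - x 0 := sub_nonneg.2 (stdSimplex.le_one _ _)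
    refine ⟨(⟨fun i => x i.succ / (1 - x 0), fun i => div_nonneg (stdSimplex.zero_le _ _) h0, ?_⟩,
      ⟨x 0, stdSimplex.zero_le _ _, stdSimplex.le_one _ _⟩), ?_⟩
    · rw [← Finset.sum_div, hx, div_self h1]
    · ext i
      refine Fin.cases ?_ (fun i => ?_) i
      · rfl
      · rw [coneMap_succ]
        exact mul_div_cancel₀ _ h1

lemma isQuotientMap_coneMap (n : ℕ) : Topology.IsQuotientMap (coneMap n) :=
  (coneMap n).continuous.isClosedMap.isQuotientMap (coneMap n).continuous
    (coneMap_surjective n)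

/-- A contraction of a space to a point. -/
structure Contraction (X : Type) [TopologicalSpace X] where
  /-- the homotopy -/
  toFun : C(X × unitInterval, X)
  /-- the point to which the space is contracted -/
  apex : X
  map_zero : ∀ x, toFun (x, 0) = x
  map_one : ∀ x, toFun (x, 1) = apex

variable (H : Contraction X)

lemma Contraction.compatible (σ : Sing X) {p q : Simplex σ.dim × unitInterval}
    (h : coneMap σ.dim p = coneMap σ.dim q) :
        H.toFun (σ.map p.1, p.2) = H.toFun (σ.map q.1, q.2) := by
  have h2 : p.2 = q.2 := by
    have := DFunLike.congr_fun h 0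
    rw [coneMap_zero, coneMap_zero] at this
    exact Subtype.ext this
  by_cases h1 : p.2 = 1
  · rw [← h2, h1, H.map_one, H.map_one]
  · have : p.1 = q.1 := by
      ext i
      have := DFunLike.congr_fun h i.succ
      rw [coneMap_succ, coneMap_succ, h2] at this
      refine mul_left_cancel₀ (sub_ne_zero.2 fun e => h1 ?_) this
      rw [h2]; exact Subtype.ext e.symm
    rw [this, h2]

/-- The cone on a singular simplex. -/
noncomputable def Contraction.coneS (σ : Sing X) : Sing X :=
  ⟨σ.dim + 1, (isQuotientMap_coneMap σ.dim).lift
    ⟨fun p => H.toFun (σ.map p.1, p.2), by fun_prop⟩ fun _ _ h => H.compatible σ h⟩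

@[simp] lemma Contraction.coneS_dim (σ : Sing X) : (H.coneS σ).dim = σ.dim + 1 := rfl

lemma Contraction.coneS_apply (σ : Sing X) (p : Simplex σ.dim × unitInterval) :
    (H.coneS σ).map (coneMap σ.dim p) = H.toFun (σ.map p.1, p.2) := by
  have := DFunLike.congr_fun ((isQuotientMap_coneMap σ.dim).lift_comp
    ⟨fun p => H.toFun (σ.map p.1, p.2), by fun_prop⟩ fun _ _ h => H.compatible σ h) p
  exact this

/-- The vertex map on a cone induced by a vertex map of the base. -/
def shiftMap (f : ℕ → ℕ) (j : ℕ) : ℕ := if j = 0 then 0 else f (j - 1) + 1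

lemma vertexMap_shiftMap (m n : ℕ) (f : ℕ → ℕ) (p : Simplex m × unitInterval) :
    vertexMap (m + 1) (n + 1) (shiftMap f) (coneMap m p) =
      coneMap n (vertexMap m n f p.1, p.2) := by
  ext i
  rw [vertexMap_apply, Fin.sum_univ_succ]
  refine Fin.cases ?_ (fun i => ?_) i
  · rw [coneMap_zero, coneMap_zero, Finset.sum_eq_zero]
    · rw [if_pos, add_zero]
      ext; simp [clip, shiftMap]
    · intro j _
      rw [if_neg]
      intro h
      have := congrArg Fin.val h
      simp only [clip, shiftMap, Fin.val_succ, Fin.val_zero] at this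
      split_ifs at this <;> omega
  · rw [coneMap_succ, if_neg, zero_add, vertexMap_apply, Finset.mul_sum]
    · refine Finset.sum_congr rfl fun j _ => ?_
      rw [coneMap_succ, mul_ite, mul_zero]
      refine if_congr ?_ rfl rfl
      simp only [clip, shiftMap, Fin.ext_iff, Fin.val_succ, Nat.add_one_sub_one]
      rw [if_neg (by omega)]
      omega
    · intro h
      have := congrArg Fin.val h
      simp only [clip, shiftMap, Fin.val_succ, Fin.val_zero] at this
      split_ifs at this <;> omega

lemma Contraction.exists_coneS (n : ℕ) (s : C(Simplex n, X)) :
    ∃ t : C(Simplex (n + 1), X), H.coneS ⟨n, s⟩ = ⟨n + 1, t⟩ ∧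
      ∀ p, t (coneMap n p) = H.toFun (s p.1, p.2) :=
  ⟨_, rfl, H.coneS_apply ⟨n, s⟩⟩

lemma Contraction.sub_coneS (σ : Sing X) (m : ℕ) (f : ℕ → ℕ) :
    sub (H.coneS σ) (m + 1) (shiftMap f) = H.coneS (sub σ m f) := by
  obtain ⟨n, s⟩ := σ
  obtain ⟨t, h, ht⟩ := H.exists_coneS n s
  obtain ⟨t', h', ht'⟩ := H.exists_coneS m (s.comp (vertexMap m n f))
  rw [h, sub_mk n s, h', sub_mk]
  refine Sing.mk_congr fun x => ?_
  obtain ⟨p, rfl⟩ := coneMap_surjective m x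
  rw [ht', ContinuousMap.comp_apply, vertexMap_shiftMap, ht, ContinuousMap.comp_apply]

lemma Contraction.sub_coneS_base (σ : Sing X) (m : ℕ) (hm : m = σ.dim) :
    sub (H.coneS σ) m (fun j => j + 1) = σ := by
  subst hm
  obtain ⟨n, s⟩ := σ
  obtain ⟨t, h, ht⟩ := H.exists_coneS n s
  rw [h, sub_mk]
  refine Sing.mk_congr fun x => ?_
  have : vertexMap n (n + 1) (fun j => j + 1) x = coneMap n (x, 0) := by
    ext i
    rw [vertexMap_apply]
    refine Fin.cases ?_ (fun i => ?_) i
    · rw [coneMap_zero, Finset.sum_eq_zero]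
      · rfl
      · intro j _
        rw [if_neg]
        intro h
        have := congrArg Fin.val h
        simp [clip] at this
    · rw [coneMap_succ, Finset.sum_eq_single i]
      · rw [if_pos]
        · simp
        · ext; simp [clip]; omega
      · intro j _ hj
        rw [if_neg]
        intro h
        refine hj (Fin.ext ?_)
        have := congrArg Fin.val h
        simp [clip] at this; omega
      · simp
  rw [ContinuousMap.comp_apply, this, ht, H.map_zero]

/-- The zero-dimensional simplex at a point. -/
def pointS (x : X) : Sing X := ⟨0, ContinuousMap.const _ x⟩

lemma sub_eq_pointS (σ : Sing X) (f : ℕ → ℕ) :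
    sub σ 0 f = pointS (σ.map (stdSimplex.vertex (clip σ.dim (f 0)))) := by
  refine Sing.mk_congr fun x => ?_
  have : x = stdSimplex.vertex 0 := Subsingleton.elim _ _
  subst this
  obtain ⟨n, s⟩ := σ
  rw [ContinuousMap.comp_apply, ContinuousMap.const_apply]
  exact congrArg s (stdSimplex.map_vertex _ _)

lemma Contraction.sub_coneS_apex (σ : Sing X) : sub (H.coneS σ) 0 (coface 1) =
    pointS H.apex := by
  obtain ⟨n, s⟩ := σ
  obtain ⟨t, h, ht⟩ := H.exists_coneS n s
  rw [h, sub_eq_pointS]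
  have e : clip (n + 1) (coface 1 0) = 0 := by ext; simp [clip, coface]
  have : stdSimplex.vertex 0 = coneMap n (Classical.arbitrary _, 1) := by
    ext i
    refine Fin.cases ?_ (fun i => ?_) i
    · rw [coneMap_zero]; simp
    · rw [coneMap_succ]; simp
  simp only [e]
  rw [this, ht, H.map_one]

/-- The cone operator on chains. -/
noncomputable def Contraction.cone : Chain X →ₗ[ℚ] Chain X := lext fun σ => bas (H.coneS σ)

@[simp] lemma Contraction.cone_bas (σ : Sing X) : H.cone (bas σ) = bas (H.coneS σ) :=
  lext_bas _ _

lemma Contraction.bdS_coneS (σ : Sing X) :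
    bdS (H.coneS σ) = bas σ - H.cone (bdS σ) - aug (bas σ) • bas (pointS H.apex) := by
  rw [bdS_of_dim_succ (H.coneS_dim σ), Finset.sum_range_succ']
  have e0 : sub (H.coneS σ) σ.dim (coface 0) = σ := by
    refine (sub_congr _ rfl fun j _ => ?_).trans (H.sub_coneS_base σ σ.dim rfl)
    simp [coface]
  rw [e0]
  obtain h | ⟨n, h⟩ : σ.dim = 0 ∨ ∃ n, σ.dim = n + 1 := by
    cases h : σ.dim <;> simp
  · rw [bdS_of_dim_zero h, h]
    simp only [range_one, sum_singleton, zero_add, pow_one, pow_zero, one_smul,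
      aug_bas, h, if_true]
    rw [H.sub_coneS_apex]
    simp [sub_eq_add_neg, add_comm]
  · rw [bdS_of_dim_succ h, h]
    simp only [aug_bas, h, map_sum, map_smul, cone_bas, pow_succ, mul_neg, mul_one, neg_smul,
      Finset.sum_neg_distrib, pow_zero, one_smul]
    rw [if_neg (by omega), zero_smul, sub_zero, neg_add_eq_sub]
    congr 1
    refine Finset.sum_congr rfl fun i _ => ?_
    rw [← H.sub_coneS]
    congr 2
    refine sub_congr _ rfl fun j hj => ?_
    congr 1
    simp only [coface, shiftMap]; split_ifs <;> omega

lemma Contraction.bd_cone (c : Chain X) :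
    bd (H.cone c) = c - H.cone (bd c) - aug c • bas (pointS H.apex) := by
  have : bd.comp H.cone = LinearMap.id - H.cone.comp bd -
      aug.smulRight (bas (pointS H.apex)) := hom_ext fun σ => by
    simp only [LinearMap.comp_apply, bd_bas, cone_bas, LinearMap.sub_apply, LinearMap.id_apply,
      LinearMap.smulRight_apply, H.bdS_coneS]
  exact LinearMap.congr_fun this c

end Cone

end SingularQ

namespace SingularQ

open Finset

variable {X Y Z : Type} [TopologicalSpace X] [TopologicalSpace Y] [TopologicalSpace Z]

/-- The contraction of a star-shaped set. -/
noncomputable def starContraction {E : Type} [AddCommGroup E] [Module ℝ E] [TopologicalSpace E]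
    [ContinuousAdd E] [ContinuousSMul ℝ E] {S : Set E} {p : E} (h : StarConvex ℝ p S)
    (hp : p ∈ S) : Contraction S where
  toFun := ⟨fun q => ⟨q.2.1 • p + (1 - q.2.1) • q.1.1,
      h q.1.2 q.2.2.1 (sub_nonneg.2 q.2.2.2) (by ring)⟩, by fun_prop⟩
  apex := ⟨p, hp⟩
  map_zero x := by ext; simp
  map_one x := by ext; simp

/-- The product of contractions. -/
def Contraction.prod (H : Contraction X) (K : Contraction Y) : Contraction (X × Y) where
  toFun := ⟨fun q => (H.toFun (q.1.1, q.2), K.toFun (q.1.2, q.2)), by fun_prop⟩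
  apex := (H.apex, K.apex)
  map_zero x := by simp [H.map_zero, K.map_zero]
  map_one x := by simp [H.map_one, K.map_one]

/-- The contraction of the unit interval. -/
noncomputable def contractionI : Contraction unitInterval :=
  starContraction (p := (0 : ℝ)) ((convex_Icc (0 : ℝ) 1).starConvex (by simp)) (by simp)

/-- The contraction of a point. -/
def contractionUnit : Contraction Unit where
  toFun := ContinuousMap.const _ ()
  apex := ()
  map_zero _ := rfl
  map_one _ := rfl

/-- The straight line contraction of a simplex. -/
noncomputable def contractionSimplex (n : ℕ) (p : Simplex n) : Contraction (Simplex n) :=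
  starContraction ((convex_stdSimplex ℝ (Fin (n + 1))).starConvex p.2) p.2

lemma exists_bd_of_contraction (H : Contraction X) {c : Chain X} (hc : bd c = 0)
    (ha : aug c = 0) : bd (H.cone c) = c := by
  rw [H.bd_cone, hc, ha]; simp

lemma Contraction.aug_cone (H : Contraction X) (c : Chain X) : aug (H.cone c) = 0 := by
  have : aug.comp H.cone = 0 := hom_ext fun σ => by
    simp only [LinearMap.comp_apply, cone_bas, aug_bas, LinearMap.zero_apply]
    exact if_neg (Nat.succ_ne_zero _)
  exact LinearMap.congr_fun this c

/-- The universal singular simplex. -/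
def univS (n : ℕ) : Sing (Simplex n) := ⟨n, ContinuousMap.id _⟩

lemma pushS_univS (σ : Sing X) : pushS σ.map (univS σ.dim) = σ := rfl

lemma map_bdS_congr {V : Type} [AddCommGroup V] [Module ℚ V] {n : ℕ} {σ : Sing X}
    {f g : Chain X →ₗ[ℚ] V} (h : ∀ τ : Sing X, τ.dim = n → f (bas τ) = g (bas τ))
    (hσ : σ.dim = n + 1) : f (bdS σ) = g (bdS σ) := by
  simp only [bdS_of_dim_succ hσ, map_sum, map_smul]
  refine Finset.sum_congr rfl fun i _ => ?_
  rw [h _ rfl]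

section Natural

variable {K : Type} [TopologicalSpace K]

/-- The natural transformation of chains with the given universal values. -/
noncomputable def nat (φ : ∀ n, Chain (Simplex n × K)) : Chain X →ₗ[ℚ] Chain (X × K) :=
  lext fun σ => push (σ.map.prodMap (ContinuousMap.id K)) (φ σ.dim)

lemma nat_bas (φ : ∀ n, Chain (Simplex n × K)) (σ : Sing X) :
    nat φ (bas σ) = push (σ.map.prodMap (ContinuousMap.id K)) (φ σ.dim) :=
  lext_bas _ _

lemma nat_push (φ : ∀ n, Chain (Simplex n × K)) (g : C(X, Y)) (c : Chain X) :
    nat φ (push g c) = push (g.prodMap (ContinuousMap.id K)) (nat φ c) := by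
  have : (nat φ).comp (push g) = (push (g.prodMap (ContinuousMap.id K))).comp (nat φ) :=
    hom_ext fun σ => by
      simp only [LinearMap.comp_apply, push_bas, nat_bas, ← push_comp]
      rfl
  exact LinearMap.congr_fun this c

lemma nat_bas_eq_push (φ : ∀ n, Chain (Simplex n × K)) (σ : Sing X) :
    nat φ (bas σ) = push (σ.map.prodMap (ContinuousMap.id K)) (nat φ (bas (univS σ.dim))) := by
  rw [← nat_push, push_bas, pushS_univS]

lemma nat_bdS_eq_push (φ : ∀ n, Chain (Simplex n × K)) (σ : Sing X) :
    nat φ (bdS σ) = push (σ.map.prodMap (ContinuousMap.id K)) (nat φ (bdS (univS σ.dim))) := by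
  rw [← nat_push, push_bdS, pushS_univS]

lemma nat_univS (φ : ∀ n, Chain (Simplex n × K)) (n : ℕ) : nat φ (bas (univS n)) = φ n := by
  rw [nat_bas]
  exact push_id _

/-- The value of a natural transformation on the boundary of a universal simplex. -/
noncomputable def natFaces (n : ℕ) : Chain (Simplex n × K) →ₗ[ℚ] Chain (Simplex (n + 1) × K) :=
  ∑ i ∈ range (n + 2), (-1 : ℚ) ^ i •
    push ((vertexMap n (n + 1) (coface i)).prodMap (ContinuousMap.id K))

lemma nat_bdS_univS (φ : ∀ n, Chain (Simplex n × K)) (n : ℕ) :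
    nat φ (bdS (univS (n + 1))) = natFaces n (φ n) := by
  rw [bdS_of_dim_succ (σ := univS (n + 1)) (n := n) rfl, natFaces, map_sum, LinearMap.sum_apply]
  refine Finset.sum_congr rfl fun i _ => ?_
  rw [map_smul, nat_bas, LinearMap.smul_apply]
  rfl

variable (H : ∀ n, Contraction (Simplex n × K)) (φ : ∀ n, Chain (Simplex n × K))

/-- The universal values of the natural homotopy produced by acyclic models. -/
noncomputable def modelHomotopy : ∀ n, Chain (Simplex n × K)
  | 0 => (H 0).cone (φ 0)
  | n + 1 => (H (n + 1)).cone (φ (n + 1) - natFaces n (modelHomotopy n))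

lemma modelHomotopy_spec (h : ∀ n, bd (φ n) = nat φ (bdS (univS n))) (ha : ∀ n, aug (φ n) = 0)
    (n : ℕ) : bd (modelHomotopy H φ n) + nat (modelHomotopy H φ) (bdS (univS n)) = φ n := by
  induction n with
  | zero =>
    have h0 := h 0
    rw [bdS_of_dim_zero (σ := univS 0) rfl, map_zero] at h0 ⊢
    rw [add_zero, modelHomotopy, exists_bd_of_contraction _ h0 (ha 0)]
  | succ n ih =>
    have key : bd (nat (modelHomotopy H φ) (bdS (univS (n + 1)))) =
        nat φ (bdS (univS (n + 1))) := by
      have : (bd.comp (nat (modelHomotopy H φ)) + (nat (modelHomotopy H φ)).comp bd :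
          Chain (Simplex (n + 1)) →ₗ[ℚ] _)
          (bdS (univS (n + 1))) = nat φ (bdS (univS (n + 1))) := by
        refine map_bdS_congr (n := n) (fun τ hτ => ?_) rfl
        obtain ⟨d, t⟩ := τ
        obtain rfl : d = n := hτ
        rw [LinearMap.add_apply, LinearMap.comp_apply, LinearMap.comp_apply, bd_bas,
          nat_bas_eq_push, nat_bdS_eq_push, ← push_bd, ← map_add, nat_univS, ih, nat_bas]
      rw [LinearMap.add_apply, LinearMap.comp_apply, LinearMap.comp_apply, ← bd_bas, bd_bd,
        map_zero, add_zero] at this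
      rw [← bd_bas, this]
    have haug : aug (nat (modelHomotopy H φ) (bdS (univS (n + 1)))) = 0 := by
      have h0 : aug (modelHomotopy H φ n) = 0 := by
        cases n <;> exact Contraction.aug_cone _ _
      rw [nat_bdS_univS, natFaces, LinearMap.sum_apply, map_sum]
      refine Finset.sum_eq_zero fun i _ => ?_
      rw [LinearMap.smul_apply, map_smul, aug_push, h0, smul_zero]
    rw [modelHomotopy, ← nat_bdS_univS, exists_bd_of_contraction]
    · abel
    · rw [map_sub, key, h, sub_self]
    · rw [map_sub, haug, ha, sub_self]

lemma bd_nat_modelHomotopy (h : ∀ n, bd (φ n) = nat φ (bdS (univS n)))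
    (ha : ∀ n, aug (φ n) = 0) (c : Chain X) :
    bd (nat (modelHomotopy H φ) c) + nat (modelHomotopy H φ) (bd c) = nat φ c := by
  have : bd.comp (nat (modelHomotopy H φ)) + (nat (modelHomotopy H φ)).comp (bd (X := X)) =
      nat φ := hom_ext fun σ => by
    rw [LinearMap.add_apply, LinearMap.comp_apply, LinearMap.comp_apply, bd_bas,
      nat_bas_eq_push, nat_bdS_eq_push, ← push_bd, ← map_add, nat_univS,
      modelHomotopy_spec H φ h ha, nat_bas]
  exact LinearMap.congr_fun this c

lemma aug_nat_modelHomotopy (c : Chain X) : aug (nat (modelHomotopy H φ) c) = 0 := by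
  have : aug.comp (nat (X := X) (modelHomotopy H φ)) = 0 := hom_ext fun σ => by
    have h0 : aug (modelHomotopy H φ σ.dim) = 0 := by
      cases σ.dim <;> exact Contraction.aug_cone _ _
    rw [LinearMap.comp_apply, nat_bas, aug_push, h0, LinearMap.zero_apply]
  exact LinearMap.congr_fun this c

end Natural

section Supported

/-- The chains supported in a subset. -/
noncomputable def chainsIn (U : Set X) : Submodule ℚ (Chain X) :=
  Finsupp.supported ℚ ℚ {σ : Sing X | ∀ x, σ.map x ∈ U}

lemma bas_mem_chainsIn {U : Set X} {σ : Sing X} (h : ∀ x, σ.map x ∈ U) : bas σ ∈ chainsIn U :=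
  Finsupp.single_mem_supported ℚ _ h

lemma chainsIn_induction {U : Set X} {V : Type} [AddCommGroup V] [Module ℚ V]
    (f : Chain X →ₗ[ℚ] V) (p : Submodule ℚ V)
    (h : ∀ σ : Sing X, (∀ x, σ.map x ∈ U) → f (bas σ) ∈ p) {c : Chain X} (hc : c ∈ chainsIn U) :
    f c ∈ p := by
  rw [chainsIn, Finsupp.supported_eq_span_single] at hc
  have : Submodule.span ℚ ((fun σ => Finsupp.single σ (1 : ℚ)) '' {σ : Sing X | ∀ x, σ.map x ∈ U}) ≤
      p.comap f := by
    rw [Submodule.span_le]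
    rintro _ ⟨σ, hσ, rfl⟩
    exact h σ hσ
  exact this hc

lemma chainsIn_mono {U V : Set X} (h : U ⊆ V) : chainsIn U ≤ chainsIn V :=
  Finsupp.supported_mono fun _ hσ x => h (hσ x)

lemma chainsIn_inter (U V : Set X) : chainsIn (U ∩ V) = chainsIn U ⊓ chainsIn V := by
  rw [chainsIn, chainsIn, chainsIn, ← Finsupp.supported_inter]
  congr 1
  ext σ
  exact forall_and

lemma chainsIn_univ : chainsIn (Set.univ : Set X) = ⊤ := by
  rw [chainsIn, ← Finsupp.supported_univ]
  congr 1
  ext σ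
  simp

lemma chainsIn_empty : chainsIn (∅ : Set X) = ⊥ := by
  rw [chainsIn, ← Finsupp.supported_empty]
  congr 1
  ext σ
  simp

lemma push_mem_chainsIn {U : Set X} {V : Set Y} {g : C(X, Y)} (h : Set.MapsTo g U V)
    {c : Chain X} (hc : c ∈ chainsIn U) : push g c ∈ chainsIn V :=
  chainsIn_induction (push g) _ (fun σ hσ => by
    rw [push_bas]
    exact bas_mem_chainsIn fun x => h (hσ x)) hc

lemma bd_mem_chainsIn {U : Set X} {c : Chain X} (hc : c ∈ chainsIn U) : bd c ∈ chainsIn U :=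
  chainsIn_induction bd _ (fun σ hσ => by
    rw [bd_bas, bdS]
    split_ifs
    · exact Submodule.zero_mem _
    · exact Submodule.sum_mem _ fun i _ => Submodule.smul_mem _ _
        (bas_mem_chainsIn fun x => hσ _)) hc

lemma nat_mem_chainsIn {K : Type} [TopologicalSpace K] (φ : ∀ n, Chain (Simplex n × K))
    {U : Set X} {c : Chain X} (hc : c ∈ chainsIn U) : nat φ c ∈ chainsIn (U ×ˢ Set.univ) :=
  chainsIn_induction (nat φ) _ (fun σ hσ => by
    rw [nat_bas]
    refine push_mem_chainsIn (U := Set.univ) (by intro p _; exact ⟨hσ p.1, trivial⟩) ?_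
    rw [chainsIn_univ]
    trivial) hc

/-- The inclusion of a subspace. -/
def incl (U : Set X) : C(U, X) := ⟨Subtype.val, continuous_subtype_val⟩

lemma push_incl_mem (U : Set X) (c : Chain U) : push (incl U) c ∈ chainsIn U :=
  push_mem_chainsIn (U := Set.univ) (fun p _ => p.2) (by rw [chainsIn_univ]; trivial)

lemma exists_push_incl {U : Set X} {c : Chain X} (hc : c ∈ chainsIn U) :
    ∃ e : Chain U, push (incl U) e = c := by
  have := chainsIn_induction LinearMap.id (LinearMap.range (push (incl U))) (fun σ hσ => ?_) hc
  · exact this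
  · exact ⟨bas ⟨σ.dim, ⟨fun x => ⟨σ.map x, hσ x⟩, by fun_prop⟩⟩, push_bas _ _⟩

lemma pushS_injective {g : C(X, Y)} (hg : Function.Injective g) :
    Function.Injective (pushS g) := by
  rintro ⟨n, s⟩ ⟨m, t⟩ h
  simp only [pushS, Sing.mk.injEq] at h
  obtain ⟨rfl, h⟩ := h
  have h := eq_of_heq h
  exact Sing.mk_congr fun x => hg (DFunLike.congr_fun h x)

lemma push_injective {g : C(X, Y)} (hg : Function.Injective g) :
    Function.Injective (push g) := by
  have : ⇑(push g) = Finsupp.mapDomain (pushS g) := by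
    have : push g = Finsupp.lmapDomain ℚ ℚ (pushS g) := hom_ext fun σ => by simp
    rw [this]; rfl
  rw [this]
  exact Finsupp.mapDomain_injective (pushS_injective hg)

end Supported

section Homotopy

/-- The universal values of the difference of the end inclusions of a cylinder. -/
noncomputable def cylinderEnds (n : ℕ) : Chain (Simplex n × unitInterval) :=
  push ((ContinuousMap.id _).prodMk (ContinuousMap.const _ 1)) (bas (univS n)) -
    push ((ContinuousMap.id _).prodMk (ContinuousMap.const _ 0)) (bas (univS n))

lemma nat_cylinderEnds (c : Chain X) : nat cylinderEnds c =
    push ((ContinuousMap.id X).prodMk (ContinuousMap.const _ 1)) c -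
    push ((ContinuousMap.id X).prodMk (ContinuousMap.const _ 0)) c := by
  have : nat cylinderEnds = push ((ContinuousMap.id X).prodMk (ContinuousMap.const _ 1)) -
      push ((ContinuousMap.id X).prodMk (ContinuousMap.const _ 0)) := hom_ext fun σ => by
    rw [nat_bas, LinearMap.sub_apply, cylinderEnds, map_sub, ← push_comp, ← push_comp]
    simp only [push_bas]
    rfl
  rw [this]; rfl

/-- The prism operator. -/
noncomputable def prism : Chain X →ₗ[ℚ] Chain (X × unitInterval) :=
  nat (modelHomotopy (fun n => (contractionSimplex n (Classical.arbitrary _)).prod contractionI)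
    cylinderEnds)

lemma bd_prism (c : Chain X) : bd (prism c) + prism (bd c) =
    push ((ContinuousMap.id X).prodMk (ContinuousMap.const _ 1)) c -
    push ((ContinuousMap.id X).prodMk (ContinuousMap.const _ 0)) c := by
  rw [prism, bd_nat_modelHomotopy, nat_cylinderEnds]
  · intro n
    rw [nat_cylinderEnds, cylinderEnds, map_sub, ← push_bd, ← push_bd, bd_bas]
  · intro n
    rw [cylinderEnds, map_sub, aug_push, aug_push, sub_self]

lemma exists_homotopy_operator (F : C(X × unitInterval, Y)) :
    ∃ P : Chain X →ₗ[ℚ] Chain Y, (∀ c, bd (P c) + P (bd c) =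
        push (F.comp ((ContinuousMap.id X).prodMk (ContinuousMap.const _ 1))) c -
        push (F.comp ((ContinuousMap.id X).prodMk (ContinuousMap.const _ 0))) c) ∧
      (∀ c, aug (P c) = 0) ∧ ∀ (U : Set X) (V : Set Y), (∀ x ∈ U, ∀ t, F (x, t) ∈ V) →
        ∀ c ∈ chainsIn U, P c ∈ chainsIn V := by
  refine ⟨(push F).comp prism, fun c => ?_, fun c => ?_, fun U V h c hc => ?_⟩
  · rw [LinearMap.comp_apply, LinearMap.comp_apply, ← push_bd, ← map_add, bd_prism, map_sub,
      push_comp, push_comp]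
  · rw [LinearMap.comp_apply, aug_push]
    exact aug_nat_modelHomotopy _ _ _
  · exact push_mem_chainsIn (U := U ×ˢ Set.univ) (fun p hp => h p.1 hp.1 p.2)
      (nat_mem_chainsIn _ hc)

end Homotopy

section SelfNatural

/-- The natural endomorphism of chains with the given universal values. -/
noncomputable def natEnd (ψ : ∀ n, Chain (Simplex n)) : Chain X →ₗ[ℚ] Chain X :=
  lext fun σ => push σ.map (ψ σ.dim)

lemma natEnd_bas (ψ : ∀ n, Chain (Simplex n)) (σ : Sing X) :
    natEnd ψ (bas σ) = push σ.map (ψ σ.dim) := lext_bas _ _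

lemma natEnd_push (ψ : ∀ n, Chain (Simplex n)) (g : C(X, Y)) (c : Chain X) :
    natEnd ψ (push g c) = push g (natEnd ψ c) := by
  have : (natEnd ψ).comp (push g) = (push g).comp (natEnd ψ) := hom_ext fun σ => by
    simp only [LinearMap.comp_apply, push_bas, natEnd_bas, ← push_comp]
    rfl
  exact LinearMap.congr_fun this c

lemma natEnd_univS (ψ : ∀ n, Chain (Simplex n)) (n : ℕ) : natEnd ψ (bas (univS n)) = ψ n := by
  rw [natEnd_bas]
  exact push_id _

lemma natEnd_mem_chainsIn (ψ : ∀ n, Chain (Simplex n)) {U : Set X} {c : Chain X}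
    (hc : c ∈ chainsIn U) : natEnd ψ c ∈ chainsIn U :=
  chainsIn_induction (natEnd ψ) _ (fun σ hσ => by
    rw [natEnd_bas]
    refine push_mem_chainsIn (U := Set.univ) (fun p _ => hσ _) ?_
    rw [chainsIn_univ]
    trivial) hc

lemma natEnd_bd {ψ : ∀ n, Chain (Simplex n)} (h : ∀ n, bd (ψ n) = natEnd ψ (bdS (univS n)))
    (c : Chain X) : natEnd ψ (bd c) = bd (natEnd ψ c) := by
  have : (natEnd ψ).comp (bd (X := X)) = bd.comp (natEnd ψ) := hom_ext fun σ => by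
    simp only [LinearMap.comp_apply, bd_bas]
    rw [natEnd_bas, ← push_bd, h, ← natEnd_push, push_bdS, pushS_univS]
  exact LinearMap.congr_fun this c

/-- A natural chain endomorphism preserving the augmentation is naturally homotopic to the
identity. -/
lemma exists_natEnd_homotopy {ψ : ∀ n, Chain (Simplex n)}
    (h : ∀ n, bd (ψ n) = natEnd ψ (bdS (univS n)))
    (ha : ∀ n, aug (ψ n) = aug (bas (univS n))) :
    ∃ θ : ∀ n, Chain (Simplex n), ∀ (X : Type) [TopologicalSpace X] (c : Chain X),
      bd (natEnd θ c) + natEnd θ (bd c) = natEnd ψ c - c := by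
  let j (X : Type) [TopologicalSpace X] : C(X, X × Unit) :=
    (ContinuousMap.id X).prodMk (ContinuousMap.const _ ())
  let φ : ∀ n, Chain (Simplex n × Unit) := fun n => push (j _) (ψ n - bas (univS n))
  have hφ : ∀ (X : Type) [TopologicalSpace X] (c : Chain X),
      nat φ c = push (j X) (natEnd ψ c - c) := fun X _ c => by
    have : nat φ = (push (j X)).comp (natEnd ψ - LinearMap.id) := hom_ext fun σ => by
      rw [nat_bas, LinearMap.comp_apply, LinearMap.sub_apply, natEnd_bas, LinearMap.id_apply,
        ← push_comp]
      have : bas σ = push σ.map (bas (univS σ.dim)) := by rw [push_bas, pushS_univS]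
      rw [this, ← map_sub, ← push_comp]
      rfl
    rw [this]; rfl
  let H : ∀ n, Contraction (Simplex n × Unit) := fun n =>
    (contractionSimplex n (Classical.arbitrary _)).prod contractionUnit
  refine ⟨fun n => push ContinuousMap.fst (modelHomotopy H φ n), fun X _ c => ?_⟩
  have hθ : ∀ c : Chain X, natEnd (fun n => push ContinuousMap.fst (modelHomotopy H φ n)) c =
      push ContinuousMap.fst (nat (modelHomotopy H φ) c) := fun c => by
    have : natEnd (fun n => push ContinuousMap.fst (modelHomotopy H φ n)) =
        (push (ContinuousMap.fst : C(X × Unit, X))).comp (nat (modelHomotopy H φ)) :=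
      hom_ext fun σ => by
        rw [natEnd_bas, LinearMap.comp_apply, nat_bas, ← push_comp, ← push_comp]
        rfl
    rw [this]; rfl
  rw [hθ, hθ, ← push_bd, ← map_add, bd_nat_modelHomotopy, hφ, ← push_comp]
  · exact push_id _
  · intro n
    rw [hφ, ← push_bd, map_sub, h, bd_bas]
  · intro n
    rw [aug_push, map_sub, ha, sub_self]

end SelfNatural

end SingularQ

namespace SingularQ

open Finset

variable {X Y Z : Type} [TopologicalSpace X] [TopologicalSpace Y] [TopologicalSpace Z]

/-- The submodule `B` carries the homology of `A` with respect to the endomorphism `d`: every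
relative cycle of `(A, B)` is a relative boundary. -/
def Acyc {V : Type} [AddCommGroup V] [Module ℚ V] (d : V →ₗ[ℚ] V) (A B : Submodule ℚ V) : Prop :=
  ∀ a ∈ A, d a ∈ B → ∃ e ∈ A, a - d e ∈ B

/-- The alternating sum of the push-forwards along the faces of a simplex. -/
noncomputable def faces (n : ℕ) : Chain (Simplex n) →ₗ[ℚ] Chain (Simplex (n + 1)) :=
  ∑ i ∈ range (n + 2), (-1 : ℚ) ^ i • push (vertexMap n (n + 1) (coface i))

lemma natEnd_bdS_univS (ψ : ∀ n, Chain (Simplex n)) (n : ℕ) :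
    natEnd ψ (bdS (univS (n + 1))) = faces n (ψ n) := by
  rw [bdS_of_dim_succ (σ := univS (n + 1)) (n := n) rfl, faces, map_sum, LinearMap.sum_apply]
  refine Finset.sum_congr rfl fun i _ => ?_
  rw [map_smul, natEnd_bas, LinearMap.smul_apply]
  rfl

/-- The barycentric subdivision of the universal simplex. -/
noncomputable def sdU : ∀ n, Chain (Simplex n)
  | 0 => bas (univS 0)
  | n + 1 => (contractionSimplex (n + 1) stdSimplex.barycenter).cone (faces n (sdU n))

lemma aug_sdU (n : ℕ) : aug (sdU n) = aug (bas (univS n)) := by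
  cases n
  · rfl
  · rw [sdU, Contraction.aug_cone, aug_bas]
    exact (if_neg (Nat.succ_ne_zero _)).symm

lemma natEnd_bas_eq_push (ψ : ∀ n, Chain (Simplex n)) (σ : Sing X) :
    natEnd ψ (bas σ) = push σ.map (natEnd ψ (bas (univS σ.dim))) := by
  rw [← natEnd_push, push_bas, pushS_univS]

lemma natEnd_bdS_eq_push (ψ : ∀ n, Chain (Simplex n)) (σ : Sing X) :
    natEnd ψ (bdS σ) = push σ.map (natEnd ψ (bdS (univS σ.dim))) := by
  rw [← natEnd_push, push_bdS, pushS_univS]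

lemma bd_sdU (n : ℕ) : bd (sdU n) = natEnd sdU (bdS (univS n)) := by
  induction n with
  | zero =>
    rw [bdS_of_dim_zero (σ := univS 0) rfl, map_zero, sdU, bd_bas,
      bdS_of_dim_zero (σ := univS 0) rfl]
  | succ n ih =>
    rw [sdU, ← natEnd_bdS_univS, exists_bd_of_contraction]
    · have : (bd.comp (natEnd sdU)) (bdS (univS (n + 1))) =
          ((natEnd sdU).comp bd) (bdS (univS (n + 1))) := by
        refine map_bdS_congr (n := n) (fun τ hτ => ?_) rfl
        obtain ⟨d, t⟩ := τ
        obtain rfl : d = n := hτ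
        rw [LinearMap.comp_apply, LinearMap.comp_apply, bd_bas, natEnd_bas_eq_push,
          natEnd_bdS_eq_push, ← push_bd, natEnd_univS, ih]
      rw [LinearMap.comp_apply, LinearMap.comp_apply] at this
      rw [this, ← bd_bas, bd_bd, map_zero]
    · have : (aug.comp (natEnd sdU)) (bdS (univS (n + 1))) = aug (bdS (univS (n + 1))) := by
        refine map_bdS_congr (n := n) (fun τ hτ => ?_) rfl
        rw [LinearMap.comp_apply, natEnd_bas, aug_push, aug_sdU, aug_bas, aug_bas]
        rfl
      rw [LinearMap.comp_apply] at this
      rw [this, ← bd_bas, aug_bd]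

/-- The barycentric subdivision operator. -/
noncomputable def sd : Chain X →ₗ[ℚ] Chain X := natEnd sdU

/-- The affine combination of points with the given barycentric coordinates. -/
def aff {n : ℕ} {N : ℕ} (v : Fin (n + 1) → Fin N → ℝ) (x : Simplex n) : Fin N → ℝ :=
  ∑ j, x j • v j

lemma aff_vertexMap {m n N : ℕ} (v : Fin (n + 1) → Fin N → ℝ) (f : ℕ → ℕ) (x : Simplex m) :
    aff v (vertexMap m n f x) = aff (fun j => v (clip n (f j))) x := by
  simp only [aff, vertexMap_apply, Finset.sum_smul, ite_smul, zero_smul]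
  rw [Finset.sum_comm]
  refine Finset.sum_congr rfl fun j _ => ?_
  simp

lemma norm_aff_sub_le {n N : ℕ} {v : Fin (n + 1) → Fin N → ℝ} {c : Fin N → ℝ} {D : ℝ}
    (h : ∀ j, ‖v j - c‖ ≤ D) (x : Simplex n) : ‖aff v x - c‖ ≤ D := by
  have : aff v x - c = ∑ j, x j • (v j - c) := by
    simp only [smul_sub, Finset.sum_sub_distrib, ← Finset.sum_smul, aff]
    rw [show ∑ i, x i = 1 from stdSimplex.sum_eq_one x, one_smul]
  rw [this]
  calc ‖∑ j, x j • (v j - c)‖ ≤ ∑ j, x j * D := by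
        refine norm_sum_le_of_le _ fun j _ => ?_
        rw [norm_smul, Real.norm_of_nonneg (stdSimplex.zero_le _ _)]
        exact mul_le_mul_of_nonneg_left (h j) (stdSimplex.zero_le _ _)
    _ = D := by
        rw [← Finset.sum_mul, show ∑ i, x i = 1 from stdSimplex.sum_eq_one x, one_mul]

lemma norm_aff_sub_aff_le {n N : ℕ} {v : Fin (n + 1) → Fin N → ℝ} {D : ℝ}
    (h : ∀ i j, ‖v i - v j‖ ≤ D) (x y : Simplex n) : ‖aff v x - aff v y‖ ≤ D := by
  refine norm_aff_sub_le (fun j => ?_) x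
  rw [norm_sub_rev]
  exact norm_aff_sub_le (fun i => h i j) y

lemma norm_aff_barycenter_sub_le {n N : ℕ} {v : Fin (n + 1) → Fin N → ℝ} {D : ℝ}
    (h : ∀ i j, ‖v i - v j‖ ≤ D) (x : Simplex n) :
    ‖aff v stdSimplex.barycenter - aff v x‖ ≤ n / (n + 1) * D := by
  rw [norm_sub_rev]
  refine norm_aff_sub_le (fun k => ?_) x
  have hn : (n + 1 : ℝ) ≠ 0 := by positivity
  have : aff v stdSimplex.barycenter - v k =
      ∑ j ∈ univ.erase k, (1 / (n + 1 : ℝ)) • (v j - v k) := by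
    have e : ∑ j ∈ univ.erase k, (1 / (n + 1 : ℝ)) • (v j - v k) =
        ∑ j, (1 / (n + 1 : ℝ)) • (v j - v k) := by
      rw [← Finset.sum_erase_add _ _ (mem_univ k), sub_self, smul_zero, add_zero]
    rw [e]
    simp only [smul_sub, Finset.sum_sub_distrib]
    rw [Finset.sum_const, Finset.card_univ, Fintype.card_fin, ← Nat.cast_smul_eq_nsmul ℝ, smul_smul,
      Nat.cast_add_one, mul_one_div_cancel hn, one_smul, aff]
    congr 1
    refine Finset.sum_congr rfl fun j _ => ?_
    have : (stdSimplex.barycenter : Simplex n) j = ((Fintype.card (Fin (n + 1)) : ℕ) : ℝ)⁻¹ := rfl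
    rw [this]
    simp
  rw [norm_sub_rev, this]
  calc _ ≤ ∑ j ∈ univ.erase k, (1 / (n + 1 : ℝ)) * D := by
        refine norm_sum_le_of_le _ fun j _ => ?_
        rw [norm_smul, Real.norm_of_nonneg (by positivity)]
        exact mul_le_mul_of_nonneg_left (h j k) (by positivity)
    _ = _ := by
        rw [Finset.sum_const, Finset.card_erase_of_mem (mem_univ _)]
        simp
        ring

/-- The affine singular simplices contracting distances of vertices by `n / (n + 1)`. -/
def affContracting (n : ℕ) : Set (Sing (Simplex n)) :=
  {τ | ∃ (w : Fin (n + 1) → Simplex n) (f : C(Simplex n, Simplex n)), τ = ⟨n, f⟩ ∧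
    (∀ (N : ℕ) (v : Fin (n + 1) → Fin N → ℝ) (x : Simplex n),
      aff v (f x) = aff (fun j => aff v (w j)) x) ∧
    ∀ (N : ℕ) (v : Fin (n + 1) → Fin N → ℝ) (D : ℝ), (∀ i j, ‖v i - v j‖ ≤ D) →
      ∀ i j, ‖aff v (w i) - aff v (w j)‖ ≤ n / (n + 1) * D}

lemma aff_vertex {n N : ℕ} (v : Fin (n + 1) → Fin N → ℝ) (j : Fin (n + 1)) :
    aff v (stdSimplex.vertex j) = v j := by
  simp [aff, Pi.single_apply]

lemma aff_coneMap {n N : ℕ} (v : Fin (n + 2) → Fin N → ℝ) (p : Simplex n × unitInterval) :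
    aff v (coneMap n p) = p.2.1 • v 0 + (1 - p.2.1) • aff (fun j => v j.succ) p.1 := by
  rw [aff, Fin.sum_univ_succ, coneMap_zero, aff, Finset.smul_sum]
  congr 1
  refine Finset.sum_congr rfl fun j _ => ?_
  rw [coneMap_succ, mul_smul]

lemma aff_contractionSimplex {n N : ℕ} (v : Fin (n + 1) → Fin N → ℝ) (b x : Simplex n)
    (s : unitInterval) : aff v ((contractionSimplex n b).toFun (x, s)) =
      s.1 • aff v b + (1 - s.1) • aff v x := by
  have : ∀ j, (contractionSimplex n b).toFun (x, s) j = s.1 * b j + (1 - s.1) * x j :=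
    fun j => rfl
  simp only [aff, this, add_smul, mul_smul, Finset.sum_add_distrib, Finset.smul_sum]

lemma sdU_mem (n : ℕ) : sdU n ∈ Finsupp.supported ℚ ℚ (affContracting n) := by
  induction n with
  | zero =>
    refine Finsupp.single_mem_supported ℚ _ ⟨fun j => stdSimplex.vertex j, ContinuousMap.id _,
      rfl, fun N v x => ?_, fun N v D h i j => ?_⟩
    · simp only [aff_vertex]; rfl
    · have : i = j := Fin.ext (by omega)
      simp [this]
  | succ n ih =>
    rw [Finsupp.supported_eq_span_single] at ih
    have : Submodule.span ℚ ((fun i => Finsupp.single i (1 : ℚ)) '' affContracting n) ≤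
        (Finsupp.supported ℚ ℚ (affContracting (n + 1))).comap
          ((contractionSimplex (n + 1) stdSimplex.barycenter).cone.comp (faces n)) := by
      rw [Submodule.span_le]
      rintro _ ⟨_, ⟨w, f, rfl, hf, hw⟩, rfl⟩
      rw [SetLike.mem_coe, Submodule.mem_comap, LinearMap.comp_apply, faces, LinearMap.sum_apply,
        map_sum]
      refine Submodule.sum_mem _ fun i _ => ?_
      rw [LinearMap.smul_apply, map_smul, push_bas, Contraction.cone_bas]
      refine Submodule.smul_mem _ _ (Finsupp.single_mem_supported ℚ _ ?_)
      obtain ⟨t, h, ht⟩ := (contractionSimplex (n + 1) stdSimplex.barycenter).exists_coneS n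
        ((vertexMap n (n + 1) (coface i)).comp f)
      refine ⟨Fin.cons stdSimplex.barycenter fun j => vertexMap n (n + 1) (coface i) (w j), t, h,
        fun N v x => ?_, fun N v D hD => ?_⟩
      · obtain ⟨p, rfl⟩ := coneMap_surjective n x
        rw [ht, aff_contractionSimplex, aff_coneMap]
        simp only [Fin.cons_zero, Fin.cons_succ, ContinuousMap.comp_apply, aff_vertexMap, hf]
      · have h0 : ∀ x : Simplex (n + 1),
            ‖aff v stdSimplex.barycenter - aff v x‖ ≤ (n + 1 : ℕ) / ((n + 1 : ℕ) + 1) * D :=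
          norm_aff_barycenter_sub_le hD
        have hD0 : 0 ≤ D := (norm_nonneg _).trans (hD 0 0)
        refine Fin.cases (Fin.cases ?_ fun j => ?_) (fun i' => Fin.cases ?_ fun j => ?_)
        · exact h0 _
        · exact h0 _
        · rw [norm_sub_rev]
          exact h0 _
        · simp only [Fin.cons_succ, aff_vertexMap]
          refine (hw N _ D (fun _ _ => hD _ _) _ _).trans ?_
          refine mul_le_mul_of_nonneg_right ?_ hD0
          push_cast
          rw [div_le_div_iff₀ (by positivity) (by positivity)]
          nlinarith
    exact this ih

/-- The affine singular simplices with vertices at distance at most `D`. -/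
def affSmall (N n : ℕ) (D : ℝ) : Set (Sing (Simplex N)) :=
  {τ | ∃ (v : Fin (n + 1) → Fin (N + 1) → ℝ) (f : C(Simplex n, Simplex N)), τ = ⟨n, f⟩ ∧
    (∀ x, ⇑(f x) = aff v x) ∧ ∀ i j, ‖v i - v j‖ ≤ D}

lemma sd_mem_affSmall {N n : ℕ} {D : ℝ} {c : Chain (Simplex N)}
    (hc : c ∈ Finsupp.supported ℚ ℚ (affSmall N n D)) :
    sd c ∈ Finsupp.supported ℚ ℚ (affSmall N n (n / (n + 1) * D)) := by
  rw [Finsupp.supported_eq_span_single] at hc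
  refine (Submodule.span_le (p := (Finsupp.supported ℚ ℚ (affSmall N n (n / (n + 1) * D))).comap
    sd)).2 ?_ hc
  rintro _ ⟨_, ⟨v, f, rfl, hf, hv⟩, rfl⟩
  rw [SetLike.mem_coe, Submodule.mem_comap, sd, natEnd_bas]
  have := sdU_mem n
  rw [Finsupp.supported_eq_span_single] at this
  refine (Submodule.span_le (p := (Finsupp.supported ℚ ℚ (affSmall N n (n / (n + 1) * D))).comap
    (push f))).2 ?_ this
  rintro _ ⟨_, ⟨w, g, rfl, hg, hw⟩, rfl⟩
  rw [SetLike.mem_coe, Submodule.mem_comap, push_bas]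
  refine Finsupp.single_mem_supported ℚ _ ⟨fun j => aff v (w j), f.comp g, rfl, fun x => ?_,
    hw _ v D hv⟩
  rw [ContinuousMap.comp_apply, hf, hg]

lemma sd_pow_succ (m : ℕ) (c : Chain X) : (sd ^ (m + 1)) c = sd ((sd ^ m) c) := by
  rw [pow_succ', Module.End.mul_apply]

lemma sd_pow_mem_affSmall (n m : ℕ) : (sd ^ m) (bas (univS n)) ∈
    Finsupp.supported ℚ ℚ (affSmall n n ((n / (n + 1)) ^ m)) := by
  induction m with
  | zero =>
    refine Finsupp.single_mem_supported ℚ _ ⟨fun j => Pi.single j 1, ContinuousMap.id _, rfl,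
      fun x => ?_, fun i j => ?_⟩
    · ext i
      simp [aff, Finset.sum_apply, Pi.single_apply]
    · rw [pow_zero, pi_norm_le_iff_of_nonneg zero_le_one]
      intro k
      simp only [Pi.sub_apply, Pi.single_apply]
      split_ifs <;> simp
  | succ m ih =>
    rw [sd_pow_succ, pow_succ']
    exact sd_mem_affSmall ih

lemma sd_push (g : C(X, Y)) (c : Chain X) : sd (push g c) = push g (sd c) := natEnd_push _ _ _

lemma sd_pow_push (g : C(X, Y)) (m : ℕ) (c : Chain X) :
    (sd ^ m) (push g c) = push g ((sd ^ m) c) := by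
  induction m with
  | zero => rfl
  | succ m ih => rw [sd_pow_succ, sd_pow_succ, ih, sd_push]

lemma sd_mem_chainsIn {U : Set X} {c : Chain X} (h : c ∈ chainsIn U) : sd c ∈ chainsIn U :=
  natEnd_mem_chainsIn _ h

/-- Operators on chains preserving chains in every subset. -/
def Local (D : Chain X →ₗ[ℚ] Chain X) : Prop :=
  ∀ (U : Set X), ∀ c ∈ chainsIn U, D c ∈ chainsIn U

lemma Local.mem_iSup {D : Chain X →ₗ[ℚ] Chain X} (h : Local D) {ι : Type} {U : ι → Set X}
    {c : Chain X} (hc : c ∈ ⨆ i, chainsIn (U i)) : D c ∈ ⨆ i, chainsIn (U i) := by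
  have : ⨆ i, chainsIn (U i) ≤ (⨆ i, chainsIn (U i)).comap D :=
    iSup_le fun i c hc => Submodule.mem_iSup_of_mem i (h _ _ hc)
  exact this hc

lemma local_sd : Local (sd : Chain X →ₗ[ℚ] Chain X) := fun _ _ => sd_mem_chainsIn

lemma exists_sd_pow_homotopy (m : ℕ) : ∃ D : Chain X →ₗ[ℚ] Chain X, Local D ∧
    ∀ c, bd (D c) + D (bd c) = (sd ^ m) c - c := by
  obtain ⟨θ, hθ⟩ := exists_natEnd_homotopy bd_sdU aug_sdU
  induction m with
  | zero => exact ⟨0, fun U c _ => Submodule.zero_mem _, fun c => by simp⟩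
  | succ m ih =>
    obtain ⟨D, hD, h⟩ := ih
    refine ⟨sd.comp D + natEnd θ, fun U c hc => Submodule.add_mem _ (local_sd _ _ (hD _ _ hc))
      (natEnd_mem_chainsIn _ hc), fun c => ?_⟩
    have e1 : bd (sd (D c)) = sd (bd (D c)) := (natEnd_bd bd_sdU _).symm
    have e2 : sd (bd (D c)) + sd (D (bd c)) = (sd ^ (m + 1)) c - sd c := by
      rw [← map_add, h, map_sub, pow_succ', Module.End.mul_apply]
    have e3 : bd (natEnd θ c) + natEnd θ (bd c) = sd c - c := hθ X c
    simp only [LinearMap.add_apply, LinearMap.comp_apply, map_add, e1]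
    rw [← sub_add_sub_cancel _ (sd c), ← e2, ← e3]
    abel

lemma exists_sd_pow_bas_mem {ι : Type} {U : ι → Set X} (hU : ∀ i, IsOpen (U i)) {σ : Sing X}
    (hσ : ∀ x, σ.map x ∈ ⋃ i, U i) : ∃ m, (sd ^ m) (bas σ) ∈ ⨆ i, chainsIn (U i) := by
  obtain ⟨n, s⟩ := σ
  obtain ⟨δ, hδ, h⟩ := lebesgue_number_lemma_of_metric (s := (Set.univ : Set (Simplex n)))
    (c := fun i => s ⁻¹' U i) isCompact_univ (fun i => (hU i).preimage s.continuous)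
    (fun x _ => by simpa using hσ x)
  obtain ⟨m, hm⟩ := exists_pow_lt_of_lt_one hδ
    (show (n / (n + 1) : ℝ) < 1 by rw [div_lt_one (by positivity)]; linarith)
  refine ⟨m, ?_⟩
  have e : bas (⟨n, s⟩ : Sing X) = push s (bas (univS n)) := by rw [push_bas]; rfl
  rw [e, sd_pow_push]
  have := sd_pow_mem_affSmall n m
  rw [Finsupp.supported_eq_span_single] at this
  refine (Submodule.span_le (p := (⨆ i, chainsIn (U i)).comap (push s))).2 ?_ this
  rintro _ ⟨_, ⟨v, f, rfl, hf, hv⟩, rfl⟩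
  rw [SetLike.mem_coe, Submodule.mem_comap, push_bas]
  obtain ⟨i, hi⟩ := h (f (Classical.arbitrary _)) trivial
  refine Submodule.mem_iSup_of_mem i (bas_mem_chainsIn fun x => hi ?_)
  rw [Metric.mem_ball]
  refine lt_of_le_of_lt ?_ hm
  rw [Subtype.dist_eq, dist_eq_norm]
  have h1 := hf x
  have h2 := hf (Classical.arbitrary _)
  have := norm_aff_sub_aff_le hv x (Classical.arbitrary _)
  rw [← h1, ← h2] at this
  exact this

lemma local_sd_pow (m : ℕ) : Local (sd ^ m : Chain X →ₗ[ℚ] Chain X) := fun U c hc => by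
  induction m with
  | zero => exact hc
  | succ m ih =>
    rw [pow_succ', Module.End.mul_apply]
    exact local_sd _ _ ih

lemma exists_sd_pow_mem {ι : Type} {U : ι → Set X} (hU : ∀ i, IsOpen (U i)) {c : Chain X}
    (hc : c ∈ chainsIn (⋃ i, U i)) : ∃ m, (sd ^ m) c ∈ ⨆ i, chainsIn (U i) := by
  rw [chainsIn, Finsupp.supported_eq_span_single] at hc
  induction hc using Submodule.span_induction with
  | mem x h =>
    obtain ⟨σ, hσ, rfl⟩ := h
    exact exists_sd_pow_bas_mem hU hσ
  | zero => exact ⟨0, by simp⟩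
  | add x y _ _ hx hy =>
    obtain ⟨m, hm⟩ := hx
    obtain ⟨k, hk⟩ := hy
    refine ⟨m + k, ?_⟩
    rw [map_add]
    refine Submodule.add_mem _ ?_ ?_
    · rw [add_comm, pow_add, Module.End.mul_apply]
      exact (local_sd_pow k).mem_iSup hm
    · rw [pow_add, Module.End.mul_apply]
      exact (local_sd_pow m).mem_iSup hk
  | smul a x _ hx =>
    obtain ⟨m, hm⟩ := hx
    exact ⟨m, by rw [map_smul]; exact Submodule.smul_mem _ _ hm⟩

/-- Small chains with respect to an open cover carry the homology. -/
theorem acyc_iSup {ι : Type} {U : ι → Set X} (hU : ∀ i, IsOpen (U i)) :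
    Acyc bd (chainsIn (⋃ i, U i)) (⨆ i, chainsIn (U i)) := by
  intro c hc hbc
  obtain ⟨m, hm⟩ := exists_sd_pow_mem hU hc
  obtain ⟨D, hD, h⟩ := exists_sd_pow_homotopy (X := X) m
  refine ⟨-D c, Submodule.neg_mem _ (hD _ _ hc), ?_⟩
  have : c - bd (-D c) = (sd ^ m) c - D (bd c) := by
    rw [map_neg, sub_neg_eq_add, eq_sub_iff_add_eq, add_assoc, h, add_sub_cancel]
  rw [this]
  exact Submodule.sub_mem _ hm (hD.mem_iSup hbc)

theorem acyc_sup {U V : Set X} (hU : IsOpen U) (hV : IsOpen V) :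
    Acyc bd (chainsIn (U ∪ V)) (chainsIn U ⊔ chainsIn V) := by
  have := acyc_iSup (U := fun b : Bool => if b then U else V) (by
    intro b; cases b <;> simpa)
  have e : (⋃ b : Bool, if b then U else V) = U ∪ V := by
    ext x; simp [or_comm]
  rwa [e, iSup_bool_eq, if_pos rfl, if_neg (by simp)] at this

end SingularQ

namespace SingularQ

open Finset

section Algebra

variable {V : Type} [AddCommGroup V] [Module ℚ V]
  {d : V →ₗ[ℚ] V}

lemma Acyc.refl (d : V →ₗ[ℚ] V) (A : Submodule ℚ V) : Acyc d A A :=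
  fun a ha _ => ⟨0, A.zero_mem, by simpa⟩

lemma Acyc.trans (hd : ∀ v, d (d v) = 0) {A B C : Submodule ℚ V} (hBA : B ≤ A) (hCB : C ≤ B)
    (h : Acyc d A B) (h' : Acyc d B C) : Acyc d A C := by
  intro a ha hda
  obtain ⟨e, he, heB⟩ := h a ha (hCB hda)
  obtain ⟨e', he', heC⟩ := h' _ heB (by rwa [map_sub, hd, sub_zero])
  exact ⟨e + e', A.add_mem he (hBA he'), by rwa [map_add, ← _root_.sub_sub]⟩

/-- The Mayer-Vietoris argument for pairs. -/
lemma Acyc.union (hd : ∀ v, d (d v) = 0) {A A₁ A₂ B B₁ B₂ : Submodule ℚ V}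
    (hA : A₁ ⊔ A₂ ≤ A) (hB : B₁ ⊔ B₂ ≤ B) (hBA : B ≤ A) (hBA₁ : B₁ ≤ A₁) (hBA₂ : B₂ ≤ A₂)
    (dA₁ : ∀ a ∈ A₁, d a ∈ A₁) (dA₂ : ∀ a ∈ A₂, d a ∈ A₂)
    (dB₁ : ∀ a ∈ B₁, d a ∈ B₁) (dB₂ : ∀ a ∈ B₂, d a ∈ B₂)
    (lA : Acyc d A (A₁ ⊔ A₂)) (lB : Acyc d B (B₁ ⊔ B₂))
    (h₁ : Acyc d A₁ B₁) (h₂ : Acyc d A₂ B₂) (h₁₂ : Acyc d (A₁ ⊓ A₂) (B₁ ⊓ B₂)) :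
    Acyc d A B := by
  intro a ha hda
  obtain ⟨e, he, h⟩ := lB (d a) hda (by rw [hd]; exact Submodule.zero_mem _)
  obtain ⟨e', he', h'⟩ := lA (a - e) (A.sub_mem ha (hBA he)) (by
    rw [map_sub]; exact sup_le_sup hBA₁ hBA₂ h)
  obtain ⟨b₁, hb₁, b₂, hb₂, hb⟩ := Submodule.mem_sup.1 h
  obtain ⟨a₁, ha₁, a₂, ha₂, hsum⟩ := Submodule.mem_sup.1 h'
  have hz : d a₁ - b₁ = b₂ - d a₂ := by
    have : d a₁ + d a₂ = b₁ + b₂ := by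
      rw [← map_add, hsum, hb, map_sub, map_sub, hd, sub_zero]
    rw [sub_eq_sub_iff_add_eq_add, this, add_comm]
  obtain ⟨w, hw, hy⟩ := h₁₂ (d a₁ - b₁)
    ⟨A₁.sub_mem (dA₁ _ ha₁) (hBA₁ hb₁), by
      rw [SetLike.mem_coe, hz]; exact A₂.sub_mem (hBA₂ hb₂) (dA₂ _ ha₂)⟩
    ⟨by rw [map_sub, hd, zero_sub]; exact B₁.neg_mem (dB₁ _ hb₁), by
      rw [SetLike.mem_coe, hz, map_sub, hd, sub_zero]; exact dB₂ _ hb₂⟩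
  obtain ⟨e₁, he₁, h₁⟩ := h₁ (a₁ - w) (A₁.sub_mem ha₁ hw.1) (by
    have : d (a₁ - w) = b₁ + (d a₁ - b₁ - d w) := by rw [map_sub]; abel
    rw [this]; exact B₁.add_mem hb₁ hy.1)
  obtain ⟨e₂, he₂, h₂⟩ := h₂ (a₂ + w) (A₂.add_mem ha₂ hw.2) (by
    have : d (a₂ + w) = b₂ - (d a₁ - b₁ - d w) := by rw [map_add, hz]; abel
    rw [this]; exact B₂.sub_mem hb₂ hy.2)
  refine ⟨e' + e₁ + e₂, A.add_mem (A.add_mem he' (hA (Submodule.mem_sup_left he₁)))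
    (hA (Submodule.mem_sup_right he₂)), ?_⟩
  have : a - d (e' + e₁ + e₂) = e + ((a₁ - w - d e₁) + (a₂ + w - d e₂)) := by
    have : a = a₁ + a₂ + d e' + e := by rw [hsum]; abel
    rw [this, map_add, map_add]; abel
  rw [this]
  exact B.add_mem he (hB (Submodule.add_mem_sup h₁ h₂))

/-- Relative acyclicity passes to a direct summand. -/
lemma Acyc.of_projection {A B : Submodule ℚ V} (h : Acyc d A B) {F : Submodule ℚ V}
    (p : V →ₗ[ℚ] V) (hp : ∀ v, p v ∈ F) (hF : ∀ v ∈ F, p v = v) (hpd : ∀ v, p (d v) = d (p v))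
    (hA : ∀ v ∈ A, p v ∈ A) (hB : ∀ v ∈ B, p v ∈ B) : Acyc d (A ⊓ F) (B ⊓ F) := by
  intro a ha hda
  obtain ⟨e, he, heB⟩ := h a ha.1 hda.1
  refine ⟨p e, ⟨hA _ he, hp _⟩, ?_⟩
  rw [← hpd]
  nth_rw 1 [← hF a ha.2]
  rw [← map_sub]
  exact ⟨hB _ heB, hp _⟩

end Algebra

section OpenInduction

variable {X : Type}

lemma finite_union_induction {P : Set X → Prop} {𝓑 : Set (Set X)} (h0 : P ∅)
    (hinter : ∀ U ∈ 𝓑, ∀ V ∈ 𝓑, U ∩ V ∈ 𝓑) (hP : ∀ U ∈ 𝓑, P U)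
    (hunion : ∀ U V, P U → P V → P (U ∩ V) → P (U ∪ V)) (n : ℕ) :
    ∀ f : Fin n → Set X, (∀ i, f i ∈ 𝓑) → P (⋃ i, f i) := by
  induction n with
  | zero => intro f _; simpa using h0
  | succ n ih =>
    intro f hf
    have e : (⋃ i, f i) = f 0 ∪ ⋃ i : Fin n, f i.succ := by
      ext x; simp [Fin.exists_fin_succ]
    rw [e]
    refine hunion _ _ (hP _ (hf 0)) (ih _ fun i => hf _) ?_
    rw [Set.inter_iUnion]
    exact ih _ fun i => hinter _ (hf _) _ (hf _)

lemma union_induction {P : Set X → Prop} {𝓑 : Set (Set X)} (h0 : P ∅)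
    (hinter : ∀ U ∈ 𝓑, ∀ V ∈ 𝓑, U ∩ V ∈ 𝓑) (hP : ∀ U ∈ 𝓑, P U)
    (hunion : ∀ U V, P U → P V → P (U ∩ V) → P (U ∪ V))
    (hdir : ∀ (ι : Type) (U : ι → Set X), Nonempty ι → Directed (· ⊆ ·) U → (∀ i, P (U i)) →
      P (⋃ i, U i)) {S : Set (Set X)} (hS : S ⊆ 𝓑) : P (⋃₀ S) := by
  classical
  have e : ⋃₀ S = ⋃ F : {F : Finset (Set X) // (F : Set (Set X)) ⊆ S}, ⋃₀ (F.1 : Set (Set X)) := by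
    ext x
    simp only [Set.mem_sUnion, Set.mem_iUnion, Subtype.exists, exists_prop]
    constructor
    · rintro ⟨U, hU, hx⟩
      exact ⟨{U}, by simpa using hU, U, by simp, hx⟩
    · rintro ⟨F, hF, U, hU, hx⟩
      exact ⟨U, hF hU, hx⟩
  rw [e]
  refine hdir _ _ ⟨⟨∅, by simp⟩⟩ ?_ ?_
  · rintro ⟨F, hF⟩ ⟨F', hF'⟩
    refine ⟨⟨F ∪ F', by simp [hF, hF']⟩, ?_, ?_⟩ <;>
    · refine Set.sUnion_subset_sUnion ?_
      simp
  · rintro ⟨F, hF⟩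
    have : ⋃₀ (F : Set (Set X)) = ⋃ i : Fin F.card, (F.equivFin.symm i : Set X) := by
      ext x
      simp only [Set.mem_sUnion, Set.mem_iUnion, Finset.mem_coe]
      constructor
      · rintro ⟨U, hU, hx⟩
        exact ⟨F.equivFin ⟨U, hU⟩, by simpa using hx⟩
      · rintro ⟨i, hx⟩
        exact ⟨_, (F.equivFin.symm i).2, hx⟩
    rw [this]
    exact finite_union_induction h0 hinter hP hunion _ _ fun i => hS (hF (F.equivFin.symm i).2)

/-- Induction over the admissible sets, given intersection-stable local bases. -/
lemma local_basis_induction {P adm : Set X → Prop} (h0 : P ∅)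
    (hadm : ∀ U V, adm U → adm V → adm (U ∩ V))
    (hunion : ∀ U V, P U → P V → P (U ∩ V) → P (U ∪ V))
    (hdir : ∀ (ι : Type) (U : ι → Set X), Nonempty ι → Directed (· ⊆ ·) U → (∀ i, P (U i)) →
      P (⋃ i, U i))
    {κ : Type} (D : κ → Set X) (𝓑 : κ → Set (Set X)) (hD : ∀ x, ∃ k, x ∈ D k)
    (hinter : ∀ k, ∀ U ∈ 𝓑 k, ∀ V ∈ 𝓑 k, U ∩ V ∈ 𝓑 k) (hP : ∀ k, ∀ U ∈ 𝓑 k, P U)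
    (hadm' : ∀ k, ∀ U ∈ 𝓑 k, adm U ∧ U ⊆ D k)
    (hbasis : ∀ k U x, adm U → x ∈ U → x ∈ D k → ∃ B ∈ 𝓑 k, x ∈ B ∧ B ⊆ U) {U : Set X}
    (hU : adm U) : P U := by
  have h1 : ∀ k V, adm V → V ⊆ D k → P V := by
    intro k V hV hVD
    have : V = ⋃₀ {B | B ∈ 𝓑 k ∧ B ⊆ V} := by
      ext x
      simp only [Set.mem_sUnion, Set.mem_ofPred_eq]
      constructor
      · intro hx
        obtain ⟨B, hB, hxB, hBV⟩ := hbasis k V x hV hx (hVD hx)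
        exact ⟨B, ⟨hB, hBV⟩, hxB⟩
      · rintro ⟨B, ⟨_, hBV⟩, hx⟩
        exact hBV hx
    rw [this]
    exact union_induction h0 (hinter k) (hP k) hunion hdir fun B hB => hB.1
  have : U = ⋃₀ {V | (adm V ∧ ∃ k, V ⊆ D k) ∧ V ⊆ U} := by
    ext x
    simp only [Set.mem_sUnion, Set.mem_ofPred_eq]
    constructor
    · intro hx
      obtain ⟨k, hk⟩ := hD x
      obtain ⟨B, hB, hxB, hBU⟩ := hbasis k U x hU hx hk
      exact ⟨B, ⟨⟨(hadm' k B hB).1, k, (hadm' k B hB).2⟩, hBU⟩, hxB⟩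
    · rintro ⟨B, ⟨_, hBV⟩, hx⟩
      exact hBV hx
  rw [this]
  refine union_induction (𝓑 := {V | adm V ∧ ∃ k, V ⊆ D k}) h0 ?_ ?_ hunion hdir fun B hB => hB.1
  · rintro V ⟨hV, k, hk⟩ W ⟨hW, _⟩
    exact ⟨hadm _ _ hV hW, k, Set.inter_subset_left.trans hk⟩
  · rintro V ⟨hV, k, hk⟩
    exact h1 k V hV hk

end OpenInduction

section Directed

variable {X : Type} [TopologicalSpace X]

lemma exists_mem_chainsIn_of_directed {ι : Type} [Nonempty ι] {U : ι → Set X}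
    (hU : ∀ i, IsOpen (U i)) (hdir : Directed (· ⊆ ·) U) {c : Chain X}
    (hc : c ∈ chainsIn (⋃ i, U i)) : ∃ i, c ∈ chainsIn (U i) := by
  rw [chainsIn, Finsupp.supported_eq_span_single] at hc
  induction hc using Submodule.span_induction with
  | mem x h =>
    obtain ⟨σ, hσ, rfl⟩ := h
    obtain ⟨i, hi⟩ := (isCompact_range σ.map.continuous).elim_directed_cover U hU
      (by rintro _ ⟨x, rfl⟩; exact hσ x) hdir
    exact ⟨i, bas_mem_chainsIn fun x => hi ⟨x, rfl⟩⟩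
  | zero => exact ⟨Classical.arbitrary _, Submodule.zero_mem _⟩
  | add x y _ _ hx hy =>
    obtain ⟨i, hi⟩ := hx
    obtain ⟨j, hj⟩ := hy
    obtain ⟨k, hik, hjk⟩ := hdir i j
    exact ⟨k, Submodule.add_mem _ (chainsIn_mono hik hi) (chainsIn_mono hjk hj)⟩
  | smul a x _ hx =>
    obtain ⟨i, hi⟩ := hx
    exact ⟨i, Submodule.smul_mem _ _ hi⟩

end Directed

section Perm

variable {Z : Type} [TopologicalSpace Z] {k : ℕ}

/-- The permutation of the coordinates of a power. -/
def permMap (Z : Type) [TopologicalSpace Z] {k : ℕ} (g : Equiv.Perm (Fin k)) :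
    C(Fin k → Z, Fin k → Z) :=
  ⟨fun x => x ∘ g, by fun_prop⟩

lemma push_permMap_mul (g h : Equiv.Perm (Fin k)) (c : Chain (Fin k → Z)) :
    push (permMap Z (g * h)) c = push (permMap Z h) (push (permMap Z g) c) := by
  rw [← push_comp]; rfl

lemma push_permMap_one (c : Chain (Fin k → Z)) : push (permMap Z 1) c = c := push_id c

/-- The chains invariant under a group of permutations of the coordinates. -/
noncomputable def fixC (Z : Type) [TopologicalSpace Z] {k : ℕ} (G : Subgroup (Equiv.Perm (Fin k))) :
    Submodule ℚ (Chain (Fin k → Z)) :=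
  ⨅ g : G, LinearMap.ker (push (permMap Z g.1) - LinearMap.id)

lemma mem_fixC {G : Subgroup (Equiv.Perm (Fin k))} {c : Chain (Fin k → Z)} :
    c ∈ fixC Z G ↔ ∀ g ∈ G, push (permMap Z g) c = c := by
  simp [fixC, Submodule.mem_iInf, sub_eq_zero]

open Classical in
/-- Averaging of chains over a group of permutations of the coordinates. -/
noncomputable def avgC (Z : Type) [TopologicalSpace Z] {k : ℕ} (G : Subgroup (Equiv.Perm (Fin k))) :
    Chain (Fin k → Z) →ₗ[ℚ] Chain (Fin k → Z) :=
  (Fintype.card G : ℚ)⁻¹ • ∑ g : G, push (permMap Z g.1)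

variable (G : Subgroup (Equiv.Perm (Fin k)))

open Classical in
lemma avgC_apply (c : Chain (Fin k → Z)) : avgC Z G c =
    (Fintype.card G : ℚ)⁻¹ • ∑ g : G, push (permMap Z g.1) c := by
  simp [avgC]

lemma push_avgC {g : Equiv.Perm (Fin k)} (hg : g ∈ G) (c : Chain (Fin k → Z)) :
    push (permMap Z g) (avgC Z G c) = avgC Z G c := by
  classical
  rw [avgC_apply, map_smul, map_sum]
  congr 1
  simp only [← push_permMap_mul]
  exact Fintype.sum_equiv (Equiv.mulRight (⟨g, hg⟩ : G)) _ _ fun _ => rfl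

lemma avgC_push {g : Equiv.Perm (Fin k)} (hg : g ∈ G) (c : Chain (Fin k → Z)) :
    avgC Z G (push (permMap Z g) c) = avgC Z G c := by
  classical
  rw [avgC_apply, avgC_apply]
  congr 1
  simp only [← push_permMap_mul]
  exact Fintype.sum_equiv (Equiv.mulLeft (⟨g, hg⟩ : G)) _ _ fun _ => rfl

lemma avgC_mem (c : Chain (Fin k → Z)) : avgC Z G c ∈ fixC Z G :=
  mem_fixC.2 fun _ hg => push_avgC G hg c

lemma avgC_of_mem {c : Chain (Fin k → Z)} (hc : c ∈ fixC Z G) : avgC Z G c = c := by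
  classical
  rw [avgC_apply]
  rw [Finset.sum_congr rfl fun (g : G) _ => mem_fixC.1 hc g.1 g.2, Finset.sum_const,
    Finset.card_univ, ← Nat.cast_smul_eq_nsmul ℚ, smul_smul, inv_mul_cancel₀, one_smul]
  exact Nat.cast_ne_zero.2 Fintype.card_ne_zero

lemma avgC_bd (c : Chain (Fin k → Z)) : avgC Z G (bd c) = bd (avgC Z G c) := by
  classical
  simp only [avgC_apply, map_smul, map_sum, push_bd]

/-- Stability of a set under a group of permutations of the coordinates. -/
def Stable (W : Set (Fin k → Z)) : Prop := ∀ g ∈ G, Set.MapsTo (permMap Z g) W W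

variable {G}

lemma Stable.inter {U V : Set (Fin k → Z)} (hU : Stable G U) (hV : Stable G V) :
    Stable G (U ∩ V) := fun g hg _ hx => ⟨hU g hg hx.1, hV g hg hx.2⟩

lemma avgC_mem_chainsIn {U : Set (Fin k → Z)} (hU : Stable G U) {c : Chain (Fin k → Z)}
    (hc : c ∈ chainsIn U) : avgC Z G c ∈ chainsIn U := by
  classical
  rw [avgC_apply]
  exact Submodule.smul_mem _ _ (Submodule.sum_mem _ fun g _ => push_mem_chainsIn (hU g.1 g.2) hc)

lemma bd_mem_fixC {c : Chain (Fin k → Z)} (hc : c ∈ fixC Z G) : bd c ∈ fixC Z G :=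
  mem_fixC.2 fun g hg => by rw [push_bd, mem_fixC.1 hc g hg]

lemma Acyc.fix {A B : Submodule ℚ (Chain (Fin k → Z))} (h : Acyc bd A B)
    (hA : ∀ c ∈ A, avgC Z G c ∈ A) (hB : ∀ c ∈ B, avgC Z G c ∈ B) :
    Acyc bd (A ⊓ fixC Z G) (B ⊓ fixC Z G) :=
  h.of_projection (avgC Z G) (avgC_mem G) (fun _ => avgC_of_mem G) (avgC_bd G) hA hB

lemma acyc_sup_fix {U V : Set (Fin k → Z)} (hU : IsOpen U) (hV : IsOpen V) (sU : Stable G U)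
    (sV : Stable G V) : Acyc bd (chainsIn (U ∪ V) ⊓ fixC Z G)
      ((chainsIn U ⊓ fixC Z G) ⊔ (chainsIn V ⊓ fixC Z G)) := by
  have e : (chainsIn U ⊓ fixC Z G) ⊔ (chainsIn V ⊓ fixC Z G) =
      (chainsIn U ⊔ chainsIn V) ⊓ fixC Z G := by
    refine le_antisymm (sup_le (inf_le_inf_right _ le_sup_left) (inf_le_inf_right _ le_sup_right))
      ?_
    rintro c ⟨hc, hf⟩
    obtain ⟨u, hu, v, hv, rfl⟩ := Submodule.mem_sup.1 hc
    rw [← avgC_of_mem G hf, map_add]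
    exact Submodule.add_mem_sup ⟨avgC_mem_chainsIn sU hu, avgC_mem G _⟩
      ⟨avgC_mem_chainsIn sV hv, avgC_mem G _⟩
  rw [e]
  refine (acyc_sup hU hV).fix (fun c hc => avgC_mem_chainsIn ?_ hc) fun c hc => ?_
  · intro g hg x hx
    exact hx.imp (fun h => sU g hg h) fun h => sV g hg h
  · obtain ⟨u, hu, v, hv, rfl⟩ := Submodule.mem_sup.1 hc
    rw [map_add]
    exact Submodule.add_mem_sup (avgC_mem_chainsIn sU hu) (avgC_mem_chainsIn sV hv)

end Perm

end SingularQ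

namespace SingularQ

section Transport

variable {X Y : Type} [TopologicalSpace X] [TopologicalSpace Y]

lemma mem_chainsIn_of_push {g : C(X, Y)} (hg : Function.Injective g) {W : Set Y} {c : Chain X}
    (h : push g c ∈ chainsIn W) : c ∈ chainsIn (g ⁻¹' W) := by
  have e : push g = Finsupp.lmapDomain ℚ ℚ (pushS g) := hom_ext fun σ => by simp
  rw [e] at h
  intro σ hσ x
  classical
  have := h (show pushS g σ ∈ _ from by
    rw [Finset.mem_coe, Finsupp.lmapDomain_apply,
      Finsupp.mapDomain_support_of_injective (pushS_injective hg)]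
    exact Finset.mem_image_of_mem _ hσ)
  exact this x

lemma push_incl_mem_of_mem {U W : Set X} {c : Chain U} (h : c ∈ chainsIn (incl U ⁻¹' W)) :
    push (incl U) c ∈ chainsIn W :=
  push_mem_chainsIn (fun _ hx => hx) h

/-- The map `τ` acts by `-1` on the homology of the pair `(U, W)`. -/
def NegAct (τ : C(X, X)) (U W : Set X) : Prop :=
  ∀ c ∈ chainsIn U, bd c ∈ chainsIn W → c + push τ c ∈ (chainsIn U).map bd ⊔ chainsIn W

lemma NegAct.of_homeomorph {τ : C(X, X)} {τ' : C(Y, Y)} {U W : Set X} {U' W' : Set Y}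
    (h : U ≃ₜ U') (hτ : Set.MapsTo τ U U) (hh : ∀ x : U, (h ⟨τ x, hτ x.2⟩ : Y) = τ' (h x))
    (hW : ∀ x : U, (h x : Y) ∈ W' ↔ (x : X) ∈ W) (H : NegAct τ' U' W') : NegAct τ U W := by
  obtain ⟨τU, hτU⟩ : ∃ τU : C(U, U), ∀ x, τU x = ⟨τ x, hτ x.2⟩ :=
    ⟨⟨fun x => ⟨τ x, hτ x.2⟩, by fun_prop⟩, fun _ => rfl⟩
  obtain ⟨g, hg⟩ : ∃ g : C(U, U'), ∀ x, g x = h x := ⟨⟨h, h.continuous⟩, fun _ => rfl⟩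
  obtain ⟨g', hg'⟩ : ∃ g' : C(U', U), ∀ x, g' x = h.symm x :=
    ⟨⟨h.symm, h.symm.continuous⟩, fun _ => rfl⟩
  intro c hc hbc
  obtain ⟨c, rfl⟩ := exists_push_incl hc
  have key : (incl U').comp (g.comp τU) = τ'.comp ((incl U').comp g) := by
    ext x
    simp only [ContinuousMap.comp_apply, hg, hτU]
    exact hh x
  have key' : τ.comp (incl U) = (incl U).comp τU := by
    ext x
    simp only [ContinuousMap.comp_apply, hτU]
    rfl
  have hinv : ∀ c : Chain U, push g' (push g c) = c := by
    intro c
    rw [← push_comp]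
    convert push_id c
    ext x; simp [hg, hg']
  rw [← push_bd] at hbc
  have hbc := mem_chainsIn_of_push Subtype.val_injective hbc
  have := H (push (incl U') (push g c)) (push_incl_mem _ _) (by
    rw [← push_bd, ← push_bd]
    refine push_incl_mem_of_mem (push_mem_chainsIn ?_ hbc)
    intro x hx
    rw [hg]
    exact (hW x).2 hx)
  obtain ⟨_, ⟨u, hu, rfl⟩, w, hw, huw⟩ := Submodule.mem_sup.1 this
  obtain ⟨u, rfl⟩ := exists_push_incl hu
  have e1 : push τ' (push (incl U') (push g c)) = push (incl U') (push g (push τU c)) := by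
    rw [← push_comp (incl U'), ← push_comp τ', ← key, push_comp, push_comp]
  rw [e1, ← push_bd, ← map_add (push (incl U')), ← map_add (push g)] at huw
  have hw' : w ∈ LinearMap.range (push (incl U')) := by
    refine ⟨push g (c + push τU c) - bd u, ?_⟩
    rw [map_sub, ← huw, add_sub_cancel_left]
  obtain ⟨w, rfl⟩ := hw'
  rw [← map_add (push (incl U'))] at huw
  have huw := push_injective Subtype.val_injective huw
  have huw := congrArg (push (incl U)) (congrArg (push g') huw)
  rw [hinv, map_add, map_add, map_add, ← push_comp (incl U) τU, ← key', push_comp τ, push_bd,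
    push_bd] at huw
  rw [← huw]
  refine Submodule.add_mem_sup ⟨_, push_incl_mem _ _, rfl⟩ ?_
  have hw := mem_chainsIn_of_push Subtype.val_injective hw
  refine push_incl_mem_of_mem (push_mem_chainsIn ?_ hw)
  intro x hx
  have : ((h (h.symm x) : U') : Y) ∈ W' := by rw [h.apply_symm_apply]; exact hx
  rw [hg']
  exact (hW _).1 this

end Transport

section Reflection

variable {E : Type} [NormedAddCommGroup E] [NormedSpace ℝ E]

lemma exists_bd_of_starConvex {S : Set E} {p : E} (h : StarConvex ℝ p S) (hp : p ∈ S)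
    {c : Chain E} (hc : c ∈ chainsIn S) (hb : bd c = 0) (ha : aug c = 0) :
    ∃ v ∈ chainsIn S, bd v = c := by
  obtain ⟨c, rfl⟩ := exists_push_incl hc
  rw [aug_push] at ha
  rw [← push_bd] at hb
  have hb : bd c = 0 := push_injective Subtype.val_injective (by rw [hb, map_zero])
  refine ⟨push (incl S) ((starContraction h hp).cone c), push_incl_mem _ _, ?_⟩
  rw [← push_bd, exists_bd_of_contraction _ hb ha]

/-- The reflection in the kernel of `f` along `e`, at time `t` of the straight line homotopy from
the identity. -/
noncomputable def reflHomotopy (f : E →L[ℝ] ℝ) (e : E) : C(E × unitInterval, E) :=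
  ⟨fun p => p.1 - (2 * p.2.1 * f p.1) • e, by fun_prop⟩

/-- The reflection in the kernel of `f` along `e`. -/
noncomputable def refl (f : E →L[ℝ] ℝ) (e : E) : C(E, E) :=
  ⟨fun x => x - (2 * f x) • e, by fun_prop⟩

/-- A side of the kernel of `f`, together with the points not projecting to `L`. -/
def side (f : E →L[ℝ] ℝ) (e : E) (U : Set E) (L : Submodule ℝ E) : Set E :=
  {x | x ∈ U ∧ (0 < f x ∨ x - f x • e ∉ L)}

lemma exists_starConvex_side {f : E →L[ℝ] ℝ} {e : E} (he : f e = 1) {U : Set E} (hU : IsOpen U)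
    (hcU : Convex ℝ U) {L : Submodule ℝ E} (hL : ∀ x ∈ L, f x = 0) {x₀ : E} (hx : x₀ ∈ U)
    (hxL : x₀ ∈ L) : ∃ p ∈ side f e U L, StarConvex ℝ p (side f e U L) := by
  have : ∃ s : ℝ, 0 < s ∧ x₀ + s • e ∈ U := by
    have hc : Filter.Tendsto (fun s : ℝ => x₀ + s • e) (nhdsWithin 0 (Set.Ioi 0)) (nhds x₀) := by
      have : Continuous fun s : ℝ => x₀ + s • e := by fun_prop
      simpa using (this.tendsto 0).mono_left nhdsWithin_le_nhds
    obtain ⟨s, hs, hs'⟩ := ((hc.eventually (hU.mem_nhds hx)).and self_mem_nhdsWithin).exists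
    exact ⟨s, hs', hs⟩
  obtain ⟨s, hs, hsU⟩ := this
  have hf : f (x₀ + s • e) = s := by simp [hL _ hxL, he]
  refine ⟨x₀ + s • e, ⟨hsU, Or.inl (by rwa [hf])⟩, ?_⟩
  rintro x ⟨hxU, hx'⟩ a b ha hb hab
  refine ⟨hcU hsU hxU ha hb hab, ?_⟩
  rw [or_iff_not_imp_left] at hx' ⊢
  have hfy : f (a • (x₀ + s • e) + b • x) = a * s + b * f x := by
    rw [map_add, map_smul, map_smul, hf]; rfl
  rw [hfy]
  intro h hmem
  have e1 : a • (x₀ + s • e) + b • x - (a * s + b * f x) • e = a • x₀ + b • (x - f x • e) := by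
    module
  rw [e1] at hmem
  have hm : b • (x - f x • e) ∈ L := by
    have := L.sub_mem hmem (L.smul_mem a hxL)
    simpa using this
  rcases hb.eq_or_lt with rfl | hb
  · simp only [add_zero] at hab
    subst hab
    simp at h
    linarith
  · refine hx' ?_ ((L.smul_mem_iff hb.ne').1 hm)
    intro hfx
    apply h
    positivity

lemma isOpen_side (f : E →L[ℝ] ℝ) (e : E) {U : Set E} (hU : IsOpen U) {L : Submodule ℝ E}
    (hLc : IsClosed (L : Set E)) : IsOpen (side f e U L) := by
  have h1 : IsOpen {x : E | 0 < f x} := isOpen_lt continuous_const f.continuous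
  have h2 : IsOpen {x : E | x - f x • e ∉ L} :=
    hLc.isOpen_compl.preimage (f := fun x : E => x - f x • e) (by fun_prop)
  exact hU.inter (h1.union h2)

lemma side_union {f : E →L[ℝ] ℝ} (e : E) (U : Set E) {L : Submodule ℝ E} (hL : ∀ x ∈ L, f x = 0) :
    side f e U L ∪ side (-f) (-e) U L = U \ L := by
  ext x
  have : x - (-f) x • -e = x - f x • e := by simp
  simp only [side, Set.mem_union, Set.mem_ofPred_eq, Set.mem_sdiff, SetLike.mem_coe, this]
  have : (-f) x = - f x := rfl
  rw [this]
  constructor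
  · rintro (⟨hx, h⟩ | ⟨hx, h⟩) <;> refine ⟨hx, fun hxL => ?_⟩ <;> simp [hL x hxL, hxL] at h
  · rintro ⟨hx, h⟩
    rcases lt_trichotomy (f x) 0 with h' | h' | h'
    · exact Or.inr ⟨hx, Or.inl (by linarith)⟩
    · exact Or.inl ⟨hx, Or.inr (by rwa [h', zero_smul, sub_zero])⟩
    · exact Or.inl ⟨hx, Or.inl h'⟩

lemma side_inter (f : E →L[ℝ] ℝ) (e : E) (U : Set E) (L : Submodule ℝ E) :
    side f e U L ∩ side (-f) (-e) U L = {x | x ∈ U ∧ x - f x • e ∉ L} := by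
  ext x
  have h1 : x - (-f) x • -e = x - f x • e := by simp
  have h2 : 0 < (-f) x ↔ f x < 0 := by simp
  simp only [side, Set.mem_inter_iff, Set.mem_ofPred_eq, h1, h2]
  constructor
  · rintro ⟨⟨h, h1⟩, _, h2⟩
    refine ⟨h, ?_⟩
    rcases h1 with h1 | h1
    · exact h2.resolve_left (by linarith)
    · exact h1
  · tauto

lemma reflHomotopy_mem {f : E →L[ℝ] ℝ} {e : E} (he : f e = 1) {U : Set E}
    (hcU : Convex ℝ U) (hρ : Set.MapsTo (refl f e) U U) (L : Submodule ℝ E) {x : E}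
    (hx : x ∈ U ∧ x - f x • e ∉ L) (t : unitInterval) :
    reflHomotopy f e (x, t) ∈ {x | x ∈ U ∧ x - f x • e ∉ L} := by
  have e1 : reflHomotopy f e (x, t) = (1 - t.1) • x + t.1 • refl f e x := by
    simp only [reflHomotopy, refl, ContinuousMap.coe_mk]
    module
  refine ⟨?_, ?_⟩
  · rw [e1]
    exact hcU hx.1 (hρ hx.1) (sub_nonneg.2 t.2.2) t.2.1 (by ring)
  · have : f (reflHomotopy f e (x, t)) = f x - 2 * t.1 * f x := by
      simp [reflHomotopy, he]
    rw [this]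
    have : reflHomotopy f e (x, t) - (f x - 2 * t.1 * f x) • e = x - f x • e := by
      simp only [reflHomotopy, ContinuousMap.coe_mk]
      module
    rw [this]
    exact hx.2

lemma refl_mapsTo_side {f : E →L[ℝ] ℝ} {e : E} (he : f e = 1) {U : Set E}
    (hρ : Set.MapsTo (refl f e) U U) (L : Submodule ℝ E) :
    Set.MapsTo (refl f e) (side (-f) (-e) U L) (side f e U L) := by
  rintro x ⟨hx, h⟩
  have h1 : f (refl f e x) = - f x := by simp [refl, he]; ring
  refine ⟨hρ hx, ?_⟩
  rw [h1]
  refine h.imp id fun h => ?_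
  convert h using 2
  simp only [refl, ContinuousMap.coe_mk, neg_smul, smul_neg, neg_apply]
  module

lemma refl_neg (f : E →L[ℝ] ℝ) (e : E) : refl (-f) (-e) = refl f e := by
  ext x; simp [refl]

lemma negAct_refl {f : E →L[ℝ] ℝ} {e : E} (he : f e = 1) {U : Set E} (hU : IsOpen U)
    (hcU : Convex ℝ U) (hρ : Set.MapsTo (refl f e) U U) {L : Submodule ℝ E}
    (hL : ∀ x ∈ L, f x = 0) (hLc : IsClosed (L : Set E)) : NegAct (refl f e) U (U \ L) := by
  intro c hc hbc
  have he' : (-f) (-e) = 1 := by simp [he]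
  have hL' : ∀ x ∈ L, (-f) x = 0 := fun x hx => by simp [hL x hx]
  by_cases hx : ∃ x₀ ∈ U, x₀ ∈ L
  swap
  · have : U \ (L : Set E) = U := by
      ext x
      simp only [Set.mem_sdiff, SetLike.mem_coe, and_iff_left_iff_imp]
      exact fun h1 h2 => hx ⟨x, h1, h2⟩
    rw [this]
    exact Submodule.mem_sup_right (Submodule.add_mem _ hc (push_mem_chainsIn hρ hc))
  obtain ⟨x₀, hx₀U, hx₀L⟩ := hx
  set P := side f e U L with hP
  set Q := side (-f) (-e) U L with hQ
  obtain ⟨p, hpP, hpS⟩ := exists_starConvex_side he hU hcU hL hx₀U hx₀L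
  obtain ⟨q, hqQ, hqS⟩ := exists_starConvex_side he' hU hcU hL' hx₀U hx₀L
  rw [← hP] at hpP hpS
  rw [← hQ] at hqQ hqS
  have hPQ : P ∪ Q = U \ L := side_union e U hL
  have hPQ' : P ∩ Q = {x | x ∈ U ∧ x - f x • e ∉ L} := side_inter f e U L
  have ρQ : Set.MapsTo (refl f e) Q P := refl_mapsTo_side he hρ L
  have ρP : Set.MapsTo (refl f e) P Q := by
    have := refl_mapsTo_side he' (by rwa [refl_neg]) L (U := U)
    rwa [refl_neg, neg_neg, neg_neg] at this
  obtain ⟨K, hK, hKa, hKU⟩ := exists_homotopy_operator (reflHomotopy f e)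
  have h0 : (reflHomotopy f e).comp ((ContinuousMap.id E).prodMk (ContinuousMap.const _ 0)) =
      ContinuousMap.id E := by ext x; simp [reflHomotopy]
  have h1 : (reflHomotopy f e).comp ((ContinuousMap.id E).prodMk (ContinuousMap.const _ 1)) =
      refl f e := by ext x; simp [reflHomotopy, refl]
  rw [h0, h1] at hK
  simp only [push_id] at hK
  have hKU : ∀ c ∈ chainsIn (P ∩ Q), K c ∈ chainsIn (P ∩ Q) := by
    refine hKU _ _ fun x hx t => ?_
    rw [hPQ'] at hx ⊢
    exact reflHomotopy_mem he hcU hρ L hx t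
  rw [← hPQ] at hbc ⊢
  obtain ⟨w, hw, hz⟩ := acyc_sup (isOpen_side f e hU hLc) (isOpen_side (-f) (-e) hU hLc)
    (bd c) hbc (by rw [bd_bd]; exact Submodule.zero_mem _)
  obtain ⟨zP, hzP, zQ, hzQ, hz⟩ := Submodule.mem_sup.1 hz
  have hy : bd zQ = - bd zP := by
    have := congrArg bd hz
    rw [map_add, map_sub, bd_bd, bd_bd, sub_zero] at this
    exact eq_neg_of_add_eq_zero_right this
  have hyPQ : bd zP ∈ chainsIn (P ∩ Q) := by
    rw [chainsIn_inter]
    refine ⟨bd_mem_chainsIn hzP, ?_⟩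
    have := Submodule.neg_mem _ (bd_mem_chainsIn hzQ)
    rwa [hy, neg_neg] at this
  have hKy := hK (bd zP)
  rw [bd_bd, map_zero, add_zero] at hKy
  have haug : aug zP + aug zQ = 0 := by
    rw [← map_add, hz, map_sub, aug_bd, aug_bd, sub_zero]
  rw [chainsIn_inter] at hKU
  rw [chainsIn_inter] at hyPQ
  obtain ⟨v₁, hv₁, hbv₁⟩ := exists_bd_of_starConvex hpS hpP
    (c := zP + push (refl f e) zQ + K (bd zP))
    (Submodule.add_mem _ (Submodule.add_mem _ hzP (push_mem_chainsIn ρQ hzQ)) (hKU _ hyPQ).1)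
    (by rw [map_add, map_add, ← push_bd, hy, map_neg, hKy]; abel)
    (by rw [map_add, map_add, aug_push, hKa, add_zero, haug])
  obtain ⟨v₂, hv₂, hbv₂⟩ := exists_bd_of_starConvex hqS hqQ
    (c := zQ + push (refl f e) zP - K (bd zP))
    (Submodule.sub_mem _ (Submodule.add_mem _ hzQ (push_mem_chainsIn ρP hzP)) (hKU _ hyPQ).2)
    (by rw [map_sub, map_add, ← push_bd, hy, hKy]; abel)
    (by rw [map_sub, map_add, aug_push, hKa, sub_zero, add_comm, haug])
  have ρPQ : Set.MapsTo (refl f e) (P ∪ Q) (P ∪ Q) := by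
    rintro x (hx | hx)
    · exact Or.inr (ρP hx)
    · exact Or.inl (ρQ hx)
  have hsubU : P ∪ Q ⊆ U := by rw [hPQ]; exact Set.sdiff_subset
  set v := v₁ + v₂ + w + push (refl f e) w with hv
  have hvmem : v ∈ chainsIn (P ∪ Q) :=
    Submodule.add_mem _ (Submodule.add_mem _ (Submodule.add_mem _
      (chainsIn_mono Set.subset_union_left hv₁) (chainsIn_mono Set.subset_union_right hv₂)) hw)
      (push_mem_chainsIn ρPQ hw)
  have hbv : bd v = bd (c + push (refl f e) c) := by
    have e1 : bd c = zP + zQ + bd w := by rw [hz]; abel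
    rw [hv, map_add, map_add, map_add, hbv₁, hbv₂, map_add, ← push_bd, ← push_bd, e1, map_add,
      map_add]
    abel
  set u := c + push (refl f e) c - v with hu
  have hbp : bd (bas (pointS p)) = 0 := by rw [bd_bas]; exact bdS_of_dim_zero rfl
  have hpm : bas (pointS p) ∈ chainsIn (P ∪ Q) := bas_mem_chainsIn fun _ => Or.inl hpP
  obtain ⟨y, hyU, hy'⟩ := exists_bd_of_starConvex (hcU.starConvex hx₀U) hx₀U
    (c := u - aug u • bas (pointS p))
    (Submodule.sub_mem _ (Submodule.sub_mem _ (Submodule.add_mem _ hc (push_mem_chainsIn hρ hc))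
      (chainsIn_mono hsubU hvmem)) (Submodule.smul_mem _ _ (chainsIn_mono hsubU hpm)))
    (by rw [map_sub, map_smul, hbp, smul_zero, sub_zero, hu, map_sub, hbv, sub_self])
    (by rw [map_sub, map_smul, aug_bas, if_pos (show (pointS p).dim = 0 from rfl)]; simp)
  refine Submodule.mem_sup.2 ⟨bd y, ⟨y, hyU, rfl⟩, v + aug u • bas (pointS p),
    Submodule.add_mem _ hvmem (Submodule.smul_mem _ _ hpm), ?_⟩
  rw [hy', hu]
  abel

end Reflection

section Swap

variable {k d : ℕ}

/-- The swap of the coordinates `a` and `b`, in the components belonging to `S`. -/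
def swapOn (a b : Fin k) (S : Finset (Fin d)) : C(Fin k → Fin d → ℝ, Fin k → Fin d → ℝ) :=
  ⟨fun x i j => if j ∈ S then x (Equiv.swap a b i) j else x i j, by
    refine continuous_pi fun i => continuous_pi fun j => ?_
    split_ifs <;> fun_prop⟩

lemma swapOn_apply (a b : Fin k) (S : Finset (Fin d)) (x : Fin k → Fin d → ℝ) (i : Fin k)
    (j : Fin d) : swapOn a b S x i j = if j ∈ S then x (Equiv.swap a b i) j else x i j := rfl

lemma swapOn_univ (a b : Fin k) :
    swapOn a b (Finset.univ : Finset (Fin d)) = permMap (Fin d → ℝ) (Equiv.swap a b) := by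
  ext x i j; simp [swapOn_apply, permMap]

lemma swapOn_empty (a b : Fin k) :
    swapOn a b (∅ : Finset (Fin d)) = ContinuousMap.id _ := by
  ext x i j; simp [swapOn_apply]

lemma swapOn_insert (a b : Fin k) {S : Finset (Fin d)} {l : Fin d} (hl : l ∉ S) :
    swapOn a b (insert l S) = (swapOn a b {l}).comp (swapOn a b S) := by
  ext x i j
  rw [ContinuousMap.comp_apply, swapOn_apply, swapOn_apply, swapOn_apply, swapOn_apply]
  by_cases h : j = l
  · subst h; simp [hl]
  · simp [h]

lemma swapOn_singleton {a b : Fin k} (hab : a ≠ b) (l : Fin d) : ∃ (f : (Fin k → Fin d → ℝ) →L[ℝ] ℝ)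
    (e : Fin k → Fin d → ℝ), f e = 1 ∧ (∀ x, f x = (x a l - x b l) / 2) ∧
      swapOn a b {l} = refl f e := by
  let π : Fin k → (Fin k → Fin d → ℝ) →L[ℝ] ℝ := fun a =>
    (ContinuousLinearMap.proj (R := ℝ) (φ := fun _ : Fin d => ℝ) l).comp
      (ContinuousLinearMap.proj (R := ℝ) (φ := fun _ : Fin k => Fin d → ℝ) a)
  have hf : ∀ x, ((2⁻¹ : ℝ) • (π a - π b)) x = (x a l - x b l) / 2 := by
    intro x
    simp [π]; ring
  refine ⟨(2⁻¹ : ℝ) • (π a - π b),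
    Pi.single a (Pi.single l 1) - Pi.single b (Pi.single l 1), ?_, hf, ?_⟩
  · rw [hf]
    simp [Pi.single_eq_of_ne hab, Pi.single_eq_of_ne hab.symm]
  · ext x i j
    have : refl ((2⁻¹ : ℝ) • (π a - π b))
      (Pi.single a (Pi.single l 1) - Pi.single b (Pi.single l 1)) x i j = x i j -
        (x a l - x b l) * ((Pi.single a (Pi.single l 1 : Fin d → ℝ) : Fin k → Fin d → ℝ) i j -
          (Pi.single b (Pi.single l 1 : Fin d → ℝ) : Fin k → Fin d → ℝ) i j) := by
      simp only [refl, ContinuousMap.coe_mk, hf]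
      simp only [Pi.sub_apply, Pi.smul_apply, smul_eq_mul]
      ring
    rw [this, swapOn_apply]
    simp only [Finset.mem_singleton]
    by_cases hj : j = l
    · subst hj
      rw [if_pos rfl]
      by_cases hia : i = a
      · subst hia; simp [hab]
      · by_cases hib : i = b
        · subst hib; simp [Pi.single_eq_of_ne hab.symm]
        · rw [Equiv.swap_apply_of_ne_of_ne hia hib]; simp [hia, hib]
    · rw [if_neg hj]
      have : ∀ c : Fin k,
          (Pi.single c (Pi.single l 1 : Fin d → ℝ) : Fin k → Fin d → ℝ) i j = 0 := by
        intro c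
        by_cases hic : i = c
        · subst hic; simp [hj]
        · simp [hic]
      rw [this, this]; ring

lemma swapOn_of_eq {a b : Fin k} (S : Finset (Fin d)) {x : Fin k → Fin d → ℝ} (h : x a = x b) :
    swapOn a b S x = x := by
  ext i j
  rw [swapOn_apply]
  split_ifs
  · by_cases hia : i = a
    · subst hia; rw [Equiv.swap_apply_left, h]
    · by_cases hib : i = b
      · subst hib; rw [Equiv.swap_apply_right, h]
      · rw [Equiv.swap_apply_of_ne_of_ne hia hib]
  · rfl

/-- In odd dimensions the swap of two coordinates acts by `-1`. -/
lemma negAct_swap (hd : Odd d) {a b : Fin k} (hab : a ≠ b) {U : Set (Fin k → Fin d → ℝ)}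
    (hU : IsOpen U) (hcU : Convex ℝ U) (hS : ∀ S : Finset (Fin d), Set.MapsTo (swapOn a b S) U U)
    {L : Submodule ℝ (Fin k → Fin d → ℝ)} (hL : ∀ x ∈ L, x a = x b) :
    NegAct (permMap (Fin d → ℝ) (Equiv.swap a b)) U (U \ L) := by
  have hLc : IsClosed (L : Set (Fin k → Fin d → ℝ)) := L.closed_of_finiteDimensional
  have hfix : ∀ (S : Finset (Fin d)), ∀ x ∈ L, swapOn a b S x = x := fun S x hx =>
    swapOn_of_eq S (hL x hx)
  have hinv : ∀ S : Finset (Fin d), ∀ x, swapOn a b S (swapOn a b S x) = x := by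
    intro S x
    ext i j
    simp only [swapOn_apply]
    split_ifs <;> simp
  have hUL : ∀ S : Finset (Fin d), Set.MapsTo (swapOn a b S) (U \ L) (U \ L) := by
    intro S x hx
    refine ⟨hS S hx.1, fun h => hx.2 ?_⟩
    rw [← hinv S x, hfix S _ h]
    exact h
  rw [← swapOn_univ]
  intro c hc hbc
  have key : ∀ S : Finset (Fin d), push (swapOn a b S) c - (-1 : ℚ) ^ S.card • c ∈
      (chainsIn U).map bd ⊔ chainsIn (U \ L) := by
    intro S
    induction S using Finset.induction_on with
    | empty =>
      rw [swapOn_empty, push_id]; simp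
    | insert l S hl ih =>
      obtain ⟨f, e, he, hf, hs⟩ := swapOn_singleton hab l
      have hn := negAct_refl he hU hcU (by rw [← hs]; exact hS _) (L := L)
        (fun x hx => by rw [hf, hL x hx]; simp) hLc
        (push (swapOn a b S) c) (push_mem_chainsIn (hS S) hc)
        (by rw [← push_bd]; exact push_mem_chainsIn (hUL S) hbc)
      rw [← hs, ← push_comp, ← swapOn_insert a b hl] at hn
      have := Submodule.sub_mem _ hn ih
      rw [Finset.card_insert_of_notMem hl]
      convert this using 1
      rw [pow_succ]
      module
  have := key Finset.univ
  rw [Finset.card_univ, Fintype.card_fin, hd.neg_one_pow] at this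
  convert this using 1
  module

lemma norm_swapOn_sub_le (a b : Fin k) (S : Finset (Fin d)) (x y : Fin k → Fin d → ℝ) :
    ‖swapOn a b S x - swapOn a b S y‖ ≤ ‖x - y‖ := by
  refine (pi_norm_le_iff_of_nonneg (norm_nonneg _)).2 fun i =>
    (pi_norm_le_iff_of_nonneg (norm_nonneg _)).2 fun j => ?_
  have h : ∀ i, ‖x i j - y i j‖ ≤ ‖x - y‖ := fun i =>
    (norm_le_pi_norm ((x - y) i) j).trans (norm_le_pi_norm (x - y) i)
  rw [Pi.sub_apply, Pi.sub_apply, swapOn_apply, swapOn_apply]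
  split_ifs
  · exact h _
  · exact h _

end Swap

end SingularQ

namespace SingularQ

section Diagonal

variable {M : Type} [TopologicalSpace M] {k d : ℕ}

/-- The diagonal of a setoid on the index set. -/
def diagonal (M : Type) (π : Setoid (Fin k)) : Set (Fin k → M) := {x | ∀ i j, π i j → x i = x j}

/-- The permutations preserving each class of a setoid. -/
def classPerm (π : Setoid (Fin k)) : Subgroup (Equiv.Perm (Fin k)) where
  carrier := {σ | ∀ i, π (σ i) i}
  mul_mem' {σ τ} hσ hτ i := π.trans (hσ (τ i)) (hτ i)
  one_mem' i := π.refl i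
  inv_mem' {σ} hσ i := π.symm (by simpa using hσ (σ⁻¹ i))

lemma swap_mem_classPerm {π : Setoid (Fin k)} {a b : Fin k} (h : π a b) :
    Equiv.swap a b ∈ classPerm π := by
  intro i
  by_cases hia : i = a
  · subst hia; rw [Equiv.swap_apply_left]; exact π.symm h
  · by_cases hib : i = b
    · subst hib; rw [Equiv.swap_apply_right]; exact h
    · rw [Equiv.swap_apply_of_ne_of_ne hia hib]

lemma comp_eq_of_mem_diagonal {X : Type} {π : Setoid (Fin k)} {x : Fin k → X}
    (hx : x ∈ diagonal X π) {σ : Equiv.Perm (Fin k)} (hσ : σ ∈ classPerm π) : x ∘ σ = x :=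
  funext fun i => hx _ _ (hσ i)

lemma isClosed_diagonal [T2Space M] (π : Setoid (Fin k)) : IsClosed (diagonal M π) := by
  simp only [diagonal, Set.ofPred_forall]
  exact isClosed_iInter fun i => isClosed_iInter fun j => isClosed_iInter fun _ =>
    isClosed_eq (continuous_apply i) (continuous_apply j)

lemma stable_compl_diagonal (π : Setoid (Fin k)) :
    Stable (classPerm π) (diagonal M π)ᶜ := by
  intro σ hσ x hx h
  refine hx ?_
  have h2 := comp_eq_of_mem_diagonal h ((classPerm π).inv_mem hσ)
  have h3 : permMap M σ x ∘ (σ⁻¹ : Equiv.Perm (Fin k)) = x := by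
    ext i; simp [permMap]
  rw [← h3, h2]
  exact h

/-- The chains in `U` are, equivariantly, homologous to chains off the diagonal. -/
def OffDiagonal (π : Setoid (Fin k)) (U : Set (Fin k → M)) : Prop :=
  IsOpen U ∧ Stable (classPerm π) U ∧
    Acyc bd (chainsIn U ⊓ fixC M (classPerm π)) (chainsIn (U \ diagonal M π) ⊓ fixC M (classPerm π))

lemma offDiagonal_of_negAct {π : Setoid (Fin k)} {a b : Fin k} (h : π a b) {U : Set (Fin k → M)}
    (hU : IsOpen U) (hs : Stable (classPerm π) U)
    (hn : NegAct (permMap M (Equiv.swap a b)) U (U \ diagonal M π)) : OffDiagonal π U := by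
  refine ⟨hU, hs, ?_⟩
  rintro c ⟨hc, hf⟩ ⟨hb, _⟩
  have := hn c hc hb
  rw [mem_fixC.1 hf _ (swap_mem_classPerm h)] at this
  obtain ⟨_, ⟨u, hu, rfl⟩, w, hw, huw⟩ := Submodule.mem_sup.1 this
  refine ⟨avgC M _ ((2⁻¹ : ℚ) • u), ⟨avgC_mem_chainsIn hs (Submodule.smul_mem _ _ hu),
    avgC_mem _ _⟩, ?_⟩
  have e : c - bd (avgC M (classPerm π) ((2⁻¹ : ℚ) • u)) =
      avgC M (classPerm π) ((2⁻¹ : ℚ) • w) := by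
    nth_rw 1 [← avgC_of_mem (classPerm π) hf]
    rw [← avgC_bd, ← map_sub]
    congr 1
    have : w = c + c - bd u := by rw [← huw]; abel
    rw [this, map_smul]
    module
  rw [e]
  exact ⟨avgC_mem_chainsIn (hs.inter (stable_compl_diagonal π)) (Submodule.smul_mem _ _ hw),
    avgC_mem _ _⟩

lemma offDiagonal_empty (π : Setoid (Fin k)) : OffDiagonal (M := M) π ∅ := by
  refine ⟨isOpen_empty, fun _ _ => Set.mapsTo_empty _ _, ?_⟩
  rw [Set.empty_sdiff]
  exact Acyc.refl _ _

lemma offDiagonal_of_disjoint {π : Setoid (Fin k)} {U : Set (Fin k → M)}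
    (hU : IsOpen U) (hs : Stable (classPerm π) U) (h : U ⊆ (diagonal M π)ᶜ) : OffDiagonal π U := by
  refine ⟨hU, hs, ?_⟩
  have : U \ diagonal M π = U := Set.inter_eq_left.2 h
  rw [this]
  exact Acyc.refl _ _

lemma Stable.union {Z : Type} [TopologicalSpace Z] {G : Subgroup (Equiv.Perm (Fin k))}
    {U V : Set (Fin k → Z)} (hU : Stable G U) (hV : Stable G V) : Stable G (U ∪ V) :=
  fun g hg _ hx => hx.imp (fun h => hU g hg h) fun h => hV g hg h

lemma OffDiagonal.union [T2Space M] {π : Setoid (Fin k)} {U V : Set (Fin k → M)}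
    (hU : OffDiagonal π U) (hV : OffDiagonal π V) (hUV : OffDiagonal π (U ∩ V)) :
    OffDiagonal π (U ∪ V) := by
  refine ⟨hU.1.union hV.1, hU.2.1.union hV.2.1, ?_⟩
  have hL := (isClosed_diagonal (M := M) π).isOpen_compl
  have sL := stable_compl_diagonal (M := M) π
  have lA := acyc_sup_fix hU.1 hV.1 hU.2.1 hV.2.1
  have lB := acyc_sup_fix (hU.1.inter hL) (hV.1.inter hL) (hU.2.1.inter sL) (hV.2.1.inter sL)
  rw [← Set.union_inter_distrib_right] at lB
  have hfix : ∀ (W : Set (Fin k → M)), ∀ c ∈ chainsIn W ⊓ fixC M (classPerm π),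
      bd c ∈ chainsIn W ⊓ fixC M (classPerm π) :=
    fun W c hc => ⟨bd_mem_chainsIn hc.1, bd_mem_fixC hc.2⟩
  have mono : ∀ {W W' : Set (Fin k → M)}, W ⊆ W' → chainsIn W ⊓ fixC M (classPerm π) ≤
    chainsIn W' ⊓ fixC M (classPerm π) := fun h => inf_le_inf_right _ (chainsIn_mono h)
  refine Acyc.union bd_bd ?_ ?_ (mono Set.inter_subset_left) (mono Set.inter_subset_left)
    (mono Set.inter_subset_left) (hfix U) (hfix V) (hfix (U ∩ (diagonal M π)ᶜ))
    (hfix (V ∩ (diagonal M π)ᶜ)) lA lB hU.2.2 hV.2.2 ?_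
  · exact sup_le (mono Set.subset_union_left) (mono Set.subset_union_right)
  · exact sup_le (mono (Set.inter_subset_inter_left _ Set.subset_union_left))
      (mono (Set.inter_subset_inter_left _ Set.subset_union_right))
  · have h := hUV.2.2
    rw [← inf_inf_distrib_right, ← inf_inf_distrib_right, ← chainsIn_inter, ← chainsIn_inter]
    have : U ∩ (diagonal M π)ᶜ ∩ (V ∩ (diagonal M π)ᶜ) = (U ∩ V) \ diagonal M π := by
      ext x; simp only [Set.mem_inter_iff, Set.mem_compl_iff, Set.mem_sdiff]; tauto
    rw [this]
    exact h

lemma OffDiagonal.iUnion {π : Setoid (Fin k)} {ι : Type} [Nonempty ι] {U : ι → Set (Fin k → M)}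
    (hdir : Directed (· ⊆ ·) U) (hU : ∀ i, OffDiagonal π (U i)) : OffDiagonal π (⋃ i, U i) := by
  refine ⟨isOpen_iUnion fun i => (hU i).1, ?_, ?_⟩
  · intro g hg x hx
    obtain ⟨i, hi⟩ := Set.mem_iUnion.1 hx
    exact Set.mem_iUnion.2 ⟨i, (hU i).2.1 g hg hi⟩
  · rintro c ⟨hc, hf⟩ ⟨hb, hbf⟩
    obtain ⟨i, hi⟩ := exists_mem_chainsIn_of_directed (fun i => (hU i).1) hdir hc
    have hb' : bd c ∈ chainsIn (U i \ diagonal M π) := by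
      have : U i \ diagonal M π = U i ∩ ((⋃ i, U i) \ diagonal M π) := by
        ext x
        simp only [Set.mem_sdiff, Set.mem_inter_iff, Set.mem_iUnion]
        exact ⟨fun h => ⟨h.1, ⟨i, h.1⟩, h.2⟩, fun h => ⟨h.1, h.2.2⟩⟩
      rw [this, chainsIn_inter]
      exact ⟨bd_mem_chainsIn hi, hb⟩
    obtain ⟨e, he, he'⟩ := (hU i).2.2 c ⟨hi, hf⟩ ⟨hb', hbf⟩
    exact ⟨e, ⟨chainsIn_mono (Set.subset_iUnion _ _) he.1, he.2⟩,
      chainsIn_mono (Set.sdiff_subset_sdiff_left (Set.subset_iUnion _ _)) he'.1, he'.2⟩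

lemma offDiagonal_chart (hd : Odd d) (φ : M → OpenPartialHomeomorph M (Fin d → ℝ))
    {π : Setoid (Fin k)} {a b : Fin k} (hab : a ≠ b) (h : π a b) {c : Fin k → M}
    (hc : c ∈ diagonal M π) {B : Set (Fin k → Fin d → ℝ)} (hB : IsOpen B) (hcB : Convex ℝ B)
    (hS : ∀ S : Finset (Fin d), Set.MapsTo (swapOn a b S) B B) (hs : Stable (classPerm π) B)
    (ht : B ⊆ (OpenPartialHomeomorph.pi fun i => φ (c i)).target) :
    OffDiagonal π ((OpenPartialHomeomorph.pi fun i => φ (c i)).source ∩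
      (OpenPartialHomeomorph.pi fun i => φ (c i)) ⁻¹' B) := by
  set Φ := OpenPartialHomeomorph.pi fun i => φ (c i) with hΦ
  have hΦa : ∀ x i, Φ x i = φ (c i) (x i) := fun _ _ => rfl
  have hsrc : ∀ x, x ∈ Φ.source ↔ ∀ i, x i ∈ (φ (c i)).source := fun x => by
    simp [hΦ, OpenPartialHomeomorph.pi]
  have hperm : ∀ σ ∈ classPerm π, ∀ x ∈ Φ.source, permMap M σ x ∈ Φ.source ∧
      Φ (permMap M σ x) = permMap _ σ (Φ x) := by
    intro σ hσ x hx
    have hcσ : ∀ i, c (σ i) = c i := fun i => hc _ _ (hσ i)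
    rw [hsrc] at hx ⊢
    refine ⟨fun i => ?_, ?_⟩
    · have := hx (σ i)
      rwa [hcσ] at this
    · ext i : 1
      change φ (c i) (x (σ i)) = φ (c (σ i)) (x (σ i))
      rw [hcσ]
  have hst : Stable (classPerm π) (Φ.source ∩ Φ ⁻¹' B) := by
    rintro σ hσ x ⟨hx, hxB⟩
    obtain ⟨h1, h2⟩ := hperm σ hσ x hx
    refine ⟨h1, ?_⟩
    rw [Set.mem_preimage, h2]
    exact hs σ hσ hxB
  refine offDiagonal_of_negAct h (Φ.isOpen_inter_preimage hB) hst ?_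
  let L : Submodule ℝ (Fin k → Fin d → ℝ) :=
    { carrier := diagonal (Fin d → ℝ) π
      add_mem' := fun hx hy i j hij => by simp [hx i j hij, hy i j hij]
      zero_mem' := fun _ _ _ => rfl
      smul_mem' := fun r x hx i j hij => by simp [hx i j hij] }
  have himg : Φ '' (Φ.source ∩ Φ ⁻¹' B) = B := by
    ext y
    constructor
    · rintro ⟨x, hx, rfl⟩; exact hx.2
    · intro hy
      refine ⟨Φ.symm y, ⟨Φ.map_target (ht hy), ?_⟩, Φ.right_inv (ht hy)⟩
      rw [Set.mem_preimage, Φ.right_inv (ht hy)]; exact hy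
  refine NegAct.of_homeomorph (Φ.homeomorphOfImageSubsetSource Set.inter_subset_left himg)
    (hst _ (swap_mem_classPerm h)) (fun x => ?_) (fun x => ?_)
    (negAct_swap hd hab hB hcB hS (L := L) fun x hx => hx _ _ h)
  · exact (hperm _ (swap_mem_classPerm h) _ x.2.1).2
  · change Φ x.1 ∈ B \ diagonal (Fin d → ℝ) π ↔ x.1 ∈ _ \ diagonal M π
    refine and_congr (iff_of_true x.2.2 x.2) (not_congr ?_)
    refine forall_congr' fun i => forall_congr' fun j => forall_congr' fun hij => ?_
    rw [hΦa, hΦa, hc i j hij]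
    have hx := (hsrc _).1 x.2.1
    refine ⟨fun h => (φ (c j)).injOn ?_ (hx j) h, fun h => by rw [h]⟩
    rw [← hc i j hij]
    exact hx i

lemma exists_ball_of_mem_diagonal {π : Setoid (Fin k)} {a b : Fin k} (h : π a b)
    {y : Fin k → Fin d → ℝ} (hy : y ∈ diagonal (Fin d → ℝ) π) {V : Set (Fin k → Fin d → ℝ)}
    (hV : IsOpen V) (hyV : y ∈ V) : ∃ B, IsOpen B ∧ Convex ℝ B ∧
      (∀ S : Finset (Fin d), Set.MapsTo (swapOn a b S) B B) ∧ Stable (classPerm π) B ∧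
      y ∈ B ∧ B ⊆ V := by
  obtain ⟨ε, hε, hball⟩ := Metric.isOpen_iff.1 hV y hyV
  refine ⟨Metric.ball y ε, Metric.isOpen_ball, convex_ball _ _, ?_, ?_, Metric.mem_ball_self hε,
    hball⟩
  · intro S x hx
    rw [mem_ball_iff_norm] at hx ⊢
    have := norm_swapOn_sub_le a b S x y
    rw [swapOn_of_eq S (hy _ _ h)] at this
    exact this.trans_lt hx
  · intro σ hσ x hx
    rw [mem_ball_iff_norm] at hx ⊢
    refine lt_of_le_of_lt ((pi_norm_le_iff_of_nonneg (norm_nonneg _)).2 fun i => ?_) hx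
    have : (permMap (Fin d → ℝ) σ x - y) i = (x - y) (σ i) := by
      change x (σ i) - y i = x (σ i) - y (σ i)
      rw [hy _ _ (hσ i)]
    rw [this]
    exact norm_le_pi_norm _ _

lemma offDiagonal [T2Space M] (hd : Odd d) (φ : M → OpenPartialHomeomorph M (Fin d → ℝ))
    (hφ : ∀ x, x ∈ (φ x).source)
    {π : Setoid (Fin k)} {a b : Fin k} (hab : a ≠ b) (h : π a b) {U : Set (Fin k → M)}
    (hU : IsOpen U) (hs : Stable (classPerm π) U) : OffDiagonal π U := by
  have hL := (isClosed_diagonal (M := M) π).isOpen_compl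
  have sL := stable_compl_diagonal (M := M) π
  let adm : Set (Fin k → M) → Prop := fun U => IsOpen U ∧ Stable (classPerm π) U
  have hadm : ∀ U V, adm U → adm V → adm (U ∩ V) :=
    fun U V hU hV => ⟨hU.1.inter hV.1, hU.2.inter hV.2⟩
  let Φ : (Fin k → M) → OpenPartialHomeomorph (Fin k → M) (Fin k → Fin d → ℝ) :=
    fun c => OpenPartialHomeomorph.pi fun i => φ (c i)
  let D : Option (diagonal M π) → Set (Fin k → M) := fun c =>
    c.elim (diagonal M π)ᶜ fun c => (Φ c.1).source
  let good : Set (Fin k → Fin d → ℝ) → Prop := fun B => IsOpen B ∧ Convex ℝ B ∧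
    (∀ S : Finset (Fin d), Set.MapsTo (swapOn a b S) B B) ∧ Stable (classPerm π) B
  let 𝓑 : Option (diagonal M π) → Set (Set (Fin k → M)) := fun c =>
    {V | (adm V ∧ V ⊆ D c ∧ V ⊆ (diagonal M π)ᶜ) ∨ c.elim False fun c => ∃ B, good B ∧
      B ⊆ (Φ c.1).target ∧ V = (Φ c.1).source ∩ Φ c.1 ⁻¹' B}
  have hchart : ∀ (c : diagonal M π) B, good B → B ⊆ (Φ c.1).target →
      OffDiagonal π ((Φ c.1).source ∩ Φ c.1 ⁻¹' B) := fun c B hB ht =>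
    offDiagonal_chart hd φ hab h c.2 hB.1 hB.2.1 hB.2.2.1 hB.2.2.2 ht
  have hP : ∀ c, ∀ V ∈ 𝓑 c, OffDiagonal π V := by
    rintro (_ | c) V (hV | hV)
    · exact offDiagonal_of_disjoint hV.1.1 hV.1.2 hV.2.2
    · exact hV.elim
    · exact offDiagonal_of_disjoint hV.1.1 hV.1.2 hV.2.2
    · obtain ⟨B, hB, ht, rfl⟩ := hV
      exact hchart c B hB ht
  have hD : ∀ c, ∀ V ∈ 𝓑 c, adm V ∧ V ⊆ D c := by
    intro c V hV
    refine ⟨⟨(hP c V hV).1, (hP c V hV).2.1⟩, ?_⟩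
    obtain _ | c := c
    · exact (hV.resolve_right id).2.1
    · obtain hV | ⟨B, hB, ht, rfl⟩ := hV
      · exact hV.2.1
      · exact Set.inter_subset_left
  refine local_basis_induction (P := OffDiagonal π) (adm := adm) (offDiagonal_empty π) hadm
    (fun U V h1 h2 h3 => h1.union h2 h3) (fun ι U _ hdir hU => OffDiagonal.iUnion hdir hU) D 𝓑
    (fun x => ?_) ?_ hP hD ?_ ⟨hU, hs⟩
  · by_cases hx : x ∈ diagonal M π
    · exact ⟨some ⟨x, hx⟩, fun i _ => hφ (x i)⟩
    · exact ⟨none, hx⟩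
  · intro c U hU V hV
    have hUa := hD c U hU
    have hVa := hD c V hV
    have hsub : U ∩ V ⊆ D c := Set.inter_subset_left.trans hUa.2
    rcases hU with h1 | h1
    · exact Or.inl ⟨hadm _ _ hUa.1 hVa.1, hsub, Set.inter_subset_left.trans h1.2.2⟩
    rcases hV with h2 | h2
    · exact Or.inl ⟨hadm _ _ hUa.1 hVa.1, hsub, Set.inter_subset_right.trans h2.2.2⟩
    obtain _ | c := c
    · exact h1.elim
    obtain ⟨B, hB, ht, rfl⟩ := h1
    obtain ⟨B', hB', ht', rfl⟩ := h2
    refine Or.inr ⟨B ∩ B', ⟨hB.1.inter hB'.1, hB.2.1.inter hB'.2.1, fun S x hx =>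
      ⟨hB.2.2.1 S hx.1, hB'.2.2.1 S hx.2⟩, hB.2.2.2.inter hB'.2.2.2⟩,
      Set.inter_subset_left.trans ht, ?_⟩
    ext y
    simp only [Set.mem_inter_iff, Set.mem_preimage]
    tauto
  · intro c U x hU hxU hxD
    have hDc : adm (D c) := by
      obtain _ | c := c
      · exact ⟨hL, sL⟩
      · refine ⟨(Φ c.1).open_source, ?_⟩
        intro σ hσ y hy i hi
        have := hy (σ i) trivial
        change y (σ i) ∈ (φ (c.1 i)).source
        rw [← c.2 _ _ (hσ i)]
        exact this
    by_cases hx : x ∈ diagonal M π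
    · obtain _ | c := c
      · exact absurd hx hxD
      have hxD : x ∈ (Φ c.1).source := hxD
      obtain ⟨B, hB, hcB, hS, hst, hxB, hBV⟩ := exists_ball_of_mem_diagonal h
        (y := Φ c.1 x) (fun i j hij => by
          change φ (c.1 i) (x i) = φ (c.1 j) (x j)
          rw [c.2 i j hij, hx i j hij])
        ((Φ c.1).isOpen_inter_preimage_symm hU.1) ⟨(Φ c.1).map_source hxD, by
          rw [Set.mem_preimage, (Φ c.1).left_inv hxD]; exact hxU⟩
      refine ⟨_, Or.inr ⟨B, ⟨hB, hcB, hS, hst⟩, hBV.trans Set.inter_subset_left, rfl⟩,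
        ⟨hxD, hxB⟩, ?_⟩
      rintro z ⟨hz, hzB⟩
      have := (hBV hzB).2
      rwa [Set.mem_preimage, (Φ c.1).left_inv hz] at this
    · refine ⟨U ∩ D c ∩ (diagonal M π)ᶜ, Or.inl ⟨hadm _ _ (hadm _ _ hU hDc) ⟨hL, sL⟩, ?_, ?_⟩,
        ⟨⟨hxU, hxD⟩, hx⟩, ?_⟩
      · exact Set.inter_subset_left.trans Set.inter_subset_right
      · exact Set.inter_subset_right
      · exact Set.inter_subset_left.trans Set.inter_subset_left

end Diagonal

section Strata

variable {M : Type} [TopologicalSpace M] {k d : ℕ}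

/-- The number of classes of a setoid. -/
noncomputable def numClasses (π : Setoid (Fin k)) : ℕ := Nat.card (Quotient π)

lemma numClasses_anti {π ρ : Setoid (Fin k)} (h : π ≤ ρ) : numClasses ρ ≤ numClasses π :=
  Nat.card_le_card_of_surjective (Quotient.map id fun _ _ hab => h hab) (by
    rintro ⟨x⟩; exact ⟨⟦x⟧, rfl⟩)

lemma eq_of_le_of_numClasses {π ρ : Setoid (Fin k)} (h : π ≤ ρ)
    (h' : numClasses π ≤ numClasses ρ) : π = ρ := by
  refine le_antisymm h fun x y hxy => ?_
  have hsurj : Function.Surjective (Quotient.map id fun _ _ hab => h hab :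
      Quotient π → Quotient ρ) := by
    rintro ⟨x⟩; exact ⟨⟦x⟧, rfl⟩
  have := (Function.Surjective.bijective_of_nat_card_le hsurj h').1
    (a₁ := ⟦x⟧) (a₂ := ⟦y⟧) (Quotient.sound hxy)
  exact Quotient.exact this

/-- The points of the power with at least `s` distinct coordinates. -/
def stratum (M : Type) (k s : ℕ) : Set (Fin k → M) := {x | s ≤ numClasses (Setoid.ker x)}

/-- The points whose coincidences are allowed by `π`. -/
def coarser (M : Type) (π : Setoid (Fin k)) : Set (Fin k → M) := {x | Setoid.ker x ≤ π}

lemma isOpen_coarser [T2Space M] (π : Setoid (Fin k)) : IsOpen (coarser M π) := by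
  have : coarser M π = ⋂ i, ⋂ j, ⋂ (_ : ¬ π i j), {x | x i ≠ x j} := by
    ext x
    simp only [coarser, Set.mem_iInter, Set.mem_ofPred_eq]
    constructor
    · intro h i j hij e; exact hij (h e)
    · intro h i j e
      by_contra hij
      exact h i j hij e
  rw [this]
  exact isOpen_iInter_of_finite fun i => isOpen_iInter_of_finite fun j =>
    isOpen_iInter_of_finite fun _ => isOpen_ne_fun (continuous_apply i) (continuous_apply j)

omit [TopologicalSpace M] in
lemma stratum_eq (s : ℕ) : stratum M k s =
    ⋃ π : {π : Setoid (Fin k) // s ≤ numClasses π}, coarser M π.1 := by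
  ext x
  simp only [stratum, coarser, Set.mem_iUnion, Set.mem_ofPred_eq]
  constructor
  · intro h; exact ⟨⟨_, h⟩, le_rfl⟩
  · rintro ⟨⟨π, hπ⟩, h⟩; exact hπ.trans (numClasses_anti h)

lemma isOpen_stratum [T2Space M] (s : ℕ) : IsOpen (stratum M k s) := by
  rw [stratum_eq]; exact isOpen_iUnion fun π => isOpen_coarser _

omit [TopologicalSpace M] in
lemma stratum_succ_subset (s : ℕ) : stratum M k (s + 1) ⊆ stratum M k s :=
  fun _ hx => (Nat.le_succ s).trans hx

omit [TopologicalSpace M] in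
lemma numClasses_ker_comp (x : Fin k → M) (σ : Equiv.Perm (Fin k)) :
    numClasses (Setoid.ker (x ∘ σ)) = numClasses (Setoid.ker x) :=
  Nat.card_congr (Quotient.congr σ fun _ _ => Iff.rfl)

lemma stable_stratum (G : Subgroup (Equiv.Perm (Fin k))) (s : ℕ) : Stable G (stratum M k s) := by
  intro σ _ x hx
  change s ≤ numClasses (Setoid.ker (x ∘ σ))
  rwa [numClasses_ker_comp]

lemma stable_coarser (π : Setoid (Fin k)) : Stable (classPerm π) (coarser M π) := by
  intro σ hσ x hx i j hij
  exact π.trans (π.symm (hσ i)) (π.trans (hx hij) (hσ j))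

omit [TopologicalSpace M] in
lemma stratum_zero : stratum M k 0 = Set.univ := Set.eq_univ_of_forall fun _ => Nat.zero_le _

lemma numClasses_bot : numClasses (⊥ : Setoid (Fin k)) = k := by
  rw [numClasses, Nat.card_congr (Setoid.quotientBotEquiv (α := Fin k)), Nat.card_fin]

omit [TopologicalSpace M] in
lemma stratum_self : stratum M k k = {x | Function.Injective x} := by
  ext x
  simp only [stratum, Set.mem_ofPred_eq]
  have hk := numClasses_bot (k := k)
  rw [← Setoid.ker_eq_bot_iff]
  constructor
  · intro h
    exact (eq_of_le_of_numClasses bot_le (by rwa [hk])).symm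
  · intro h
    rw [h, hk]

omit [TopologicalSpace M] in
lemma sdiff_diagonal {π : Setoid (Fin k)} {s : ℕ} (hπ : numClasses π = s) :
    (stratum M k (s + 1) ∪ coarser M π) \ diagonal M π = stratum M k (s + 1) := by
  have hdiag : ∀ x : Fin k → M, x ∈ diagonal M π ↔ π ≤ Setoid.ker x := fun x => Iff.rfl
  ext x
  constructor
  · rintro ⟨h | h, hx⟩
    · exact h
    · change s + 1 ≤ numClasses (Setoid.ker x)
      by_contra hlt
      refine hx ((hdiag x).2 ?_)
      rw [eq_of_le_of_numClasses h (by omega)]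
  · intro hx
    refine ⟨Or.inl hx, fun h => ?_⟩
    have := numClasses_anti ((hdiag x).1 h)
    have hx : s + 1 ≤ numClasses (Setoid.ker x) := hx
    omega

lemma acyc_stratum [T2Space M] (hd : Odd d) (φ : M → OpenPartialHomeomorph M (Fin d → ℝ))
    (hφ : ∀ x, x ∈ (φ x).source) {s : ℕ} (hs : s < k) :
    Acyc bd (chainsIn (stratum M k s) ⊓ fixC M ⊤) (chainsIn (stratum M k (s + 1)) ⊓ fixC M ⊤) := by
  set N := (chainsIn (stratum M k s)).map bd ⊔ chainsIn (stratum M k (s + 1)) with hN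
  have hNG : ∀ c ∈ N, avgC M ⊤ c ∈ N := by
    intro c hc
    obtain ⟨_, ⟨u, hu, rfl⟩, w, hw, rfl⟩ := Submodule.mem_sup.1 hc
    rw [map_add, avgC_bd]
    exact Submodule.add_mem_sup ⟨_, avgC_mem_chainsIn (stable_stratum _ _) hu, rfl⟩
      (avgC_mem_chainsIn (stable_stratum _ _) hw)
  let W : {π : Setoid (Fin k) // numClasses π = s} → Set (Fin k → M) :=
    fun π => stratum M k (s + 1) ∪ coarser M π.1
  have hWo : ∀ π, IsOpen (W π) := fun π => (isOpen_stratum _).union (isOpen_coarser _)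
  have hW : ∀ π, W π ⊆ stratum M k s := by
    rintro ⟨π, hπ⟩ x (hx | hx)
    · exact stratum_succ_subset _ hx
    · exact hπ.symm.le.trans (numClasses_anti hx)
  have hWW : ∀ π ρ, π ≠ ρ → W π ∩ W ρ ⊆ stratum M k (s + 1) := by
    rintro ⟨π, hπ⟩ ⟨ρ, hρ⟩ hne x ⟨h1 | h1, h2 | h2⟩
    · exact h1
    · exact h1
    · exact h2
    · by_contra hlt
      have hlt : ¬ s + 1 ≤ numClasses (Setoid.ker x) := hlt
      apply hne
      have h1 : Setoid.ker x ≤ π := h1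
      have h2 : Setoid.ker x ≤ ρ := h2
      have e1 : Setoid.ker x = π := eq_of_le_of_numClasses h1 (by omega)
      have e2 : Setoid.ker x = ρ := eq_of_le_of_numClasses h2 (by omega)
      exact Subtype.ext (e1.symm.trans e2)
  have hWN : ∀ π, ∀ c ∈ chainsIn (W π), bd c ∈ chainsIn (stratum M k (s + 1)) →
      avgC M ⊤ c ∈ N := by
    rintro ⟨π, hπ⟩ c hc hb
    have hab : ∃ a b, a ≠ b ∧ π a b := by
      by_contra! hcon
      have : π = ⊥ := le_antisymm (fun a b h => by by_contra hne; exact hcon a b hne h) bot_le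
      have hk := numClasses_bot (k := k)
      rw [← this] at hk
      omega
    obtain ⟨a, b, hab, hπab⟩ := hab
    have hst : Stable (classPerm π) (W ⟨π, hπ⟩) := (stable_stratum _ _).union (stable_coarser π)
    have key := (offDiagonal hd φ hφ hab hπab (hWo ⟨π, hπ⟩) hst).2.2
    simp only [W, sdiff_diagonal hπ] at key
    obtain ⟨e, he, he'⟩ := key (avgC M (classPerm π) c) ⟨avgC_mem_chainsIn hst hc, avgC_mem _ _⟩
      ⟨by rw [← avgC_bd]; exact avgC_mem_chainsIn (stable_stratum _ _) hb,
        bd_mem_fixC (avgC_mem _ _)⟩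
    have h1 : avgC M (classPerm π) c ∈ N := by
      rw [← sub_add_cancel (avgC M (classPerm π) c) (bd e), add_comm]
      exact Submodule.add_mem_sup ⟨e, chainsIn_mono (hW ⟨π, hπ⟩) he.1, rfl⟩ he'.1
    have h2 : avgC M ⊤ (avgC M (classPerm π) c) = avgC M ⊤ c := by
      classical
      rw [avgC_apply (classPerm π), map_smul, map_sum,
        Finset.sum_congr rfl fun g _ => avgC_push ⊤ (Subgroup.mem_top g.1) c, Finset.sum_const,
        Finset.card_univ, ← Nat.cast_smul_eq_nsmul ℚ, smul_smul, inv_mul_cancel₀, one_smul]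
      exact Nat.cast_ne_zero.2 Fintype.card_ne_zero
    rw [← h2]
    exact hNG _ h1
  rintro c ⟨hc, hf⟩ ⟨hb, _⟩
  have hcover : stratum M k s = ⋃ o : Option {π : Setoid (Fin k) // numClasses π = s},
      o.elim (stratum M k (s + 1)) W := by
    refine Set.Subset.antisymm (fun x hx => ?_) (Set.iUnion_subset ?_)
    · have hx : s ≤ numClasses (Setoid.ker x) := hx
      rw [Set.mem_iUnion]
      rcases hx.eq_or_lt with h | h
      · exact ⟨some ⟨_, h.symm⟩, Or.inr (show Setoid.ker x ≤ Setoid.ker x from le_rfl)⟩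
      · exact ⟨none, h⟩
    · rintro (_ | π)
      · exact stratum_succ_subset _
      · exact hW π
  have hopen : ∀ o : Option {π : Setoid (Fin k) // numClasses π = s},
      IsOpen (o.elim (stratum M k (s + 1)) W) := by
    rintro (_ | π)
    · exact isOpen_stratum _
    · exact hWo π
  have hac := acyc_iSup hopen
  rw [← hcover] at hac
  obtain ⟨e, he, hce⟩ := hac c hc
    (Submodule.mem_iSup_of_mem (p := fun o : Option {π : Setoid (Fin k) // numClasses π = s} =>
      chainsIn (o.elim (stratum M k (s + 1)) W)) none hb)
  obtain ⟨f, hf', hsum⟩ := (Submodule.mem_iSup_iff_exists_finsupp _ _).1 hce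
  have hfN : ∀ o, avgC M ⊤ (f o) ∈ N := by
    rintro (_ | π)
    · exact hNG _ (Submodule.mem_sup_right (hf' none))
    · refine hWN π _ (hf' (some π)) ?_
      set T : Set (Fin k → M) := stratum M k (s + 1) ∪ ⋃ ρ : {ρ // ρ ≠ π}, W ρ.1 with hT
      have hTW : W π ∩ T ⊆ stratum M k (s + 1) := by
        rintro x ⟨h1, h2 | h2⟩
        · exact h2
        · obtain ⟨ρ, hρ⟩ := Set.mem_iUnion.1 h2
          exact hWW π ρ.1 ρ.2.symm ⟨h1, hρ⟩
      refine chainsIn_mono hTW ?_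
      rw [chainsIn_inter]
      refine ⟨bd_mem_chainsIn (hf' (some π)), ?_⟩
      classical
      have e1 : bd (f (some π)) = bd (c - bd e) -
          ∑ o ∈ f.support.erase (some π), bd (f o) := by
        rw [← hsum, Finsupp.sum, map_sum]
        by_cases hm : some π ∈ f.support
        · rw [← Finset.add_sum_erase _ _ hm, add_sub_cancel_right]
        · rw [Finset.erase_eq_of_notMem hm, _root_.sub_self, Finsupp.notMem_support_iff.1 hm,
            map_zero]
      rw [e1, map_sub, bd_bd, sub_zero]
      refine Submodule.sub_mem _ (chainsIn_mono Set.subset_union_left hb)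
        (Submodule.sum_mem _ fun o ho => bd_mem_chainsIn ?_)
      have hne := Finset.ne_of_mem_erase ho
      refine chainsIn_mono ?_ (hf' o)
      obtain _ | ρ := o
      · exact Set.subset_union_left
      · refine Set.Subset.trans ?_ Set.subset_union_right
        exact Set.subset_iUnion (fun ρ : {ρ // ρ ≠ π} => W ρ.1)
          ⟨ρ, fun h => hne (by rw [h])⟩
  have hcN : c ∈ N := by
    have h1 : avgC M ⊤ (c - bd e) ∈ N := by
      rw [← hsum, Finsupp.sum, map_sum]
      exact Submodule.sum_mem _ fun o _ => hfN o
    rw [map_sub, avgC_of_mem ⊤ hf] at h1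
    have h2 : avgC M ⊤ (bd e) ∈ N := hNG _ (Submodule.mem_sup_left ⟨e, he, rfl⟩)
    simpa using Submodule.add_mem _ h1 h2
  obtain ⟨_, ⟨u, hu, rfl⟩, w, hw, rfl⟩ := Submodule.mem_sup.1 hcN
  refine ⟨avgC M ⊤ u, ⟨avgC_mem_chainsIn (stable_stratum _ _) hu, avgC_mem _ _⟩, ?_⟩
  nth_rw 1 [← avgC_of_mem ⊤ hf]
  rw [map_add, avgC_bd, add_sub_cancel_left]
  exact ⟨avgC_mem_chainsIn (stable_stratum _ _) hw, avgC_mem _ _⟩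

/-- In odd dimensions the invariant chains of the power are homologous to those of the ordered
configuration space. -/
theorem acyc_config [T2Space M] (hd : Odd d) (φ : M → OpenPartialHomeomorph M (Fin d → ℝ))
    (hφ : ∀ x, x ∈ (φ x).source) :
    Acyc bd (fixC M (⊤ : Subgroup (Equiv.Perm (Fin k))))
      (chainsIn {x | Function.Injective x} ⊓ fixC M ⊤) := by
  have key : ∀ s ≤ k, Acyc bd (fixC M (⊤ : Subgroup (Equiv.Perm (Fin k))))
      (chainsIn (stratum M k s) ⊓ fixC M ⊤) := by
    intro s
    induction s with
    | zero =>
      intro _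
      rw [stratum_zero, chainsIn_univ, top_inf_eq]
      exact Acyc.refl _ _
    | succ s ih =>
      intro hs
      exact (ih (by omega)).trans bd_bd inf_le_right
        (inf_le_inf_right _ (chainsIn_mono (stratum_succ_subset s)))
        (acyc_stratum hd φ hφ (by omega))
  rw [← stratum_self]
  exact key k le_rfl

end Strata

end SingularQ

namespace SingularQ

section Part

variable {X Y : Type} [TopologicalSpace X] [TopologicalSpace Y]

/-- The homogeneous component of degree `n` of a chain. -/
noncomputable def part (n : ℕ) : Chain X →ₗ[ℚ] Chain X :=
  lext fun σ => if σ.dim = n then bas σ else 0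

lemma part_bas (n : ℕ) (σ : Sing X) :
    part n (bas σ) = if σ.dim = n then bas σ else 0 := lext_bas _ _

lemma part_bas_self (σ : Sing X) {n : ℕ} (h : σ.dim = n) : part n (bas σ) = bas σ := by
  rw [part_bas, if_pos h]

lemma part_bas_of_ne (σ : Sing X) {n : ℕ} (h : σ.dim ≠ n) : part n (bas σ) = 0 := by
  rw [part_bas, if_neg h]

lemma part_part (n : ℕ) (c : Chain X) : part n (part n c) = part n c := by
  have : (part n : Chain X →ₗ[ℚ] Chain X).comp (part n) = part n := hom_ext fun σ => by
    rw [LinearMap.comp_apply]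
    by_cases h : σ.dim = n
    · rw [part_bas_self σ h, part_bas_self σ h]
    · rw [part_bas_of_ne σ h, map_zero]
  exact LinearMap.congr_fun this c

lemma part_push (g : C(X, Y)) (n : ℕ) (c : Chain X) : part n (push g c) = push g (part n c) := by
  have : (part n).comp (push g) = (push g).comp (part n) := hom_ext fun σ => by
    rw [LinearMap.comp_apply, LinearMap.comp_apply, push_bas]
    by_cases h : σ.dim = n
    · rw [part_bas_self σ h, part_bas_self (pushS g σ) h, push_bas]
    · rw [part_bas_of_ne σ h, part_bas_of_ne (pushS g σ) h, map_zero]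
  exact LinearMap.congr_fun this c

lemma part_bd (n : ℕ) (c : Chain X) : part n (bd c) = bd (part (n + 1) c) := by
  have : (part n : Chain X →ₗ[ℚ] Chain X).comp bd = bd.comp (part (n + 1)) :=
    hom_ext fun σ => by
      rw [LinearMap.comp_apply, LinearMap.comp_apply, bd_bas]
      obtain h | ⟨m, h⟩ : σ.dim = 0 ∨ ∃ m, σ.dim = m + 1 := by
        cases h : σ.dim <;> simp
      · rw [bdS_of_dim_zero h, part_bas_of_ne σ (by omega), map_zero, map_zero]
      rw [bdS_of_dim_succ h, map_sum]
      simp only [map_smul]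
      by_cases hm : m = n
      · rw [part_bas_self σ (by omega), bd_bas, bdS_of_dim_succ h]
        exact Finset.sum_congr rfl fun i _ => by rw [part_bas_self _ (by simpa using hm)]
      · rw [part_bas_of_ne σ (by omega), map_zero]
        exact Finset.sum_eq_zero fun i _ => by
          rw [part_bas_of_ne _ (by simpa using hm), smul_zero]
  exact LinearMap.congr_fun this c

lemma bd_part_zero (c : Chain X) : bd (part 0 c) = 0 := by
  have : (bd : Chain X →ₗ[ℚ] Chain X).comp (part 0) = 0 := hom_ext fun σ => by
    rw [LinearMap.comp_apply, LinearMap.zero_apply]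
    by_cases h : σ.dim = 0
    · rw [part_bas_self σ h, bd_bas, bdS_of_dim_zero h]
    · rw [part_bas_of_ne σ h, map_zero]
  exact LinearMap.congr_fun this c

lemma bd_part_eq_zero {c : Chain X} (h : bd c = 0) (n : ℕ) : bd (part n c) = 0 := by
  cases n with
  | zero => exact bd_part_zero c
  | succ n => rw [← part_bd, h, map_zero]

end Part

section Covering

variable {E B G : Type} [TopologicalSpace E] [TopologicalSpace B] [Group G] [MulAction G E]

instance (n : ℕ) : ContractibleSpace (Simplex n) :=
  (convex_stdSimplex ℝ (Fin (n + 1))).contractibleSpace ⟨_, single_mem_stdSimplex ℝ 0⟩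

instance (n : ℕ) : LocallyPathConnectedSpace (Simplex n) :=
  (convex_stdSimplex ℝ (Fin (n + 1))).locallyPathConnectedSpace

/-- The continuous map given by a group element. -/
def actMap [ContinuousConstSMul G E] (g : G) : C(E, E) := ⟨fun x => g • x, continuous_const_smul g⟩

variable {q : C(E, B)}

lemma exists_lift (hq : IsQuotientCoveringMap q G) (τ : Sing B) :
    ∃ σ : Sing E, pushS q σ = τ := by
  obtain ⟨e, he⟩ := hq.surjective (τ.map (Classical.arbitrary _))
  obtain ⟨F, ⟨_, hF⟩, _⟩ := hq.isCoveringMap.existsUnique_continuousMap_lifts τ.map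
    (Classical.arbitrary _) e he
  exact ⟨⟨τ.dim, F⟩, Sing.mk_congr fun x => congrFun hF x⟩

lemma pushS_eq_iff [ContinuousConstSMul G E] (hq : IsQuotientCoveringMap q G) {σ τ : Sing E} :
    pushS q σ = pushS q τ ↔ ∃ g : G, σ = pushS (actMap g) τ := by
  constructor
  · intro h
    obtain ⟨n, s⟩ := σ
    obtain ⟨n', t⟩ := τ
    obtain rfl : n = n' := congrArg Sing.dim h
    have h' : ∀ x, q (s x) = q (t x) := by
      simp only [pushS, Sing.mk.injEq, heq_eq_eq, true_and] at h
      exact fun x => DFunLike.congr_fun h x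
    obtain ⟨g, hg⟩ := hq.apply_eq_iff_mem_orbit.1 (h' (Classical.arbitrary _))
    refine ⟨g, Sing.mk_congr fun x => ?_⟩
    refine congrFun (hq.isCoveringMap.eq_of_comp_eq s.continuous
      ((actMap g).comp t).continuous ?_ (Classical.arbitrary _) hg.symm) x
    funext x
    exact (h' x).trans (hq.map_smul g).symm
  · rintro ⟨g, rfl⟩
    exact Sing.mk_congr fun x => hq.map_smul g

variable [Fintype G]

/-- The transfer on singular chains for a quotient by a finite group. -/
noncomputable def transfer [ContinuousConstSMul G E] (hq : IsQuotientCoveringMap q G) :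
    Chain B →ₗ[ℚ] Chain E :=
  lext fun τ => ∑ g : G, bas (pushS (actMap g) (exists_lift hq τ).choose)

variable [ContinuousConstSMul G E] (hq : IsQuotientCoveringMap q G)

lemma transfer_push (c : Chain E) :
    transfer hq (push q c) = ∑ g : G, push (actMap g) c := by
  have : (transfer hq).comp (push q) = ∑ g : G, push (actMap g) := hom_ext fun σ => by
    rw [LinearMap.comp_apply, push_bas, transfer, lext_bas, LinearMap.sum_apply]
    obtain ⟨h, hh⟩ := (pushS_eq_iff hq).1 (exists_lift hq (pushS q σ)).choose_spec
    rw [hh]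
    refine Fintype.sum_equiv (Equiv.mulRight h) _ _ fun g => ?_
    rw [push_bas, ← pushS_comp]
    congr 1
    exact Sing.mk_congr fun x => smul_smul g h _
  rw [← LinearMap.comp_apply, this, LinearMap.sum_apply]

omit [Fintype G] [ContinuousConstSMul G E] in
include hq in
lemma push_surjective : Function.Surjective (push q) := by
  intro c
  induction c using Finsupp.induction_linear with
  | zero => exact ⟨0, map_zero _⟩
  | add c d hc hd =>
    obtain ⟨c, rfl⟩ := hc
    obtain ⟨d, rfl⟩ := hd
    exact ⟨c + d, map_add _ _ _⟩
  | single τ a =>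
    obtain ⟨σ, rfl⟩ := exists_lift hq τ
    refine ⟨a • bas σ, ?_⟩
    rw [map_smul, push_bas, Finsupp.smul_single, smul_eq_mul, mul_one]

lemma push_transfer (c : Chain B) : push q (transfer hq c) = (Fintype.card G : ℚ) • c := by
  obtain ⟨c, rfl⟩ := push_surjective hq c
  rw [transfer_push, map_sum]
  have : ∀ g : G, push q (push (actMap g) c) = push q c := fun g => by
    rw [← push_comp]
    congr 2
    ext x
    exact hq.map_smul g
  simp only [this, Finset.sum_const, Finset.card_univ, Nat.cast_smul_eq_nsmul]

lemma transfer_bd (c : Chain B) : transfer hq (bd c) = bd (transfer hq c) := by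
  obtain ⟨c, rfl⟩ := push_surjective hq c
  simp only [← push_bd, transfer_push, map_sum]

lemma transfer_part (n : ℕ) (c : Chain B) :
    transfer hq (part n c) = part n (transfer hq c) := by
  obtain ⟨c, rfl⟩ := push_surjective hq c
  simp only [part_push, transfer_push, map_sum]

lemma transfer_injective : Function.Injective (transfer hq) := by
  intro c d h
  have := congrArg (push q) h
  rw [push_transfer, push_transfer] at this
  exact smul_right_injective _ (Nat.cast_ne_zero.2 Fintype.card_ne_zero) this

end Covering

section Config

variable {M : Type} [TopologicalSpace M] {k : ℕ}

instance : MulAction (Equiv.Perm (Fin k)) (orderedConfig M k) where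
  smul g x := ⟨x.1 ∘ ⇑g⁻¹, x.2.comp (g⁻¹).injective⟩
  one_smul _ := rfl
  mul_smul g h x := by
    apply Subtype.ext
    change x.1 ∘ ⇑(g * h)⁻¹ = (x.1 ∘ ⇑h⁻¹) ∘ ⇑g⁻¹
    rw [mul_inv_rev]; rfl

instance : ContinuousConstSMul (Equiv.Perm (Fin k)) (orderedConfig M k) where
  continuous_const_smul g := by
    refine Continuous.subtype_mk (f := fun x : orderedConfig M k => x.1 ∘ ⇑g⁻¹) ?_ _
    exact continuous_pi fun i => (continuous_apply (g⁻¹ i)).comp continuous_subtype_val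

/-- The quotient map from ordered to unordered configurations. -/
def configMap (M : Type) [TopologicalSpace M] (k : ℕ) : C(orderedConfig M k, unorderedConfig M k) :=
  ⟨Quot.mk _, continuous_quot_mk⟩

/-- The inclusion of the ordered configurations into the power. -/
def configIncl (M : Type) [TopologicalSpace M] (k : ℕ) : C(orderedConfig M k, Fin k → M) :=
  ⟨Subtype.val, continuous_subtype_val⟩

lemma configMap_eq_iff {x y : orderedConfig M k} :
    configMap M k x = configMap M k y ↔ x ∈ MulAction.orbit (Equiv.Perm (Fin k)) y := by
  have heq : Equivalence fun f g : orderedConfig M k => ∃ σ : Equiv.Perm (Fin k), g.1 = f.1 ∘ σ :=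
    ⟨fun f => ⟨1, rfl⟩, fun {f g} ⟨σ, h⟩ => ⟨σ⁻¹, by rw [h]; funext i; simp⟩,
      fun {f g h} ⟨σ, h1⟩ ⟨τ, h2⟩ => ⟨σ * τ, by rw [h2, h1]; rfl⟩⟩
  change Quot.mk _ x = Quot.mk _ y ↔ _
  rw [Quot.eq, heq.eqvGen_iff]
  constructor
  · rintro ⟨σ, h⟩
    refine ⟨σ, Subtype.ext ?_⟩
    change y.1 ∘ ⇑σ⁻¹ = x.1
    rw [h]; funext i; simp
  · rintro ⟨σ, rfl⟩
    refine ⟨σ, ?_⟩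
    change y.1 = (y.1 ∘ ⇑σ⁻¹) ∘ ⇑σ
    funext i; simp

lemma isQuotientCoveringMap_configMap [T2Space M] :
    IsQuotientCoveringMap (configMap M k) (Equiv.Perm (Fin k)) where
  toIsQuotientMap := isQuotientMap_quot_mk
  continuous_const_smul := continuous_const_smul
  apply_eq_iff_mem_orbit := configMap_eq_iff
  disjoint x := by
    obtain ⟨U, hU, hd⟩ := (Set.finite_range x.1).t2_separation
    refine ⟨{y | ∀ i, y.1 i ∈ U (x.1 i)}, ?_, ?_⟩
    · refine IsOpen.mem_nhds ?_ fun i => (hU _).1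
      have : {y : orderedConfig M k | ∀ i, y.1 i ∈ U (x.1 i)} =
          ⋂ i, {y : orderedConfig M k | y.1 i ∈ U (x.1 i)} := by ext; simp
      rw [this]
      exact isOpen_iInter_of_finite fun i => (hU _).2.preimage
        ((continuous_apply i).comp continuous_subtype_val)
    · rintro g ⟨_, ⟨y, hy, rfl⟩, hy'⟩
      refine inv_eq_one.1 (Equiv.ext fun i => ?_)
      by_contra hne
      have h1 : y.1 (g⁻¹ i) ∈ U (x.1 i) := hy' i
      exact Set.disjoint_left.1 (hd ⟨i, rfl⟩ ⟨g⁻¹ i, rfl⟩ fun h => hne (x.2 h).symm) h1 (hy _)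

variable [T2Space M]

/-- The transfer from the chains of unordered configurations to those of the power. -/
noncomputable def configT (M : Type) [TopologicalSpace M] [T2Space M] (k : ℕ) :
    Chain (unorderedConfig M k) →ₗ[ℚ] Chain (Fin k → M) :=
  (push (configIncl M k)).comp (transfer isQuotientCoveringMap_configMap)

lemma configT_apply (c : Chain (unorderedConfig M k)) : configT M k c =
    push (configIncl M k) (transfer isQuotientCoveringMap_configMap c) := rfl

lemma configT_bd (c : Chain (unorderedConfig M k)) : configT M k (bd c) = bd (configT M k c) := by
  rw [configT_apply, transfer_bd, push_bd]; rfl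

lemma configT_part (n : ℕ) (c : Chain (unorderedConfig M k)) :
    configT M k (part n c) = part n (configT M k c) := by
  rw [configT_apply, transfer_part, ← part_push]; rfl

lemma configT_injective : Function.Injective (configT M k) :=
  (push_injective Subtype.val_injective).comp (transfer_injective _)

lemma configT_push (c : Chain (orderedConfig M k)) : configT M k (push (configMap M k) c) =
    ∑ g : Equiv.Perm (Fin k), push (permMap M g) (push (configIncl M k) c) := by
  rw [configT_apply, transfer_push, map_sum]
  refine Fintype.sum_equiv (Equiv.inv _) _ _ fun g => ?_
  rw [← push_comp, ← push_comp]
  rfl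

lemma range_configT : LinearMap.range (configT M k) =
    chainsIn {x | Function.Injective x} ⊓ fixC M (⊤ : Subgroup (Equiv.Perm (Fin k))) := by
  have hsum : ∀ c : Chain (Fin k → M), ∑ g : Equiv.Perm (Fin k), push (permMap M g) c =
      (Fintype.card (Equiv.Perm (Fin k)) : ℚ) • avgC M ⊤ c := fun c => by
    classical
    rw [avgC_apply, smul_smul]
    have : (Fintype.card (⊤ : Subgroup (Equiv.Perm (Fin k)))) =
        Fintype.card (Equiv.Perm (Fin k)) := Fintype.card_congr Subgroup.topEquiv.toEquiv
    rw [this, mul_inv_cancel₀ (Nat.cast_ne_zero.2 Fintype.card_ne_zero), one_smul]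
    exact (Fintype.sum_equiv Subgroup.topEquiv.toEquiv _ _ fun _ => rfl).symm
  have hst : Stable (⊤ : Subgroup (Equiv.Perm (Fin k))) {x : Fin k → M | Function.Injective x} :=
    by
    intro g _ x hx
    exact Function.Injective.comp (f := g) hx g.injective
  refine le_antisymm ?_ ?_
  · rintro _ ⟨c, rfl⟩
    obtain ⟨c, rfl⟩ := push_surjective isQuotientCoveringMap_configMap c
    rw [configT_push, hsum]
    exact Submodule.smul_mem _ _ ⟨avgC_mem_chainsIn hst
      (push_incl_mem {x : Fin k → M | Function.Injective x} c), avgC_mem _ _⟩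
  · rintro c ⟨hc, hf⟩
    obtain ⟨e, rfl⟩ := exists_push_incl hc
    have h := configT_push (M := M) (k := k) e
    rw [hsum] at h
    refine ⟨(Fintype.card (Equiv.Perm (Fin k)) : ℚ)⁻¹ • push (configMap M k) e, ?_⟩
    rw [map_smul, h, smul_smul, inv_mul_cancel₀ (Nat.cast_ne_zero.2 Fintype.card_ne_zero),
      one_smul]
    exact avgC_of_mem _ hf

variable {d : ℕ} (hd : Odd d) (φ : M → OpenPartialHomeomorph M (Fin d → ℝ))
  (hφ : ∀ x, x ∈ (φ x).source)

include hd hφ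

lemma exists_bd_of_configT {c : Chain (unorderedConfig M k)} {e : Chain (Fin k → M)}
    (h : configT M k c = bd e) : ∃ e', c = bd e' := by
  have hc : configT M k c ∈ LinearMap.range (configT M k) := ⟨c, rfl⟩
  rw [range_configT] at hc
  have h1 : bd (avgC M ⊤ e) = configT M k c := by
    rw [← avgC_bd, ← h, avgC_of_mem _ hc.2]
  obtain ⟨e₂, _, h2⟩ := acyc_config hd φ hφ (avgC M ⊤ e) (avgC_mem _ e) (h1 ▸ hc)
  rw [← range_configT] at h2
  obtain ⟨e', he'⟩ := h2
  refine ⟨e', configT_injective ?_⟩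
  rw [configT_bd, he', map_sub, bd_bd, sub_zero, h1]

lemma exists_configT_of_cycle {z : Chain (Fin k → M)}
    (hz : z ∈ fixC M (⊤ : Subgroup (Equiv.Perm (Fin k)))) (hb : bd z = 0) {n : ℕ}
    (hn : part n z = z) : ∃ c e, part n c = c ∧ bd c = 0 ∧ configT M k c = z - bd e := by
  obtain ⟨e, _, he⟩ := acyc_config hd φ hφ z hz (hb ▸ Submodule.zero_mem _)
  rw [← range_configT] at he
  obtain ⟨c, hc⟩ := he
  have hbc : bd c = 0 := configT_injective (by
    rw [configT_bd, hc, map_sub, bd_bd, hb, map_zero, sub_zero])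
  refine ⟨part n c, part (n + 1) e, part_part _ _, bd_part_eq_zero hbc n, ?_⟩
  rw [configT_part, hc, map_sub, hn, part_bd]

end Config

end SingularQ

namespace SingularQ

open Finset

variable {X Y Z : Type} [TopologicalSpace X] [TopologicalSpace Y] [TopologicalSpace Z]

section AlexanderWhitney

variable {V W : Type} [AddCommGroup V] [Module ℚ V] [AddCommGroup W] [Module ℚ W]

/-- The Alexander–Whitney diagonal of a singular simplex evaluated on a bilinear map. -/
noncomputable def awS (F : Chain X →ₗ[ℚ] Chain X →ₗ[ℚ] V) (σ : Sing X) : V :=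
  ∑ p ∈ range (σ.dim + 1), F (bas (sub σ p id)) (bas (sub σ (σ.dim - p) (· + p)))

/-- The Alexander–Whitney diagonal evaluated on a bilinear map. -/
noncomputable def aw (F : Chain X →ₗ[ℚ] Chain X →ₗ[ℚ] V) : Chain X →ₗ[ℚ] V := lext (awS F)

lemma aw_bas (F : Chain X →ₗ[ℚ] Chain X →ₗ[ℚ] V) (σ : Sing X) : aw F (bas σ) =
    ∑ p ∈ range (σ.dim + 1), F (bas (sub σ p id)) (bas (sub σ (σ.dim - p) (· + p))) :=
  lext_bas _ _

/-- The grading involution of chains. -/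
noncomputable def sgn : Chain X →ₗ[ℚ] Chain X := lext fun σ => (-1 : ℚ) ^ σ.dim • bas σ

lemma sgn_bas (σ : Sing X) : sgn (bas σ) = (-1 : ℚ) ^ σ.dim • bas σ := lext_bas _ _

lemma aw_sub (F : Chain X →ₗ[ℚ] Chain X →ₗ[ℚ] V) (σ : Sing X) (m : ℕ) (f : ℕ → ℕ) :
    aw F (bas (sub σ m f)) = ∑ p ∈ range (m + 1),
      F (bas (sub σ p f)) (bas (sub σ (m - p) fun j => f (j + p))) := by
  rw [aw_bas]
  refine Finset.sum_congr rfl fun p hp => ?_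
  have hp' := Finset.mem_range.1 hp
  rw [sub_sub, sub_sub]
  congr 2
  · congr 1
    refine sub_congr _ rfl fun j hj => ?_
    rw [id, min_eq_left (a := j) (b := m) (by omega)]
  · refine sub_congr _ rfl fun j hj => ?_
    simp only [sub_dim] at hj
    rw [min_eq_left (a := j + p) (b := m) (by omega)]

lemma aw_bd (F : Chain X →ₗ[ℚ] Chain X →ₗ[ℚ] V) (c : Chain X) :
    aw F (bd c) = aw (F.compl₁₂ bd LinearMap.id) c + aw (F.compl₁₂ sgn bd) c := by
  have : (aw F).comp bd = aw (F.compl₁₂ bd LinearMap.id) + aw (F.compl₁₂ sgn bd) := by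
    refine hom_ext fun σ => ?_
    rw [LinearMap.comp_apply, LinearMap.add_apply, bd_bas, aw_bas, aw_bas]
    simp only [LinearMap.compl₁₂_apply, LinearMap.id_apply, bd_bas, sgn_bas, sub_dim]
    obtain h | ⟨m, h⟩ : σ.dim = 0 ∨ ∃ n, σ.dim = n + 1 := by
      cases h : σ.dim <;> simp
    · rw [bdS_of_dim_zero h, map_zero, h, Finset.sum_range_one, Finset.sum_range_one,
        bdS_of_dim_zero (σ := sub σ 0 id) rfl, bdS_of_dim_zero (σ := sub σ (0 - 0) _) rfl,
        map_zero, map_zero, LinearMap.zero_apply, add_zero]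
    · have e1 : ∑ p ∈ range (σ.dim + 1), F (bdS (sub σ p id)) (bas (sub σ (σ.dim - p) (· + p))) =
          ∑ p ∈ range (m + 1), (∑ i ∈ range (p + 1), (-1 : ℚ) ^ i •
            F (bas (sub σ p (coface i))) (bas (sub σ (m - p) (· + (p + 1)))) +
            (-1 : ℚ) ^ (p + 1) • F (bas (sub σ p id)) (bas (sub σ (m - p) (· + (p + 1))))) := by
        rw [h, Finset.sum_range_succ', bdS_of_dim_zero (σ := sub σ 0 id) rfl, map_zero,
          LinearMap.zero_apply, add_zero]
        refine Finset.sum_congr rfl fun p _ => ?_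
        rw [bd_sub, Finset.sum_range_succ, map_add, map_sum, LinearMap.add_apply,
          LinearMap.sum_apply, Nat.add_sub_add_right]
        congr 1
        · refine Finset.sum_congr rfl fun i _ => ?_
          rw [map_smul, LinearMap.smul_apply]; rfl
        · rw [map_smul, LinearMap.smul_apply]
          congr 4
          refine sub_congr _ rfl fun j hj => ?_
          simp only [coface, id]
          rw [if_pos (by omega)]
      have e2 : ∑ p ∈ range (σ.dim + 1), F ((-1 : ℚ) ^ p • bas (sub σ p id))
            (bdS (sub σ (σ.dim - p) (· + p))) =
          ∑ p ∈ range (m + 1), (∑ j ∈ range (m - p + 1), (-1 : ℚ) ^ (p + (j + 1)) •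
            F (bas (sub σ p id)) (bas (sub σ (m - p) fun k => coface (j + 1) k + p)) +
            (-1 : ℚ) ^ p • F (bas (sub σ p id)) (bas (sub σ (m - p) (· + (p + 1))))) := by
        rw [h, Finset.sum_range_succ, Nat.sub_self, bdS_of_dim_zero (σ := sub σ 0 _) rfl, map_zero,
          add_zero]
        refine Finset.sum_congr rfl fun p hp => ?_
        have hp' := Finset.mem_range.1 hp
        rw [show m + 1 - p = (m - p) + 1 by omega, bd_sub, Finset.sum_range_succ', map_add, map_sum,
          map_smul, LinearMap.smul_apply]
        congr 1
        · refine Finset.sum_congr rfl fun i _ => ?_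
          rw [map_smul, LinearMap.smul_apply, smul_smul, ← pow_add, add_comm p]
        · rw [pow_zero, one_smul]
          congr 3
          refine sub_congr _ rfl fun j hj => ?_
          simp only [coface]
          rw [if_neg (by omega), add_assoc, add_comm 1]
      rw [e1, e2, bdS_of_dim_succ h, map_sum]
      simp only [map_smul, aw_sub, Finset.smul_sum]
      rw [Finset.sum_comm, ← Finset.sum_add_distrib]
      refine Finset.sum_congr rfl fun p hp => ?_
      have hp' := Finset.mem_range.1 hp
      rw [show m + 2 = (p + 1) + (m - p + 1) by omega, Finset.sum_range_add, pow_succ]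
      have f1 : ∀ i ∈ range (p + 1), (-1 : ℚ) ^ i • F (bas (sub σ p (coface i)))
          (bas (sub σ (m - p) fun j => coface i (j + p))) = (-1 : ℚ) ^ i •
            F (bas (sub σ p (coface i))) (bas (sub σ (m - p) (· + (p + 1)))) := by
        intro i hi
        have hi' := Finset.mem_range.1 hi
        congr 3
        refine sub_congr _ rfl fun j hj => ?_
        simp only [coface]
        rw [if_neg (by omega), add_assoc]
      have f2 : ∀ j ∈ range (m - p + 1), (-1 : ℚ) ^ (p + 1 + j) • F
          (bas (sub σ p (coface (p + 1 + j))))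
          (bas (sub σ (m - p) fun k => coface (p + 1 + j) (k + p))) = (-1 : ℚ) ^ (p + (j + 1)) •
            F (bas (sub σ p id)) (bas (sub σ (m - p) fun k => coface (j + 1) k + p)) := by
        intro j _
        rw [show p + (j + 1) = p + 1 + j by omega]
        congr 1
        congr 2
        · congr 1
          refine sub_congr _ rfl fun k hk => ?_
          simp only [coface, id]
          rw [if_pos (by omega)]
        · refine sub_congr _ rfl fun k hk => ?_
          congr 1
          simp only [coface]; split_ifs <;> omega
      rw [Finset.sum_congr rfl f1, Finset.sum_congr rfl f2]
      module
  rw [← LinearMap.comp_apply, this, LinearMap.add_apply]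

lemma aw_push (F : Chain Y →ₗ[ℚ] Chain Y →ₗ[ℚ] V) (g : C(X, Y)) (c : Chain X) :
    aw F (push g c) = aw (F.compl₁₂ (push g) (push g)) c := by
  have : (aw F).comp (push g) = aw (F.compl₁₂ (push g) (push g)) := hom_ext fun σ => by
    rw [LinearMap.comp_apply, push_bas, aw_bas, aw_bas]
    simp only [LinearMap.compl₁₂_apply, push_bas, pushS_sub, pushS_dim]
  rw [← this, LinearMap.comp_apply]

lemma map_aw (F : Chain X →ₗ[ℚ] Chain X →ₗ[ℚ] V) (f : V →ₗ[ℚ] W) (c : Chain X) :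
    f (aw F c) = aw (F.compr₂ f) c := by
  have : f.comp (aw F) = aw (F.compr₂ f) := hom_ext fun σ => by
    rw [LinearMap.comp_apply, aw_bas, aw_bas, map_sum]
    rfl
  rw [← this, LinearMap.comp_apply]

end AlexanderWhitney

/-- Rational singular cochains. -/
abbrev Cochain (X : Type) [TopologicalSpace X] : Type := Chain X →ₗ[ℚ] ℚ

/-- The pull-back of cochains. -/
noncomputable abbrev pull (g : C(X, Y)) (a : Cochain Y) : Cochain X := a.comp (push g)

/-- The cup product of cochains. -/
noncomputable def cup (a b : Cochain X) : Cochain X := aw ((LinearMap.mul ℚ ℚ).compl₁₂ a b)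

lemma cup_bas (a b : Cochain X) (σ : Sing X) : cup a b (bas σ) = ∑ p ∈ range (σ.dim + 1),
    a (bas (sub σ p id)) * b (bas (sub σ (σ.dim - p) (· + p))) := by
  rw [cup, aw_bas]; rfl

lemma pull_cup (g : C(X, Y)) (a b : Cochain Y) :
    pull g (cup a b) = cup (pull g a) (pull g b) := by
  ext1 σ
  ext
  change cup a b (push g (bas σ)) = cup (pull g a) (pull g b) (bas σ)
  rw [cup, aw_push]; rfl

lemma pull_comp (h : C(Y, Z)) (g : C(X, Y)) (a : Cochain Z) :
    pull (h.comp g) a = pull g (pull h a) := LinearMap.ext fun c => by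
  simp only [pull, LinearMap.comp_apply, push_comp]

lemma pull_aug (g : C(X, Y)) : pull g aug = aug := LinearMap.ext fun c => aug_push g c

lemma cup_bd (a b : Cochain X) (c : Chain X) :
    cup a b (bd c) = cup (a.comp bd) b c + cup (a.comp sgn) (b.comp bd) c := by
  rw [cup, aw_bd]; rfl

lemma cup_add_left (a a' b : Cochain X) : cup (a + a') b = cup a b + cup a' b := hom_ext fun σ => by
  simp only [LinearMap.add_apply, cup_bas, add_mul, Finset.sum_add_distrib]

lemma cup_add_right (a b b' : Cochain X) : cup a (b + b') = cup a b + cup a b' :=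
  hom_ext fun σ => by
  simp only [LinearMap.add_apply, cup_bas, mul_add, Finset.sum_add_distrib]

lemma cup_smul_left (r : ℚ) (a b : Cochain X) : cup (r • a) b = r • cup a b := hom_ext fun σ => by
  simp only [LinearMap.smul_apply, cup_bas, smul_eq_mul, Finset.mul_sum, mul_assoc]

lemma cup_smul_right (r : ℚ) (a b : Cochain X) : cup a (r • b) = r • cup a b := hom_ext fun σ => by
  simp only [LinearMap.smul_apply, cup_bas, smul_eq_mul, Finset.mul_sum, mul_left_comm]

lemma cup_zero_left (b : Cochain X) : cup 0 b = 0 := by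
  simpa using cup_smul_left 0 0 b

lemma cup_zero_right (a : Cochain X) : cup a 0 = 0 := by
  simpa using cup_smul_right 0 a 0

lemma cup_assoc (a b c : Cochain X) : cup (cup a b) c = cup a (cup b c) := hom_ext fun σ => by
  rw [cup_bas, cup_bas]
  simp only [cup_bas, sub_dim, Finset.sum_mul, Finset.mul_sum]
  rw [Finset.sum_comm' (t' := range (σ.dim + 1)) (s' := fun q => Ico q (σ.dim + 1))]
  · refine Finset.sum_congr rfl fun q hq => ?_
    have hq' := Finset.mem_range.1 hq
    rw [Finset.sum_Ico_eq_sum_range, show σ.dim + 1 - q = σ.dim - q + 1 by omega]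
    refine Finset.sum_congr rfl fun r hr => ?_
    have hr' := Finset.mem_range.1 hr
    rw [mul_assoc]
    simp only [sub_sub]
    congr 1
    · congr 2
      refine sub_congr _ rfl fun j hj => ?_
      simp only [id]
      rw [min_eq_left (a := j) (b := q + r) (by omega)]
    · congr 1
      · congr 2
        refine sub_congr _ (by omega) fun j hj => ?_
        simp only [id]
        rw [min_eq_left (a := j) (by omega), min_eq_left (a := j + q) (by omega)]
      · congr 2
        refine sub_congr _ (by omega) fun j hj => ?_
        rw [min_eq_left (a := j + r) (by omega), add_assoc, add_comm q]
  · intro p q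
    simp only [Finset.mem_range, Finset.mem_Ico]
    omega

lemma sgn_sgn (c : Chain X) : sgn (sgn c) = c := by
  have : (sgn : Chain X →ₗ[ℚ] Chain X).comp sgn = LinearMap.id := hom_ext fun σ => by
    rw [LinearMap.comp_apply, sgn_bas, map_smul, sgn_bas, smul_smul, ← pow_add,
      Even.neg_one_pow ⟨_, rfl⟩, one_smul, LinearMap.id_apply]
  exact LinearMap.congr_fun this c

lemma sgn_bd (c : Chain X) : sgn (bd c) = - bd (sgn c) := by
  have : (sgn : Chain X →ₗ[ℚ] Chain X).comp bd = - bd.comp sgn := hom_ext fun σ => by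
    rw [LinearMap.neg_apply, LinearMap.comp_apply, LinearMap.comp_apply, sgn_bas, map_smul, bd_bas]
    obtain h | ⟨m, h⟩ : σ.dim = 0 ∨ ∃ m, σ.dim = m + 1 := by
      cases h : σ.dim <;> simp
    · rw [bdS_of_dim_zero h, map_zero, smul_zero, neg_zero]
    · rw [bdS_of_dim_succ h, map_sum, Finset.smul_sum, ← Finset.sum_neg_distrib]
      refine Finset.sum_congr rfl fun i _ => ?_
      rw [map_smul, sgn_bas, sub_dim, h, pow_succ]
      module
  exact LinearMap.congr_fun this c

/-- Cocycles. -/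
def IsCocycle (a : Cochain X) : Prop := ∀ c, a (bd c) = 0

/-- Cohomologous cochains. -/
def Cohom (a b : Cochain X) : Prop := ∃ h : Cochain X, ∀ c, a c = b c + h (bd c)

lemma IsCocycle.cup {a b : Cochain X} (ha : IsCocycle a) (hb : IsCocycle b) :
    IsCocycle (cup a b) := fun c => by
  have h1 : a.comp bd = 0 := LinearMap.ext ha
  have h2 : b.comp bd = 0 := LinearMap.ext hb
  rw [cup_bd, h1, h2, cup_zero_left, cup_zero_right]; simp

lemma IsCocycle.pull {a : Cochain Y} (ha : IsCocycle a) (g : C(X, Y)) : IsCocycle (pull g a) :=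
  fun c => by rw [LinearMap.comp_apply, push_bd, ha]

lemma Cohom.symm {a b : Cochain X} (h : Cohom a b) : Cohom b a := by
  obtain ⟨u, hu⟩ := h
  exact ⟨-u, fun c => by rw [hu, LinearMap.neg_apply]; ring⟩

lemma Cohom.trans {a b c : Cochain X} (h : Cohom a b) (h' : Cohom b c) : Cohom a c := by
  obtain ⟨u, hu⟩ := h
  obtain ⟨v, hv⟩ := h'
  exact ⟨u + v, fun c => by rw [hu, hv, LinearMap.add_apply]; ring⟩

lemma Cohom.smul {a b : Cochain X} (h : Cohom a b) (r : ℚ) : Cohom (r • a) (r • b) := by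
  obtain ⟨u, hu⟩ := h
  exact ⟨r • u, fun c => by simp only [LinearMap.smul_apply, hu, smul_eq_mul]; ring⟩

lemma Cohom.cup_right {a b c : Cochain X} (h : Cohom a b) (hc : IsCocycle c) :
    Cohom (cup a c) (cup b c) := by
  obtain ⟨u, hu⟩ := h
  refine ⟨cup u c, fun z => ?_⟩
  have e : a = b + u.comp bd := LinearMap.ext hu
  have hc' : c.comp bd = 0 := LinearMap.ext hc
  rw [e, cup_add_left, cup_bd, hc', cup_zero_right, LinearMap.add_apply, LinearMap.zero_apply,
    add_zero]

lemma Cohom.cup_left {a b c : Cochain X} (h : Cohom a b) (hc : IsCocycle c) :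
    Cohom (cup c a) (cup c b) := by
  obtain ⟨u, hu⟩ := h
  refine ⟨cup (c.comp sgn) u, fun z => ?_⟩
  have e : a = b + u.comp bd := LinearMap.ext hu
  have h1 : (c.comp sgn).comp bd = 0 := LinearMap.ext fun z => by
    rw [LinearMap.comp_apply, LinearMap.comp_apply, sgn_bd, map_neg, hc, neg_zero]; rfl
  have h2 : (c.comp sgn).comp sgn = c := LinearMap.ext fun z => by
    rw [LinearMap.comp_apply, LinearMap.comp_apply, sgn_sgn]
  rw [e, cup_add_right, cup_bd, h1, h2, cup_zero_left, LinearMap.add_apply, LinearMap.zero_apply,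
    zero_add]

lemma Cohom.apply_eq {a b : Cochain X} (h : Cohom a b) {c : Chain X} (hc : bd c = 0) :
    a c = b c := by
  obtain ⟨u, hu⟩ := h
  rw [hu, hc, map_zero, add_zero]

/-- Homogeneous cochains. -/
def Homog (n : ℕ) (a : Cochain X) : Prop := ∀ c, a (part n c) = a c

lemma Homog.eq_zero {n : ℕ} {a : Cochain X} (h : Homog n a) (σ : Sing X) (hσ : σ.dim ≠ n) :
    a (bas σ) = 0 := by
  rw [← h, part_bas_of_ne σ hσ, map_zero]

lemma Homog.of_bas {n : ℕ} {a : Cochain X} (h : ∀ σ, σ.dim ≠ n → a (bas σ) = 0) : Homog n a := by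
  intro c
  have : a.comp (part n) = a := hom_ext fun σ => by
    rw [LinearMap.comp_apply]
    by_cases hσ : σ.dim = n
    · rw [part_bas_self σ hσ]
    · rw [part_bas_of_ne σ hσ, map_zero, h σ hσ]
  exact LinearMap.congr_fun this c

lemma Homog.pull {n : ℕ} {a : Cochain Y} (h : Homog n a) (g : C(X, Y)) : Homog n (pull g a) :=
  fun c => by rw [LinearMap.comp_apply, ← part_push, h]; rfl

lemma Homog.cup {m n : ℕ} {a b : Cochain X} (ha : Homog m a) (hb : Homog n b) :
    Homog (m + n) (cup a b) := .of_bas fun σ hσ => by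
  rw [cup_bas]
  refine Finset.sum_eq_zero fun p hp => ?_
  have hp' := Finset.mem_range.1 hp
  by_cases h : p = m
  · rw [hb.eq_zero _ (by rw [sub_dim]; omega), mul_zero]
  · rw [ha.eq_zero _ (by rw [sub_dim]; exact h), zero_mul]

lemma homog_aug : Homog 0 (aug : Cochain X) := .of_bas fun σ hσ => by
  rw [aug_bas, if_neg hσ]

/-- The sign of the reversal of a simplex. -/
def revSign (n : ℕ) : ℚ := (-1) ^ (n * (n + 1) / 2)

lemma revSign_add (m n : ℕ) : revSign (m + n) = revSign m * revSign n * (-1) ^ (m * n) := by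
  rw [revSign, revSign, revSign, ← pow_add, ← pow_add]
  congr 1
  obtain ⟨a, ha⟩ := Nat.even_mul_succ_self m
  obtain ⟨b, hb⟩ := Nat.even_mul_succ_self n
  rw [show (m + n) * (m + n + 1) = (a + b + m * n) + (a + b + m * n) by linarith, ha, hb]
  omega

/-- The signed reversal of the universal simplex. -/
noncomputable def revU (n : ℕ) : Chain (Simplex n) := revSign n • bas (sub (univS n) n (n - ·))

lemma natEnd_revU_bas (σ : Sing X) :
    natEnd revU (bas σ) = revSign σ.dim • bas (sub σ σ.dim (σ.dim - ·)) := by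
  rw [natEnd_bas, revU, map_smul, push_bas, pushS_sub, pushS_univS]

lemma bd_revU (n : ℕ) : bd (revU n) = natEnd revU (bdS (univS n)) := by
  cases n with
  | zero => rw [revU, map_smul, bd_bas, bdS_of_dim_zero rfl, bdS_of_dim_zero rfl, map_zero,
      smul_zero]
  | succ m =>
    rw [revU, map_smul, bd_bas, bd_sub, bdS_of_dim_succ (n := m) rfl, map_sum, Finset.smul_sum,
      ← Finset.sum_range_reflect]
    refine Finset.sum_congr rfl fun i hi => ?_
    have hi' := Finset.mem_range.1 hi
    rw [map_smul, natEnd_revU_bas, sub_dim, sub_sub, smul_smul, smul_smul]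
    congr 1
    · have : (-1 : ℚ) ^ m * (-1) ^ (m + 2 - 1 - i) * (-1) = (-1) ^ i := by
        rw [← pow_add, ← pow_succ, show m + (m + 2 - 1 - i) + 1 = 2 * (m + 1 - i) + i by omega,
          pow_add, pow_mul, neg_one_sq, one_pow, one_mul]
      rw [revSign_add, show revSign 1 = -1 by norm_num [revSign], mul_one, ← this]
      ring
    · congr 1
      refine sub_congr _ rfl fun j hj => ?_
      congr 1
      simp only [coface]
      split_ifs <;> omega

lemma aug_revU (n : ℕ) : aug (revU n) = aug (bas (univS n)) := by
  rw [revU, map_smul, aug_bas, aug_bas, sub_dim, show (univS n).dim = n from rfl]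
  split_ifs with h
  · subst h; simp [revSign]
  · simp

lemma cohom_natEnd_revU {a : Cochain X} (ha : IsCocycle a) : Cohom (a.comp (natEnd revU)) a := by
  obtain ⟨θ, hθ⟩ := exists_natEnd_homotopy bd_revU aug_revU
  refine ⟨a.comp (natEnd θ), fun c => ?_⟩
  have := congrArg a (hθ X c)
  rw [map_add, map_sub, ha, zero_add] at this
  rw [LinearMap.comp_apply, LinearMap.comp_apply, this]
  ring

lemma cup_natEnd_revU {m n : ℕ} {a b : Cochain X} (ha : Homog m a) (hb : Homog n b) :
    (cup a b).comp (natEnd revU) =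
      (-1 : ℚ) ^ (m * n) • cup (b.comp (natEnd revU)) (a.comp (natEnd revU)) := hom_ext fun σ => by
  rw [LinearMap.comp_apply, natEnd_revU_bas, map_smul, LinearMap.smul_apply, cup_bas, cup_bas,
    smul_eq_mul, smul_eq_mul, Finset.mul_sum, Finset.mul_sum, ← Finset.sum_range_reflect]
  refine Finset.sum_congr rfl fun q hq => ?_
  have hq' := Finset.mem_range.1 hq
  simp only [sub_dim, LinearMap.comp_apply, natEnd_revU_bas, map_smul, smul_eq_mul, sub_sub]
  by_cases h : q = n ∧ σ.dim - q = m
  · obtain ⟨rfl, h⟩ := h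
    have e1 : sub σ (σ.dim + 1 - 1 - q) (fun j => σ.dim - min (id j) σ.dim) =
        sub σ (σ.dim - q) fun j => min (σ.dim - q - j) (σ.dim - q) + q :=
      sub_congr _ (by omega) fun j hj => by simp only [id]; omega
    have e2 : sub σ (σ.dim - (σ.dim + 1 - 1 - q))
        (fun j => σ.dim - min (j + (σ.dim + 1 - 1 - q)) σ.dim) =
        sub σ q fun j => id (min (q - j) q) :=
      sub_congr _ (by omega) fun j hj => by simp only [id]; omega
    rw [e1, e2, show revSign σ.dim = revSign (m + q) by congr 1; omega, revSign_add, h]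
    ring
  · rw [mul_eq_zero_of_right, mul_eq_zero_of_right]
    · by_cases h' : q = n
      · exact mul_eq_zero_of_right _ (mul_eq_zero_of_right _ (ha.eq_zero _ fun e => h ⟨h', e⟩))
      · exact mul_eq_zero_of_left (mul_eq_zero_of_right _ (hb.eq_zero _ h')) _
    · by_cases h' : σ.dim - (σ.dim + 1 - 1 - q) = n
      · refine mul_eq_zero_of_left (ha.eq_zero _ fun e => h ⟨by omega, ?_⟩) _
        rw [sub_dim] at e
        omega
      · exact mul_eq_zero_of_right _ (hb.eq_zero _ h')

lemma cohom_cup_comm {m n : ℕ} {a b : Cochain X} (ha : Homog m a) (hb : Homog n b)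
    (ha' : IsCocycle a) (hb' : IsCocycle b) :
    Cohom (cup a b) ((-1 : ℚ) ^ (m * n) • cup b a) := by
  refine (cohom_natEnd_revU (ha'.cup hb')).symm.trans ?_
  rw [cup_natEnd_revU ha hb]
  have hr : IsCocycle (a.comp (natEnd revU)) := fun c => by
    obtain ⟨u, hu⟩ := cohom_natEnd_revU ha'
    rw [hu, ha', bd_bd, map_zero, add_zero]
  exact Cohom.smul (((cohom_natEnd_revU hb').cup_right hr).trans
    ((cohom_natEnd_revU ha').cup_left hb')) _

end SingularQ

namespace SingularQ

open Finset

variable {X Y Z : Type} [TopologicalSpace X] [TopologicalSpace Y] [TopologicalSpace Z]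

section Slant

/-- The slant product with a cochain of the second factor. -/
noncomputable def slant (b : Cochain Y) : Chain (X × Y) →ₗ[ℚ] Chain X :=
  aw ((LinearMap.lsmul ℚ (Chain X)).flip.compl₁₂ (push ContinuousMap.fst)
    (b.comp (push ContinuousMap.snd)))

lemma slant_bas (b : Cochain Y) (σ : Sing (X × Y)) : slant b (bas σ) = ∑ p ∈ range (σ.dim + 1),
    b (bas (sub (pushS ContinuousMap.snd σ) (σ.dim - p) (· + p))) •
      bas (sub (pushS ContinuousMap.fst σ) p id) := by
  rw [slant, aw_bas]
  refine Finset.sum_congr rfl fun p _ => ?_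
  simp only [LinearMap.compl₁₂_apply, push_bas, LinearMap.comp_apply, pushS_sub]
  rfl

lemma slant_bd {b : Cochain Y} (hb : IsCocycle b) (c : Chain (X × Y)) :
    slant b (bd c) = bd (slant b c) := by
  rw [slant, aw_bd, map_aw]
  have h1 : (b.comp (push (ContinuousMap.snd : C(X × Y, Y)))).comp bd = 0 :=
    LinearMap.ext fun c => hb.pull ContinuousMap.snd c
  have : aw (((LinearMap.lsmul ℚ (Chain X)).flip.compl₁₂ (push ContinuousMap.fst)
      (b.comp (push (ContinuousMap.snd : C(X × Y, Y))))).compl₁₂ sgn bd) = 0 := hom_ext fun σ => by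
    rw [aw_bas]
    refine Finset.sum_eq_zero fun p _ => ?_
    have := LinearMap.congr_fun h1 (bas (sub σ (σ.dim - p) (· + p)))
    rw [LinearMap.comp_apply] at this
    rw [LinearMap.compl₁₂_apply, LinearMap.compl₁₂_apply, this]
    exact zero_smul ℚ (push ContinuousMap.fst _)
  rw [this, LinearMap.zero_apply, add_zero]
  congr 2
  refine LinearMap.ext₂ fun x y => ?_
  change b (push ContinuousMap.snd y) • push ContinuousMap.fst (bd x) =
    bd (b (push ContinuousMap.snd y) • push ContinuousMap.fst x)
  rw [map_smul, push_bd]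

lemma apply_slant (a : Cochain X) (b : Cochain Y) (c : Chain (X × Y)) :
    a (slant b c) = cup (pull ContinuousMap.fst a) (pull ContinuousMap.snd b) c := by
  rw [slant, map_aw, cup]
  congr 2
  refine LinearMap.ext₂ fun x y => ?_
  change a (b (push ContinuousMap.snd y) • push ContinuousMap.fst x) =
    a (push ContinuousMap.fst x) * b (push ContinuousMap.snd y)
  rw [map_smul, smul_eq_mul, mul_comm]

lemma aug_cup (b : Cochain X) : cup aug b = b := hom_ext fun σ => by
  rw [cup_bas, Finset.sum_range_succ', Finset.sum_eq_zero, zero_add, aug_bas,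
    if_pos (sub_dim _ _ _), one_mul]
  · exact congrArg (fun τ => b (bas τ)) (sub_eq_self σ (Nat.sub_zero _) fun j hj => min_eq_left hj)
  · intro p _
    rw [aug_bas, if_neg (by rw [sub_dim]; omega), zero_mul]

lemma aug_slant (b : Cochain Y) (c : Chain (X × Y)) :
    aug (slant b c) = b (push ContinuousMap.snd c) := by
  rw [apply_slant, pull_aug, aug_cup]; rfl

lemma slant_mem_chainsIn (b : Cochain Y) {U : Set X} {c : Chain (X × Y)}
    (hc : c ∈ chainsIn (Prod.fst ⁻¹' U)) : slant b c ∈ chainsIn U := by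
  refine chainsIn_induction _ _ (fun σ hσ => ?_) hc
  rw [slant_bas]
  exact Submodule.sum_mem _ fun p _ => Submodule.smul_mem _ _ (bas_mem_chainsIn fun x => hσ _)

lemma slant_push (b : Cochain Y) (g : C(X, Z)) (c : Chain (X × Y)) :
    slant b (push (g.prodMap (ContinuousMap.id Y)) c) = push g (slant b c) := by
  have : (slant b).comp (push (g.prodMap (ContinuousMap.id Y))) = (push g).comp (slant b) :=
    hom_ext fun σ => by
      rw [LinearMap.comp_apply, LinearMap.comp_apply, push_bas, slant_bas, slant_bas, map_sum]
      refine Finset.sum_congr rfl fun p _ => ?_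
      rw [map_smul, push_bas]
      rfl
  exact LinearMap.congr_fun this c

end Slant

/-- A family of homogeneous cocycles that is a basis of the rational cohomology. -/
structure IsCohomBasis {ι : Type} (deg : ι → ℕ) (a : ι → Cochain X) : Prop where
  homog : ∀ i, Homog (deg i) (a i)
  cocycle : ∀ i, IsCocycle (a i)
  exact : ∀ c, bd c = 0 → (∀ i, a i c = 0) → ∃ e, bd e = c
  surj : ∀ v : ι → ℚ, ∃ c, bd c = 0 ∧ ∀ i, a i c = v i

lemma IsCohomBasis.of_homeomorph {ι : Type} {deg : ι → ℕ} {a : ι → Cochain X}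
    (h : IsCohomBasis deg a) (e : Y ≃ₜ X) :
    IsCohomBasis deg fun i => pull (e : C(Y, X)) (a i) where
  homog i := (h.homog i).pull _
  cocycle i := (h.cocycle i).pull _
  exact c hc hi := by
    obtain ⟨v, hv⟩ := h.exact (push (e : C(Y, X)) c) (by rw [← push_bd, hc, map_zero]) hi
    refine ⟨push (e.symm : C(X, Y)) v, ?_⟩
    rw [← push_bd, hv, ← push_comp]
    convert push_id c using 2
    congr 1
    ext x
    exact e.symm_apply_apply x
  surj v := by
    obtain ⟨c, hc, hi⟩ := h.surj v
    refine ⟨push (e.symm : C(X, Y)) c, by rw [← push_bd, hc, map_zero], fun i => ?_⟩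
    rw [LinearMap.comp_apply, ← push_comp, ← hi]
    congr 1
    convert push_id c using 2
    congr 1
    ext x
    exact e.apply_symm_apply x

section Kunneth

variable {κ : Type} {deg : κ → ℕ} {b : κ → Cochain Y}

/-- The mapping cone of the slant products. -/
noncomputable def coneBd (X : Type) [TopologicalSpace X] (b : κ → Cochain Y) :
    (Chain (X × Y) × (κ → Chain X)) →ₗ[ℚ] Chain (X × Y) × (κ → Chain X) :=
  LinearMap.prod (bd.comp (LinearMap.fst ℚ _ _)) (LinearMap.pi fun j =>
    (slant (b j)).comp (LinearMap.fst ℚ _ _) -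
      bd.comp ((LinearMap.proj j).comp (LinearMap.snd ℚ _ _)))

lemma coneBd_fst (v : Chain (X × Y) × (κ → Chain X)) : (coneBd X b v).1 = bd v.1 := rfl

lemma coneBd_snd (v : Chain (X × Y) × (κ → Chain X)) (j : κ) :
    (coneBd X b v).2 j = slant (b j) v.1 - bd (v.2 j) := rfl

lemma coneBd_coneBd (hb : ∀ j, IsCocycle (b j)) (v : Chain (X × Y) × (κ → Chain X)) :
    coneBd X b (coneBd X b v) = 0 := by
  refine Prod.ext (bd_bd _) (funext fun j => ?_)
  rw [coneBd_snd, coneBd_fst, coneBd_snd, slant_bd (hb j), map_sub, bd_bd, sub_zero,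
    _root_.sub_self]
  rfl

/-- The part of the cone lying over a subset. -/
noncomputable def coneIn (Y κ : Type) [TopologicalSpace Y] (U : Set X) :
    Submodule ℚ (Chain (X × Y) × (κ → Chain X)) :=
  (chainsIn (Prod.fst ⁻¹' U)).prod (Submodule.pi Set.univ fun _ => chainsIn U)

lemma mem_coneIn {U : Set X} {v : Chain (X × Y) × (κ → Chain X)} : v ∈ coneIn Y κ U ↔
    v.1 ∈ chainsIn (Prod.fst ⁻¹' U) ∧ ∀ j, v.2 j ∈ chainsIn U := by
  simp [coneIn, Submodule.mem_prod, Submodule.mem_pi]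

lemma coneIn_mono {U V : Set X} (h : U ⊆ V) : coneIn Y κ U ≤ coneIn Y κ V := fun v hv => by
  rw [mem_coneIn] at hv ⊢
  exact ⟨chainsIn_mono (Set.preimage_mono h) hv.1, fun j => chainsIn_mono h (hv.2 j)⟩

lemma coneIn_inter (U V : Set X) : coneIn Y κ (U ∩ V) = coneIn Y κ U ⊓ coneIn Y κ V := by
  ext v
  simp only [Submodule.mem_inf, mem_coneIn, Set.preimage_inter, chainsIn_inter]
  constructor
  · exact fun h => ⟨⟨h.1.1, fun j => (h.2 j).1⟩, h.1.2, fun j => (h.2 j).2⟩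
  · exact fun h => ⟨⟨h.1.1, h.2.1⟩, fun j => ⟨h.1.2 j, h.2.2 j⟩⟩

lemma mem_coneIn_sup {U V : Set X} {v : Chain (X × Y) × (κ → Chain X)} :
    v ∈ coneIn Y κ U ⊔ coneIn Y κ V ↔
      v.1 ∈ chainsIn (Prod.fst ⁻¹' U) ⊔ chainsIn (Prod.fst ⁻¹' V) ∧
      ∀ j, v.2 j ∈ chainsIn U ⊔ chainsIn V := by
  constructor
  · intro h
    obtain ⟨x, hx, y, hy, rfl⟩ := Submodule.mem_sup.1 h
    rw [mem_coneIn] at hx hy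
    exact ⟨Submodule.add_mem_sup hx.1 hy.1, fun j => Submodule.add_mem_sup (hx.2 j) (hy.2 j)⟩
  · rintro ⟨h1, h2⟩
    obtain ⟨x, hx, y, hy, hxy⟩ := Submodule.mem_sup.1 h1
    choose x' hx' y' hy' hxy' using fun j => Submodule.mem_sup.1 (h2 j)
    refine Submodule.mem_sup.2 ⟨(x, x'), mem_coneIn.2 ⟨hx, hx'⟩, (y, y'),
      mem_coneIn.2 ⟨hy, hy'⟩, ?_⟩
    exact Prod.ext hxy (funext hxy')

lemma coneBd_mem_coneIn {U : Set X} {v : Chain (X × Y) × (κ → Chain X)} (hv : v ∈ coneIn Y κ U) :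
    coneBd X b v ∈ coneIn Y κ U := by
  rw [mem_coneIn] at hv ⊢
  exact ⟨bd_mem_chainsIn hv.1, fun j =>
    Submodule.sub_mem _ (slant_mem_chainsIn (b j) hv.1) (bd_mem_chainsIn (hv.2 j))⟩

lemma acyc_coneIn_sup (hb : ∀ j, IsCocycle (b j)) {U V : Set X} (hU : IsOpen U) (hV : IsOpen V) :
    Acyc (coneBd X b) (coneIn Y κ (U ∪ V)) (coneIn Y κ U ⊔ coneIn Y κ V) := by
  intro v hv hd
  rw [mem_coneIn] at hv
  rw [mem_coneIn_sup] at hd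
  obtain ⟨e, he, he'⟩ := acyc_sup (hU.preimage continuous_fst) (hV.preimage continuous_fst) v.1
    hv.1 hd.1
  have hs : ∀ j, slant (b j) (v.1 - bd e) ∈ chainsIn U ⊔ chainsIn V := by
    intro j
    obtain ⟨x, hx, y, hy, hxy⟩ := Submodule.mem_sup.1 he'
    rw [← hxy, map_add]
    exact Submodule.add_mem_sup (slant_mem_chainsIn _ hx) (slant_mem_chainsIn _ hy)
  have : ∀ j, ∃ f ∈ chainsIn (U ∪ V), v.2 j - slant (b j) e - bd f ∈ chainsIn U ⊔ chainsIn V := by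
    intro j
    refine acyc_sup hU hV _ (Submodule.sub_mem _ (hv.2 j) (slant_mem_chainsIn _ he)) ?_
    have := Submodule.sub_mem _ (hs j) (hd.2 j)
    rw [coneBd_snd, map_sub, slant_bd (hb j)] at this
    rw [map_sub]
    convert this using 1
    abel
  choose f hf hf' using this
  refine ⟨(e, -f), mem_coneIn.2 ⟨he, fun j => Submodule.neg_mem _ (hf j)⟩, mem_coneIn_sup.2
    ⟨he', fun j => ?_⟩⟩
  convert hf' j using 1
  change v.2 j - (slant (b j) e - bd (-f j)) = _
  rw [map_neg]
  abel

/-- The slant products are a quasi-isomorphism over the open set `U`. -/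
def KunnethOn (b : κ → Cochain Y) (U : Set X) : Prop :=
  IsOpen U ∧ Acyc (coneBd X b) (coneIn Y κ U) ⊥

lemma KunnethOn.union (hb : ∀ j, IsCocycle (b j)) {U V : Set X} (hU : KunnethOn b U)
    (hV : KunnethOn b V) (hUV : KunnethOn b (U ∩ V)) : KunnethOn b (U ∪ V) := by
  refine ⟨hU.1.union hV.1, ?_⟩
  refine Acyc.union (A₁ := coneIn Y κ U) (A₂ := coneIn Y κ V) (B₁ := ⊥) (B₂ := ⊥)
    (coneBd_coneBd hb) (sup_le (coneIn_mono Set.subset_union_left)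
      (coneIn_mono Set.subset_union_right)) (by simp) bot_le bot_le bot_le
    (fun _ => coneBd_mem_coneIn) (fun _ => coneBd_mem_coneIn) ?_ ?_
    (acyc_coneIn_sup hb hU.1 hV.1) ?_ hU.2 hV.2 ?_
  · rintro a rfl
    exact (map_zero _ : coneBd X b 0 = 0)
  · rintro a rfl
    exact (map_zero _ : coneBd X b 0 = 0)
  · rw [sup_idem]
    exact Acyc.refl _ _
  · rw [← coneIn_inter, inf_idem]
    exact hUV.2

lemma KunnethOn.iUnion [Finite κ] {ι : Type} [Nonempty ι] {U : ι → Set X}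
    (hdir : Directed (· ⊆ ·) U) (h : ∀ i, KunnethOn b (U i)) : KunnethOn b (⋃ i, U i) := by
  refine ⟨isOpen_iUnion fun i => (h i).1, fun v hv hd => ?_⟩
  rw [mem_coneIn] at hv
  obtain ⟨i₀, h₀⟩ := exists_mem_chainsIn_of_directed (U := fun i => Prod.fst ⁻¹' U i)
    (fun i => (h i).1.preimage continuous_fst)
    (fun i j => (hdir i j).imp fun k hk => ⟨Set.preimage_mono hk.1, Set.preimage_mono hk.2⟩)
    (by rw [← Set.preimage_iUnion]; exact hv.1)
  choose i hi using fun j => exists_mem_chainsIn_of_directed (fun i => (h i).1) hdir (hv.2 j)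
  obtain ⟨l, hl⟩ := hdir.finite_le fun o : Option κ => o.elim i₀ i
  obtain ⟨e, he, he'⟩ := (h l).2 v (mem_coneIn.2 ⟨chainsIn_mono (Set.preimage_mono (hl none)) h₀,
    fun j => chainsIn_mono (hl (some j)) (hi j)⟩) hd
  exact ⟨e, coneIn_mono (Set.subset_iUnion _ l) he, he'⟩

lemma kunnethOn_empty : KunnethOn b (∅ : Set X) := by
  refine ⟨isOpen_empty, fun v hv _ => ⟨0, Submodule.zero_mem _, ?_⟩⟩
  rw [mem_coneIn, Set.preimage_empty, chainsIn_empty, chainsIn_empty] at hv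
  rw [map_zero, sub_zero]
  exact Prod.ext hv.1 (funext hv.2)

lemma acyc_cone_of_contraction (hb : IsCohomBasis deg b) (H : Contraction X) :
    Acyc (coneBd X b) ⊤ ⊥ := by
  intro v _ hv
  obtain ⟨P, hP, -, -⟩ := exists_homotopy_operator (X := X × Y) (Y := X × Y)
    ⟨fun q => (H.toFun (q.1.1, q.2), q.1.2), by fun_prop⟩
  let i : C(Y, X × Y) := ⟨fun y => (H.apex, y), by fun_prop⟩
  have hP' : ∀ c, bd (P c) + P (bd c) = push i (push ContinuousMap.snd c) - c := by
    intro c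
    rw [hP, ← push_comp]
    congr 1
    · congr 2
      ext x
      · exact H.map_one _
      · rfl
    · convert push_id c using 2
      congr 1
      ext x
      · exact H.map_zero _
      · rfl
  have hv : coneBd X b v = 0 := hv
  have h1 : bd v.1 = 0 := congrArg Prod.fst hv
  have h2 : ∀ j, slant (b j) v.1 = bd (v.2 j) := fun j =>
    sub_eq_zero.1 (congrFun (congrArg Prod.snd hv) j)
  obtain ⟨e, he⟩ := hb.exact (push ContinuousMap.snd v.1) (by rw [← push_bd, h1, map_zero])
    fun j => by rw [← aug_slant, h2, aug_bd]
  have hc : v.1 = bd (push i e - P v.1) := by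
    have := hP' v.1
    rw [h1, map_zero, add_zero, ← he] at this
    rw [map_sub, ← push_bd, this]
    abel
  obtain ⟨y, hy, hy'⟩ := hb.surj fun j => aug (v.2 j - slant (b j) (push i e - P v.1))
  have : ∀ j, ∃ w, bd w = slant (b j) (push i y) - (v.2 j - slant (b j) (push i e - P v.1)) := by
    intro j
    refine ⟨_, exists_bd_of_contraction H ?_ ?_⟩
    · rw [map_sub, map_sub, ← slant_bd (hb.cocycle j), ← slant_bd (hb.cocycle j), ← hc, ← push_bd,
        hy, map_zero, map_zero, h2, _root_.sub_self, _root_.sub_self]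
    · rw [map_sub, ← hy' j, aug_slant, ← push_comp]
      have : (ContinuousMap.snd.comp i : C(Y, Y)) = ContinuousMap.id Y := rfl
      rw [this, push_id, _root_.sub_self]
  choose w hw using this
  refine ⟨(push i e - P v.1 + push i y, w), trivial, ?_⟩
  change v - _ = 0
  rw [sub_eq_zero]
  refine Prod.ext ?_ (funext fun j => ?_)
  · rw [coneBd_fst, map_add, ← hc, ← push_bd, hy, map_zero, add_zero]
  · rw [coneBd_snd, hw, map_add]
    abel

lemma kunnethOn_of_contraction (hb : IsCohomBasis deg b) {U : Set X} (hU : IsOpen U)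
    (H : Contraction U) : KunnethOn b U := by
  refine ⟨hU, fun v hv hd => ?_⟩
  have hd : coneBd X b v = 0 := hd
  rw [mem_coneIn] at hv
  have hinj : Function.Injective ((incl U).prodMap (ContinuousMap.id Y)) :=
    Subtype.val_injective.prodMap Function.injective_id
  have : ∃ c, push ((incl U).prodMap (ContinuousMap.id Y)) c = v.1 := by
    obtain ⟨c, hc⟩ := exists_push_incl hv.1
    let g : C(Prod.fst ⁻¹' U, U × Y) := ⟨fun x => (⟨x.1.1, x.2⟩, x.1.2), by fun_prop⟩
    refine ⟨push g c, ?_⟩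
    rw [← push_comp, ← hc]
    rfl
  obtain ⟨c, hc⟩ := this
  choose z hz using fun j => exists_push_incl (hv.2 j)
  have h0 : coneBd U b (c, z) = 0 := by
    refine Prod.ext (push_injective hinj ?_) (funext fun j =>
      push_injective (g := incl U) Subtype.val_injective ?_)
    · rw [coneBd_fst, push_bd, hc]
      exact (congrArg Prod.fst hd).trans (map_zero _).symm
    · rw [coneBd_snd, map_sub, ← slant_push, push_bd, hc, hz]
      exact (congrFun (congrArg Prod.snd hd) j).trans (map_zero _).symm
  obtain ⟨e, -, he⟩ := acyc_cone_of_contraction hb H (c, z) trivial h0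
  have he : (c, z) = coneBd U b e := sub_eq_zero.1 he
  refine ⟨(push ((incl U).prodMap (ContinuousMap.id Y)) e.1, fun j => push (incl U) (e.2 j)),
    mem_coneIn.2 ⟨?_, fun j => push_incl_mem _ _⟩, ?_⟩
  · have := push_mem_chainsIn (g := (incl U).prodMap (ContinuousMap.id Y)) (U := Set.univ)
      (V := Prod.fst ⁻¹' U) (fun x _ => x.1.2) (c := e.1) (by rw [chainsIn_univ]; trivial)
    exact this
  · change v - _ = 0
    rw [sub_eq_zero]
    refine Prod.ext ?_ (funext fun j => ?_)
    · rw [coneBd_fst, ← push_bd, ← hc]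
      exact congrArg _ (congrArg Prod.fst he)
    · rw [coneBd_snd, slant_push, ← push_bd, ← map_sub, ← hz]
      exact congrArg _ (congrFun (congrArg Prod.snd he) j)

/-- A contraction transported along a homeomorphism. -/
def Contraction.ofHomeomorph (H : Contraction X) (e : Y ≃ₜ X) : Contraction Y where
  toFun := ⟨fun q => e.symm (H.toFun (e q.1, q.2)), by fun_prop⟩
  apex := e.symm H.apex
  map_zero x := by simp [H.map_zero]
  map_one x := by simp [H.map_one]

lemma kunnethOn_chart (hb : IsCohomBasis deg b) {d : ℕ} (φ : OpenPartialHomeomorph X (Fin d → ℝ))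
    {B : Set (Fin d → ℝ)} (hB : IsOpen B) (hcB : Convex ℝ B) (ht : B ⊆ φ.target) :
    KunnethOn b (φ.source ∩ φ ⁻¹' B) := by
  obtain rfl | ⟨p, hp⟩ := B.eq_empty_or_nonempty
  · rw [Set.preimage_empty, Set.inter_empty]
    exact kunnethOn_empty
  let e : (φ.source ∩ φ ⁻¹' B : Set X) ≃ₜ B :=
    { toFun := fun x => ⟨φ x, x.2.2⟩
      invFun := fun y => ⟨φ.symm y, φ.map_target (ht y.2), by
        rw [Set.mem_preimage, φ.right_inv (ht y.2)]; exact y.2⟩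
      left_inv := fun x => Subtype.ext (φ.left_inv x.2.1)
      right_inv := fun y => Subtype.ext (φ.right_inv (ht y.2))
      continuous_toFun := Continuous.subtype_mk
        (φ.continuousOn.comp_continuous continuous_subtype_val fun x => x.2.1) _
      continuous_invFun := Continuous.subtype_mk
        (φ.symm.continuousOn.comp_continuous continuous_subtype_val fun y => ht y.2) _ }
  exact kunnethOn_of_contraction hb (φ.isOpen_inter_preimage hB)
    ((starContraction (hcB.starConvex hp) hp).ofHomeomorph e)

lemma kunnethOn_univ [Finite κ] (hb : IsCohomBasis deg b) {d : ℕ}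
    (φ : X → OpenPartialHomeomorph X (Fin d → ℝ)) (hφ : ∀ x, x ∈ (φ x).source) :
    KunnethOn b (Set.univ : Set X) := by
  refine local_basis_induction (P := KunnethOn b) (adm := IsOpen) kunnethOn_empty
    (fun U V hU hV => hU.inter hV) (fun U V h1 h2 h3 => h1.union hb.cocycle h2 h3)
    (fun ι U _ hdir hU => KunnethOn.iUnion hdir hU) (fun x => (φ x).source)
    (fun x => {V | ∃ B, (IsOpen B ∧ Convex ℝ B ∧ B ⊆ (φ x).target) ∧
      V = (φ x).source ∩ φ x ⁻¹' B}) (fun x => ⟨x, hφ x⟩) ?_ ?_ ?_ ?_ isOpen_univ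
  · rintro x _ ⟨B, ⟨h1, h2, h3⟩, rfl⟩ _ ⟨B', ⟨h1', h2', h3'⟩, rfl⟩
    refine ⟨B ∩ B', ⟨h1.inter h1', h2.inter h2', Set.inter_subset_left.trans h3⟩, ?_⟩
    ext y
    simp only [Set.mem_inter_iff, Set.mem_preimage]
    tauto
  · rintro x _ ⟨B, ⟨h1, h2, h3⟩, rfl⟩
    exact kunnethOn_chart hb _ h1 h2 h3
  · rintro x _ ⟨B, ⟨h1, h2, h3⟩, rfl⟩
    exact ⟨(φ x).isOpen_inter_preimage h1, Set.inter_subset_left⟩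
  · intro x U y hU hyU hyx
    obtain ⟨ε, hε, hball⟩ := Metric.isOpen_iff.1 ((φ x).isOpen_inter_preimage_symm hU) (φ x y)
      ⟨(φ x).map_source hyx, by rw [Set.mem_preimage, (φ x).left_inv hyx]; exact hyU⟩
    refine ⟨_, ⟨Metric.ball (φ x y) ε, ⟨Metric.isOpen_ball, convex_ball _ _,
      hball.trans Set.inter_subset_left⟩, rfl⟩, ⟨hyx, Metric.mem_ball_self hε⟩, ?_⟩
    rintro z ⟨hz, hz'⟩
    have := (hball hz').2
    rwa [Set.mem_preimage, (φ x).left_inv hz] at this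

/-- The Künneth theorem. -/
theorem IsCohomBasis.prod {ι : Type} {deg' : ι → ℕ} {a : ι → Cochain X} (ha : IsCohomBasis deg' a)
    [Finite κ] (hb : IsCohomBasis deg b) {d : ℕ}
    (φ : X → OpenPartialHomeomorph X (Fin d → ℝ)) (hφ : ∀ x, x ∈ (φ x).source) :
    IsCohomBasis (fun q : ι × κ => deg' q.1 + deg q.2)
      fun q => cup (pull ContinuousMap.fst (a q.1)) (pull ContinuousMap.snd (b q.2)) where
  homog q := ((ha.homog q.1).pull _).cup ((hb.homog q.2).pull _)
  cocycle q := ((ha.cocycle q.1).pull _).cup ((hb.cocycle q.2).pull _)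
  exact c hc hq := by
    have : ∀ j, ∃ z, bd z = slant (b j) c := by
      intro j
      refine ha.exact _ (by rw [← slant_bd (hb.cocycle j), hc, map_zero]) fun i => ?_
      rw [apply_slant]
      exact hq (i, j)
    choose z hz using this
    have hd : coneBd X b (c, z) = 0 := by
      refine Prod.ext hc (funext fun j => ?_)
      rw [coneBd_snd, hz, _root_.sub_self]
      rfl
    obtain ⟨e, -, he⟩ := (kunnethOn_univ hb φ hφ).2 (c, z) (mem_coneIn.2 (by simp [chainsIn_univ]))
      hd
    exact ⟨e.1, (congrArg Prod.fst (sub_eq_zero.1 he)).symm⟩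
  surj v := by
    choose z hz hz' using fun j => ha.surj fun i => v (i, j)
    have hd : coneBd X b (0, z) = 0 := by
      refine Prod.ext (map_zero bd : bd (0 : Chain (X × Y)) = 0) (funext fun j => ?_)
      rw [coneBd_snd, hz, map_zero, _root_.sub_self]
      rfl
    obtain ⟨e, -, he⟩ := (kunnethOn_univ hb φ hφ).2 (0, z) (mem_coneIn.2 (by simp [chainsIn_univ]))
      hd
    have he : (0, z) = coneBd X b e := sub_eq_zero.1 he
    refine ⟨e.1, (congrArg Prod.fst he).symm, fun q => ?_⟩
    have : z q.2 = slant (b q.2) e.1 - bd (e.2 q.2) := congrFun (congrArg Prod.snd he) q.2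
    rw [← apply_slant, ← hz', this, map_sub, ha.cocycle, sub_zero]

end Kunneth

end SingularQ

namespace SingularQ

open Finset

section HomologyClass

/-- Homology classes of cycles, extended to all chains. -/
lemma exists_homology_class (S : ShortComplex (ModuleCat.{0} ℚ)) :
    ∃ f : S.X₂ →ₗ[ℚ] S.homology, (∀ y, f (S.f.hom y) = 0) ∧
      (∀ x, S.g.hom x = 0 → f x = 0 → ∃ y, S.f.hom y = x) ∧
      ∀ w, ∃ x, S.g.hom x = 0 ∧ f x = w := by
  let e := S.moduleCatHomologyIso.toLinearEquiv
  let R := LinearMap.range S.moduleCatToCycles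
  let π : LinearMap.ker S.g.hom →ₗ[ℚ] S.homology := e.symm.toLinearMap.comp R.mkQ
  obtain ⟨f, hf⟩ := LinearMap.exists_extend π
  have hf' : ∀ x (hx : S.g.hom x = 0), f x = π ⟨x, hx⟩ := fun x hx => LinearMap.congr_fun hf ⟨x, hx⟩
  refine ⟨f, fun y => ?_, fun x hx h => ?_, fun w => ?_⟩
  · have hy : S.g.hom (S.f.hom y) = 0 := S.moduleCat_zero_apply y
    rw [hf' _ hy]
    have : R.mkQ ⟨S.f.hom y, hy⟩ = 0 := (Submodule.Quotient.mk_eq_zero R).2 ⟨y, rfl⟩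
    exact (congrArg e.symm this).trans (map_zero e.symm)
  · rw [hf' x hx] at h
    have : R.mkQ ⟨x, hx⟩ = 0 := e.symm.injective (h.trans (map_zero e.symm).symm)
    obtain ⟨y, hy⟩ := (Submodule.Quotient.mk_eq_zero R).1 this
    exact ⟨y, congrArg Subtype.val hy⟩
  · obtain ⟨⟨x, hx⟩, h⟩ := Submodule.Quotient.mk_surjective R (e w)
    refine ⟨x, hx, ?_⟩
    rw [hf' x hx]
    exact (congrArg e.symm h).trans (e.symm_apply_apply w)

lemma exists_homology_class_complex (K : ChainComplex (ModuleCat.{0} ℚ) ℕ) (n : ℕ) :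
    ∃ f : K.X n →ₗ[ℚ] K.homology n, (∀ y, f ((K.d (n + 1) n).hom y) = 0) ∧
      (∀ x, (∀ m, (K.d n m).hom x = 0) → f x = 0 → ∃ y, (K.d (n + 1) n).hom y = x) ∧
      ∀ w, ∃ x, (∀ m, (K.d n m).hom x = 0) ∧ f x = w := by
  obtain ⟨f, h1, h2, h3⟩ := exists_homology_class (K.sc n)
  have hp : (ComplexShape.down ℕ).prev n = n + 1 := ChainComplex.prev ℕ n
  have key : ∀ p, p = n + 1 → (∀ y, f ((K.d p n).hom y) = 0) →
      (∀ x, (K.d n ((ComplexShape.down ℕ).next n)).hom x = 0 → f x = 0 →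
        ∃ y, (K.d p n).hom y = x) →
      (∀ y, f ((K.d (n + 1) n).hom y) = 0) ∧
      (∀ x, (K.d n ((ComplexShape.down ℕ).next n)).hom x = 0 → f x = 0 →
        ∃ y, (K.d (n + 1) n).hom y = x) := by
    rintro _ rfl h h'
    exact ⟨h, h'⟩
  obtain ⟨h1, h2⟩ := key _ hp h1 h2
  refine ⟨f, h1, fun x hx => h2 x (hx _), fun w => ?_⟩
  obtain ⟨x, hx, hw⟩ := h3 w
  refine ⟨x, fun m => ?_, hw⟩
  by_cases hm : (ComplexShape.down ℕ).Rel n m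
  · obtain rfl := (ComplexShape.down ℕ).next_eq' hm
    exact hx
  · rw [K.shape _ _ hm]
    rfl

end HomologyClass

section Comparison

variable {X : Type} [TopologicalSpace X]

/-- The singular simplices in Mathlib's singular simplicial set. -/
abbrev SimplexQ (X : Type) [TopologicalSpace X] (n : ℕ) : Type :=
  (TopCat.toSSet.obj (TopCat.of X)).obj (Opposite.op (SimplexCategory.mk n))

/-- The comparison of singular simplices. -/
noncomputable def toSing (n : ℕ) (s : SimplexQ X n) : Sing X :=
  ⟨n, TopCat.toSSetObjEquiv (TopCat.of X) (Opposite.op (SimplexCategory.mk n)) s⟩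

lemma toSing_injective (n : ℕ) : Function.Injective (toSing (X := X) n) := fun s t h => by
  have := eq_of_heq (Sing.mk.inj h).2
  exact (TopCat.toSSetObjEquiv (TopCat.of X) _).injective this

lemma exists_toSing (σ : Sing X) : ∃ s : SimplexQ X σ.dim, toSing σ.dim s = σ :=
  ⟨(TopCat.toSSetObjEquiv (TopCat.of X) (Opposite.op (SimplexCategory.mk σ.dim))).symm σ.map,
    congrArg (Sing.mk σ.dim) (Equiv.apply_symm_apply _ σ.map)⟩

lemma toSing_δ (n : ℕ) (i : Fin (n + 2)) (s : SimplexQ X (n + 1)) :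
    toSing n (SimplicialObject.δ (TopCat.toSSet.obj (TopCat.of X)) i s) =
      sub (toSing (n + 1) s) n (coface i) := by
  rw [toSing, toSing, sub_mk]
  have : ∀ x : Simplex n, stdSimplex.map (SimplexCategory.δ i) x =
      vertexMap n (n + 1) (coface i) x := by
    intro x
    have : (fun j : Fin (n + 1) => clip (n + 1) (coface i j)) = i.succAbove := by
      funext j
      ext
      simp only [clip, coface]
      split_ifs with h
      · rw [Fin.succAbove_of_castSucc_lt _ _ (show j.castSucc < i from h), Fin.val_castSucc]
        omega
      · rw [Fin.succAbove_of_le_castSucc _ _ (show i ≤ j.castSucc from not_lt.1 h), Fin.val_succ]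
        omega
    simp only [vertexMap, this]
    rfl
  refine Sing.mk_congr fun x => ?_
  rw [ContinuousMap.comp_apply, ← this]
  rfl

/-- The comparison of chains. -/
noncomputable def toChain (X : Type) [TopologicalSpace X] (n : ℕ) :
    (singularChainComplexQ X).X n →ₗ[ℚ] Chain X :=
  (Finsupp.lmapDomain ℚ ℚ (toSing (X := X) n) : (SimplexQ X n →₀ ℚ) →ₗ[ℚ] Chain X)

lemma toChain_freeMk (n : ℕ) (s : SimplexQ X n) :
    toChain X n (ModuleCat.freeMk s) = bas (toSing n s) :=
  Finsupp.mapDomain_single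

lemma toChain_injective (n : ℕ) : Function.Injective (toChain X n) :=
  Finsupp.mapDomain_injective (toSing_injective n)

lemma objD_hom_apply (A : SimplicialObject (ModuleCat.{0} ℚ)) (n : ℕ)
    (y : A.obj (Opposite.op (SimplexCategory.mk (n + 1)))) :
    ((((AlgebraicTopology.alternatingFaceMapComplex (ModuleCat ℚ)).obj A).d (n + 1) n).hom y :
      A.obj (Opposite.op (SimplexCategory.mk n))) =
      ∑ i : Fin (n + 2), (-1 : ℚ) ^ i.1 • (A.δ i).hom y := by
  rw [AlgebraicTopology.alternatingFaceMapComplex_obj_d,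
    AlgebraicTopology.AlternatingFaceMapComplex.objD, ModuleCat.hom_sum, LinearMap.sum_apply]
  refine Finset.sum_congr rfl fun i _ => ?_
  rw [ModuleCat.hom_zsmul, LinearMap.smul_apply, ← Int.cast_smul_eq_zsmul ℚ]
  push_cast
  rfl

lemma toChain_d (n : ℕ) (x : (singularChainComplexQ X).X (n + 1)) :
    toChain X n (((singularChainComplexQ X).d (n + 1) n).hom x) = bd (toChain X (n + 1) x) := by
  have : ModuleCat.ofHom ((toChain X n).comp ((singularChainComplexQ X).d (n + 1) n).hom) =
      ModuleCat.ofHom (bd.comp (toChain X (n + 1))) := by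
    refine ModuleCat.free_hom_ext (X := SimplexQ X (n + 1)) fun s => ?_
    change toChain X n (((singularChainComplexQ X).d (n + 1) n).hom (ModuleCat.freeMk s)) =
      bd (toChain X (n + 1) (ModuleCat.freeMk s))
    rw [toChain_freeMk, bd_bas, bdS_of_dim_succ (n := n) rfl, Finset.sum_range]
    refine (congrArg (toChain X n) (objD_hom_apply (((SimplicialObject.whiskering _ _).obj
      (ModuleCat.free ℚ)).obj (TopCat.toSSet.obj (TopCat.of X))) n (ModuleCat.freeMk s))).trans ?_
    refine (map_sum (toChain X n) _ _).trans (Finset.sum_congr rfl fun i _ => ?_)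
    refine (map_smul (toChain X n) _ _).trans ?_
    rw [← toSing_δ, ← toChain_freeMk]
    have h : ((((SimplicialObject.whiskering _ _).obj (ModuleCat.free ℚ)).obj
        (TopCat.toSSet.obj (TopCat.of X))).δ i).hom (ModuleCat.freeMk s) =
        (ModuleCat.freeMk (SimplicialObject.δ (TopCat.toSSet.obj (TopCat.of X)) i s) :
          (ModuleCat.free ℚ).obj (SimplexQ X n)) :=
      ModuleCat.free_map_apply _ _
    exact congrArg (fun y => (-1 : ℚ) ^ i.1 • toChain X n y) h
  exact LinearMap.congr_fun (congrArg ModuleCat.Hom.hom this) x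

lemma part_toChain (n : ℕ) (x : (singularChainComplexQ X).X n) :
    part n (toChain X n x) = toChain X n x := by
  have : ModuleCat.ofHom ((part n).comp (toChain X n)) = ModuleCat.ofHom (toChain X n) := by
    refine ModuleCat.free_hom_ext (X := SimplexQ X n) fun s => ?_
    change part n (toChain X n (ModuleCat.freeMk s)) = toChain X n (ModuleCat.freeMk s)
    rw [toChain_freeMk, part_bas_self (toSing n s) (n := n) rfl]
  exact LinearMap.congr_fun (congrArg ModuleCat.Hom.hom this) x

lemma exists_toChain (n : ℕ) (c : Chain X) : ∃ x, toChain X n x = part n c := by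
  have : LinearMap.range (part (X := X) n) ≤ LinearMap.range (toChain X n) := by
    rintro _ ⟨c, rfl⟩
    refine Finsupp.induction_linear c ?_ ?_ ?_
    · rw [map_zero]
      exact Submodule.zero_mem _
    · intro a b ha hb
      rw [map_add]
      exact Submodule.add_mem _ ha hb
    · intro σ r
      have : Finsupp.single σ r = r • bas σ := by
        rw [bas, Finsupp.smul_single, smul_eq_mul, mul_one]
      rw [this, map_smul, part_bas]
      refine Submodule.smul_mem _ _ ?_
      split_ifs with h
      · subst h
        obtain ⟨s, hs⟩ := exists_toSing σ
        exact ⟨ModuleCat.freeMk s, by rw [toChain_freeMk, hs]⟩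
      · exact Submodule.zero_mem _
  exact this ⟨c, rfl⟩

/-- A linear map on chains that identifies the homology in degree `n` with its target. -/
structure IsHomologyMap (n : ℕ) {W : Type} [AddCommGroup W] [Module ℚ W]
    (f : Chain X →ₗ[ℚ] W) : Prop where
  map_bd : ∀ c, f (bd c) = 0
  exact : ∀ c, part n c = c → bd c = 0 → f c = 0 → ∃ e, bd e = c
  surj : ∀ w, ∃ c, part n c = c ∧ bd c = 0 ∧ f c = w

variable (X) in
theorem exists_isHomologyMap (n : ℕ) : ∃ f : Chain X →ₗ[ℚ] (singularChainComplexQ X).homology n,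
    IsHomologyMap n f ∧ ∀ c, f (part n c) = f c := by
  obtain ⟨π, h1, h2, h3⟩ := exists_homology_class_complex (singularChainComplexQ X) n
  obtain ⟨ρ, hρ⟩ := (toChain X n).exists_leftInverse_of_injective
    (LinearMap.ker_eq_bot.2 (toChain_injective n))
  have hρ : ∀ x, ρ (toChain X n x) = x := LinearMap.congr_fun hρ
  refine ⟨π.comp (ρ.comp (part n)), ⟨fun c => ?_, fun c hc hb hf => ?_, fun w => ?_⟩, fun c => ?_⟩
  · obtain ⟨y, hy⟩ := exists_toChain (n + 1) c
    rw [LinearMap.comp_apply, LinearMap.comp_apply, part_bd, ← hy, ← toChain_d, hρ]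
    exact h1 y
  · obtain ⟨x, hx⟩ := exists_toChain n c
    rw [LinearMap.comp_apply, LinearMap.comp_apply, ← hx, hρ] at hf
    have hd : ∀ m, ((singularChainComplexQ X).d n m).hom x = 0 := by
      intro m
      by_cases hm : m + 1 = n
      · subst hm
        refine toChain_injective m ?_
        rw [toChain_d, hx, hc, hb, map_zero]
      · rw [(singularChainComplexQ X).shape n m hm]
        rfl
    obtain ⟨y, hy⟩ := h2 x hd hf
    refine ⟨toChain X (n + 1) y, ?_⟩
    rw [← toChain_d, hy, hx, hc]
  · obtain ⟨x, hx, rfl⟩ := h3 w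
    refine ⟨toChain X n x, part_toChain n x, ?_, ?_⟩
    · cases n with
      | zero => rw [← part_toChain, bd_part_zero]
      | succ m => rw [← toChain_d, hx m, map_zero]
    · rw [LinearMap.comp_apply, LinearMap.comp_apply, part_toChain, hρ]
  · rw [LinearMap.comp_apply, LinearMap.comp_apply, part_part]
    rfl

lemma IsHomologyMap.finrank_eq {n : ℕ} {W W' : Type} [AddCommGroup W] [Module ℚ W]
    [AddCommGroup W'] [Module ℚ W'] {f : Chain X →ₗ[ℚ] W} {f' : Chain X →ₗ[ℚ] W'}
    (h : IsHomologyMap n f) (h' : IsHomologyMap n f') :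
    Module.finrank ℚ W = Module.finrank ℚ W' := by
  let C : Submodule ℚ (Chain X) := LinearMap.ker bd ⊓ LinearMap.ker (part n - LinearMap.id)
  have hC : ∀ c, c ∈ C ↔ bd c = 0 ∧ part n c = c := fun c => by
    rw [Submodule.mem_inf, LinearMap.mem_ker, LinearMap.mem_ker, LinearMap.sub_apply, sub_eq_zero]
    rfl
  have hk : LinearMap.ker (f.comp C.subtype) = LinearMap.ker (f'.comp C.subtype) := by
    ext ⟨c, hc⟩
    rw [hC] at hc
    change f c = 0 ↔ f' c = 0
    constructor
    · intro h0
      obtain ⟨e, rfl⟩ := h.exact c hc.2 hc.1 h0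
      exact h'.map_bd e
    · intro h0
      obtain ⟨e, rfl⟩ := h'.exact c hc.2 hc.1 h0
      exact h.map_bd e
  have hs : Function.Surjective (f.comp C.subtype) := fun w => by
    obtain ⟨c, h1, h2, h3⟩ := h.surj w
    exact ⟨⟨c, (hC c).2 ⟨h2, h1⟩⟩, h3⟩
  have hs' : Function.Surjective (f'.comp C.subtype) := fun w => by
    obtain ⟨c, h1, h2, h3⟩ := h'.surj w
    exact ⟨⟨c, (hC c).2 ⟨h2, h1⟩⟩, h3⟩
  exact (((f.comp C.subtype).quotKerEquivOfSurjective hs).symm.trans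
    ((Submodule.quotEquivOfEq _ _ hk).trans
      ((f'.comp C.subtype).quotKerEquivOfSurjective hs'))).finrank_eq

lemma IsHomologyMap.bettiQ_eq {n : ℕ} {W : Type} [AddCommGroup W] [Module ℚ W]
    {f : Chain X →ₗ[ℚ] W} (h : IsHomologyMap n f) : bettiQ X n = Module.finrank ℚ W := by
  obtain ⟨f', h', -⟩ := exists_isHomologyMap X n
  rw [h.finrank_eq h']
  exact Subspace.dual_finrank_eq

end Comparison

end SingularQ

namespace SingularQ

open Finset

variable {X : Type} [TopologicalSpace X]

lemma part_part_of_ne {m n : ℕ} (h : m ≠ n) (c : Chain X) : part m (part n c) = 0 := by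
  have : (part m).comp (part n) = (0 : Chain X →ₗ[ℚ] Chain X) := hom_ext fun σ => by
    rw [LinearMap.comp_apply, LinearMap.zero_apply, part_bas]
    split_ifs with hn
    · exact part_bas_of_ne σ (by omega)
    · exact map_zero _
  exact LinearMap.congr_fun this c

lemma exists_sum_part (c : Chain X) : ∃ D, ∀ D' ≥ D, ∑ n ∈ range D', part n c = c := by
  refine Finsupp.induction_linear c ⟨0, fun D' _ => ?_⟩ ?_ ?_
  · exact Finset.sum_eq_zero fun n _ => map_zero _
  · rintro a b ⟨D₁, h₁⟩ ⟨D₂, h₂⟩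
    refine ⟨max D₁ D₂, fun D' hD => ?_⟩
    simp only [map_add, Finset.sum_add_distrib]
    rw [h₁ D' (le_trans (le_max_left _ _) hD), h₂ D' (le_trans (le_max_right _ _) hD)]
  · intro σ r
    have : Finsupp.single σ r = r • bas σ := by
      rw [bas, Finsupp.smul_single, smul_eq_mul, mul_one]
    refine ⟨σ.dim + 1, fun D' hD => ?_⟩
    rw [this]
    simp only [map_smul]
    rw [← Finset.smul_sum, Finset.sum_eq_single σ.dim, part_bas_self σ rfl]
    · exact fun n _ hn => part_bas_of_ne σ hn.symm
    · intro h
      exact absurd (Finset.mem_range.2 hD) h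

lemma exists_bd_of_part {c : Chain X} (h : ∀ n, ∃ e, bd e = part n c) : ∃ e, bd e = c := by
  choose e he using h
  obtain ⟨D, hD⟩ := exists_sum_part c
  refine ⟨∑ n ∈ range D, e n, ?_⟩
  rw [map_sum, ← hD D le_rfl]
  simp only [he, hD D le_rfl]

lemma IsCohomBasis.reindex {ι κ : Type} {deg : ι → ℕ} {a : ι → Cochain X}
    (h : IsCohomBasis deg a) (e : κ ≃ ι) : IsCohomBasis (deg ∘ e) (a ∘ e) where
  homog i := h.homog _
  cocycle i := h.cocycle _
  exact c hc hi := h.exact c hc fun i => by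
    rw [← e.apply_symm_apply i]
    exact hi _
  surj v := by
    obtain ⟨c, hc, hi⟩ := h.surj (v ∘ e.symm)
    exact ⟨c, hc, fun i => (hi (e i)).trans (congrArg v (e.symm_apply_apply i))⟩

theorem exists_isCohomBasis (h : FiniteTotalCohomologyQ X) :
    ∃ (N : ℕ) (deg : Fin N → ℕ) (a : Fin N → Cochain X), IsCohomBasis deg a ∧
      ∀ i, bettiQ X i = #{j | deg j = i} := by
  obtain ⟨hfin, N, hN⟩ := h
  choose f hf hpart using exists_isHomologyMap X
  have hfd : ∀ n, FiniteDimensional ℚ ((singularChainComplexQ X).homology n) := fun n =>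
    (Module.finite_dual_iff ℚ).1 (hfin n)
  have hbetti : ∀ n, bettiQ X n = Module.finrank ℚ ((singularChainComplexQ X).homology n) :=
    fun n => (hf n).bettiQ_eq
  have hzero : ∀ n, N ≤ n → Module.finrank ℚ ((singularChainComplexQ X).homology n) = 0 := by
    intro n hn
    have := hN n hn
    rw [← hbetti]
    exact Module.finrank_zero_of_subsingleton
  let ι : Type := Σ n : Fin N, Fin (Module.finrank ℚ ((singularChainComplexQ X).homology n))
  let B := fun n => Module.finBasis ℚ ((singularChainComplexQ X).homology n)
  let deg : ι → ℕ := fun q => q.1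
  let a : ι → Cochain X := fun q => ((B q.1).coord q.2).comp (f q.1)
  have hba : IsCohomBasis deg a :=
    { homog := fun q c => congrArg ((B q.1).coord q.2) (hpart q.1 c)
      cocycle := fun q c => (congrArg ((B q.1).coord q.2) ((hf q.1).map_bd c)).trans (map_zero _)
      exact := fun c hc hq => exists_bd_of_part fun n => by
        refine (hf n).exact _ (part_part n c) (bd_part_eq_zero hc n) ?_
        rw [hpart]
        by_cases hn : n < N
        · exact (B n).ext_elem fun i => (hq ⟨⟨n, hn⟩, i⟩).trans (by simp)
        · have := Module.finrank_zero_iff.1 (hzero n (not_lt.1 hn))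
          exact Subsingleton.elim _ _
      surj := fun v => by
        choose c hc hb hw using fun n : Fin N => (hf n).surj ((B n).equivFun.symm fun i => v ⟨n, i⟩)
        refine ⟨∑ n, c n, by simp [hb], fun q => ?_⟩
        have h0 : ∀ n, n ≠ q.1 → f q.1 (c n) = 0 := fun n hn => by
          rw [← hc, ← hpart, part_part_of_ne, map_zero]
          exact fun h => hn (Fin.ext h.symm)
        have : f q.1 (∑ n, c n) = (B q.1).equivFun.symm fun i => v ⟨q.1, i⟩ := by
          rw [map_sum, Finset.sum_eq_single q.1 (fun n _ hn => h0 n hn) (by simp), hw]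
        refine (congrArg ((B q.1).coord q.2) this).trans ?_
        rw [Module.Basis.coord_apply, ← Module.Basis.equivFun_apply, LinearEquiv.apply_symm_apply] }
  let e := (Fintype.equivFin ι).symm
  refine ⟨_, _, _, hba.reindex e, fun i => ?_⟩
  rw [hbetti]
  have h1 : #{j | (deg ∘ e) j = i} = Fintype.card {q : ι // deg q = i} := by
    rw [← Fintype.card_subtype]
    exact Fintype.card_congr (e.subtypeEquiv fun _ => Iff.rfl)
  rw [h1]
  by_cases hi : i < N
  · rw [← Fintype.card_fin (Module.finrank ℚ ((singularChainComplexQ X).homology i))]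
    refine Fintype.card_congr
      { toFun := fun j => ⟨⟨⟨i, hi⟩, j⟩, rfl⟩
        invFun := fun q => Fin.cast
          (congrArg (fun n => Module.finrank ℚ ((singularChainComplexQ X).homology n)) q.2) q.1.2
        left_inv := fun j => rfl
        right_inv := ?_ }
    rintro ⟨⟨⟨n, hn⟩, j⟩, hq⟩
    change n = i at hq
    subst hq
    rfl
  · rw [hzero i (not_lt.1 hi), eq_comm, Fintype.card_eq_zero_iff]
    exact ⟨fun q => hi (q.2 ▸ q.1.1.2)⟩

end SingularQ

namespace SingularQ

open Finset

lemma Cohom.pull {X Y : Type} [TopologicalSpace X] [TopologicalSpace Y] {a b : Cochain Y}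
    (h : Cohom a b) (g : C(X, Y)) : Cohom (pull g a) (pull g b) := by
  obtain ⟨u, hu⟩ := h
  refine ⟨u.comp (push g), fun c => ?_⟩
  rw [LinearMap.comp_apply, LinearMap.comp_apply, LinearMap.comp_apply, hu, push_bd]

lemma isCocycle_aug {X : Type} [TopologicalSpace X] : IsCocycle (aug : Cochain X) := aug_bd

lemma isCohomBasis_aug {X : Type} [TopologicalSpace X] [Unique X] {ι : Type} [Unique ι] :
    IsCohomBasis (X := X) (fun _ : ι => 0) fun _ => aug where
  homog _ := homog_aug
  cocycle _ := isCocycle_aug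
  exact c hc hi := ⟨_, exists_bd_of_contraction
    ⟨⟨Prod.fst, continuous_fst⟩, default, fun _ => rfl, fun _ => Unique.eq_default _⟩ hc
    (hi default)⟩
  surj v := by
    refine ⟨v default • bas (pointS default), ?_, fun i => ?_⟩
    · rw [map_smul, bd_bas, bdS_of_dim_zero rfl, smul_zero]
    · rw [map_smul, aug_bas, show (if (pointS (default : X)).dim = 0 then (1 : ℚ) else 0) = 1 from
        if_pos rfl, smul_eq_mul, mul_one, Unique.eq_default i]

section Cross

variable {M : Type} [TopologicalSpace M] {ι : Type} {deg : ι → ℕ} {a : ι → Cochain M} {k : ℕ}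

/-- The first coordinate of a tuple. -/
def headMap (M : Type) [TopologicalSpace M] (k : ℕ) : C(Fin (k + 1) → M, M) :=
  ⟨fun x => x 0, by fun_prop⟩

/-- The tuple of the coordinates other than the first. -/
def tailMap (M : Type) [TopologicalSpace M] (k : ℕ) : C(Fin (k + 1) → M, Fin k → M) :=
  ⟨fun x j => x j.succ, by fun_prop⟩

/-- A tuple is its first coordinate and the others. -/
def headTail (M : Type) [TopologicalSpace M] (k : ℕ) : (Fin (k + 1) → M) ≃ₜ M × (Fin k → M) where
  toFun x := (x 0, fun j => x j.succ)
  invFun q := Fin.cons q.1 q.2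
  left_inv x := Fin.cons_self_tail x
  right_inv q := rfl
  continuous_toFun := by fun_prop
  continuous_invFun := continuous_pi fun j => by
    refine Fin.cases ?_ (fun i => ?_) j
    · exact continuous_fst
    · exact (continuous_apply i).comp continuous_snd

/-- The external product of a tuple of cochains. -/
noncomputable def cross (a : ι → Cochain M) : (k : ℕ) → (Fin k → ι) → Cochain (Fin k → M)
  | 0, _ => aug
  | k + 1, I =>
    cup (pull (headMap M k) (a (I 0))) (pull (tailMap M k) (cross a k fun j => I j.succ))

lemma cross_succ (I : Fin (k + 1) → ι) : cross a (k + 1) I =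
    cup (pull (headMap M k) (a (I 0))) (pull (tailMap M k) (cross a k fun j => I j.succ)) := rfl

theorem isCohomBasis_cross [Finite ι] (ha : IsCohomBasis deg a) {d : ℕ}
    (φ : M → OpenPartialHomeomorph M (Fin d → ℝ)) (hφ : ∀ x, x ∈ (φ x).source) (k : ℕ) :
    IsCohomBasis (fun I : Fin k → ι => ∑ j, deg (I j)) (cross a k) := by
  induction k with
  | zero =>
    convert isCohomBasis_aug (X := Fin 0 → M) (ι := Fin 0 → ι)
    · simp
    · rfl
  | succ k ih =>
    have h := ((ha.prod ih φ hφ).of_homeomorph (headTail M k)).reindex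
      ((Fin.consEquiv fun _ : Fin (k + 1) => ι).symm)
    convert h using 1
    · funext I
      exact Fin.sum_univ_succ _
    · funext I
      change _ = pull _ (cup _ _)
      rw [pull_cup, ← pull_comp, ← pull_comp]
      rfl

lemma IsCohomBasis.isCocycle_cross (ha : IsCohomBasis deg a) (I : Fin k → ι) :
    IsCocycle (cross a k I) := by
  induction k with
  | zero => exact isCocycle_aug
  | succ k ih => exact ((ha.cocycle _).pull _).cup ((ih _).pull _)

/-- The transposition of two adjacent indices. -/
abbrev adjSwap (j : Fin k) : Equiv.Perm (Fin (k + 1)) := Equiv.swap j.castSucc j.succ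

lemma adjSwap_succ_zero (j : Fin k) : adjSwap j.succ 0 = 0 :=
  Equiv.swap_apply_of_ne_of_ne (by simp [Fin.ext_iff]) (by simp [Fin.ext_iff])

lemma adjSwap_succ_succ (j : Fin k) (i : Fin (k + 1)) :
    adjSwap j.succ i.succ = (adjSwap j i).succ :=
  (Fin.succ_injective (k + 1)).swap_apply j.castSucc j.succ i

lemma adjSwap_zero_zero : adjSwap (0 : Fin (k + 1)) 0 = 1 := Equiv.swap_apply_left _ _

lemma adjSwap_zero_one : adjSwap (0 : Fin (k + 1)) 1 = 0 := Equiv.swap_apply_right _ _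

lemma adjSwap_zero_succ_succ (i : Fin k) : adjSwap (0 : Fin (k + 1)) i.succ.succ = i.succ.succ :=
  Equiv.swap_apply_of_ne_of_ne (by simp [Fin.ext_iff]) (by simp [Fin.ext_iff])

theorem IsCohomBasis.cohom_cross (ha : IsCohomBasis deg a) (j : Fin k) (I : Fin (k + 1) → ι) :
    Cohom (pull (permMap M (adjSwap j)) (cross a (k + 1) I))
      ((-1 : ℚ) ^ (deg (I j.castSucc) * deg (I j.succ)) • cross a (k + 1) (I ∘ adjSwap j)) := by
  induction k with
  | zero => exact j.elim0
  | succ k ih =>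
    rw [cross_succ (k := k + 1) I, cross_succ (k := k + 1) (I ∘ adjSwap j), pull_cup, ← pull_comp,
      ← pull_comp]
    obtain ⟨i, rfl⟩ | rfl := (Fin.eq_zero_or_eq_succ j).symm
    · have h1 : (headMap M (k + 1)).comp (permMap M (adjSwap i.succ)) = headMap M (k + 1) := by
        ext x
        exact congrArg x (adjSwap_succ_zero i)
      have h2 : (tailMap M (k + 1)).comp (permMap M (adjSwap i.succ)) =
          (permMap M (adjSwap i)).comp (tailMap M (k + 1)) := by
        ext x l
        exact congrArg x (adjSwap_succ_succ i l)
      rw [h1, h2, pull_comp]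
      have h3 : (fun l => (I ∘ adjSwap i.succ) l.succ) = (fun l => I l.succ) ∘ adjSwap i := by
        funext l
        exact congrArg I (adjSwap_succ_succ i l)
      have h4 : (I ∘ adjSwap i.succ) 0 = I 0 := congrArg I (adjSwap_succ_zero i)
      rw [h3, h4, ← cup_smul_right]
      exact ((ih i fun l => I l.succ).pull _).cup_left ((ha.cocycle _).pull _)
    · rw [cross_succ fun l => I l.succ, cross_succ fun l => (I ∘ adjSwap 0) l.succ, pull_cup,
        pull_cup, ← pull_comp, ← pull_comp, ← pull_comp, ← pull_comp, ← cup_assoc, ← cup_assoc]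
      let p₀ := headMap M (k + 1)
      let p₁ := (headMap M k).comp (tailMap M (k + 1))
      let t := (tailMap M k).comp (tailMap M (k + 1))
      have h1 : (headMap M (k + 1)).comp (permMap M (adjSwap 0)) = p₁ := by
        ext x
        exact congrArg x adjSwap_zero_zero
      have h2 : (headMap M k).comp ((tailMap M (k + 1)).comp (permMap M (adjSwap 0))) = p₀ := by
        ext x
        exact congrArg x adjSwap_zero_one
      have h3 : (tailMap M k).comp ((tailMap M (k + 1)).comp (permMap M (adjSwap 0))) = t := by
        ext x l
        exact congrArg x (adjSwap_zero_succ_succ l)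
      have h4 : (fun l : Fin k => (I ∘ adjSwap 0) l.succ.succ) = fun l => I l.succ.succ := by
        funext l
        exact congrArg I (adjSwap_zero_succ_succ l)
      have h5 : (I ∘ adjSwap 0) 0 = I 1 := congrArg I adjSwap_zero_zero
      have h6 : (I ∘ adjSwap 0) (Fin.succ 0) = I 0 := congrArg I adjSwap_zero_one
      rw [h1, h2, h3, h4, h5, h6, ← cup_smul_left]
      exact (cohom_cup_comm ((ha.homog (I 0)).pull p₁) ((ha.homog (I 1)).pull p₀)
        ((ha.cocycle _).pull _) ((ha.cocycle _).pull _)).cup_right ((ha.isCocycle_cross _).pull t)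

lemma IsCohomBasis.cross_push (ha : IsCohomBasis deg a) (j : Fin k) (I : Fin (k + 1) → ι)
    {z : Chain (Fin (k + 1) → M)} (hz : bd z = 0) :
    cross a (k + 1) I (push (permMap M (adjSwap j)) z) =
      (-1) ^ (deg (I j.castSucc) * deg (I j.succ)) * cross a (k + 1) (I ∘ adjSwap j) z :=
  (ha.cohom_cross j I).apply_eq hz

end Cross

end SingularQ

namespace SingularQ

open Finset

section Symmetry

variable {ι : Type} {deg : ι → ℕ} {k : ℕ}

/-- Functions of tuples that transform under adjacent transpositions by the graded sign rule. -/
def GradedSymm (deg : ι → ℕ) (v : (Fin (k + 1) → ι) → ℚ) : Prop :=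
  ∀ (j : Fin k) I, v I = (-1) ^ (deg (I j.castSucc) * deg (I j.succ)) * v (I ∘ adjSwap j)

lemma perm_induction {P : Equiv.Perm (Fin (k + 1)) → Prop} (h1 : P 1)
    (hs : ∀ j : Fin k, P (adjSwap j)) (hmul : ∀ g h, P g → P h → P (g * h)) (g) : P g := by
  have hg : g ∈ Submonoid.closure (Set.range fun i : Fin k => Equiv.swap i.castSucc i.succ) :=
    Equiv.Perm.mclosure_swap_castSucc_succ k ▸ Submonoid.mem_top g
  induction hg using Submonoid.closure_induction with
  | mem g hg => obtain ⟨j, rfl⟩ := hg; exact hs j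
  | one => exact h1
  | mul g h _ _ hg hh => exact hmul g h hg hh

lemma GradedSymm.comp_eq_zero {v : (Fin (k + 1) → ι) → ℚ} (hv : GradedSymm deg v)
    (g : Equiv.Perm (Fin (k + 1))) : ∀ I, v (I ∘ g) = 0 ↔ v I = 0 := by
  refine perm_induction (P := fun g => ∀ I, v (I ∘ g) = 0 ↔ v I = 0) (fun I => Iff.rfl)
    (fun j I => ?_) (fun g h hg hh I => (hh (I ∘ g)).trans (hg I)) g
  rw [hv j I, mul_eq_zero_iff_left (pow_ne_zero _ (by norm_num))]

lemma GradedSymm.eq_zero {v : (Fin (k + 1) → ι) → ℚ} (hv : GradedSymm deg v)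
    {I : Fin (k + 1) → ι} {p q : Fin (k + 1)} (hpq : p ≠ q) (hI : I p = I q)
    (hodd : Odd (deg (I p))) : v I = 0 := by
  cases k with
  | zero => exact absurd (Fin.ext (by omega)) hpq
  | succ k =>
    let y := Equiv.swap 0 p q
    let g : Equiv.Perm (Fin (k + 2)) := Equiv.swap 0 p * Equiv.swap 1 y
    have hy : y ≠ 0 := fun h => hpq (by
      have := congrArg (Equiv.swap 0 p) h
      rwa [Equiv.swap_apply_left, Equiv.swap_apply_self, eq_comm] at this)
    have g0 : g 0 = p := by
      change Equiv.swap 0 p (Equiv.swap 1 y 0) = p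
      rw [Equiv.swap_apply_of_ne_of_ne (by simp) hy.symm, Equiv.swap_apply_left]
    have g1 : g 1 = q := by
      change Equiv.swap 0 p (Equiv.swap 1 y 1) = q
      rw [Equiv.swap_apply_left, Equiv.swap_apply_self]
    rw [← hv.comp_eq_zero g I]
    have h0 : (I ∘ g) (Fin.castSucc 0) = I p := congrArg I g0
    have h1 : (I ∘ g) (Fin.succ 0) = I p := (congrArg I g1).trans hI.symm
    have h2 : (I ∘ g) ∘ adjSwap 0 = I ∘ g := by
      funext i
      by_cases hi0 : i = Fin.castSucc 0
      · rw [hi0]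
        exact (congrArg (I ∘ g) (Equiv.swap_apply_left _ _)).trans (h1.trans h0.symm)
      by_cases hi1 : i = Fin.succ 0
      · rw [hi1]
        exact (congrArg (I ∘ g) (Equiv.swap_apply_right _ _)).trans (h0.trans h1.symm)
      · exact congrArg (I ∘ g) (Equiv.swap_apply_of_ne_of_ne hi0 hi1)
    have h := hv 0 (I ∘ g)
    rw [h0, h1, h2, (hodd.mul hodd).neg_one_pow] at h
    linarith

/-- The number of entries of a tuple with a given value. -/
noncomputable def cnt (I : Fin k → ι) (i : ι) : ℕ := Nat.card {j // I j = i}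

lemma cnt_comp (I : Fin k → ι) (g : Equiv.Perm (Fin k)) : cnt (I ∘ g) = cnt I := by
  funext i
  exact Nat.card_congr (g.subtypeEquiv fun j => Iff.rfl)

lemma exists_comp_eq {I J : Fin k → ι} (h : cnt I = cnt J) :
    ∃ g : Equiv.Perm (Fin k), J ∘ g = I := by
  have e : ∀ i, Nonempty ({j // I j = i} ≃ {j // J j = i}) := fun i =>
    Finite.card_eq.1 (congrFun h i)
  exact ⟨Equiv.ofFiberEquiv fun i => (e i).some, funext fun j => Equiv.ofFiberEquiv_map _ j⟩

lemma sum_cnt_mul [Fintype ι] (I : Fin k → ι) (w : ι → ℕ) :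
    ∑ i, cnt I i * w i = ∑ j, w (I j) := by
  classical
  rw [← Finset.sum_fiberwise_of_maps_to (g := I) (t := univ) fun _ _ => mem_univ _]
  refine sum_congr rfl fun i _ => ?_
  rw [sum_congr rfl fun j hj => congrArg w (mem_filter.1 hj).2, sum_const, smul_eq_mul, cnt,
    Nat.card_eq_fintype_card, Fintype.card_subtype]

lemma exists_cnt_eq [Fintype ι] {f : ι → ℕ} (hf : ∑ i, f i = k) : ∃ I : Fin k → ι, cnt I = f := by
  have e : Fin k ≃ Σ i, Fin (f i) := Fintype.equivOfCardEq (by simp [hf])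
  refine ⟨fun j => (e j).1, funext fun i => ?_⟩
  have e' : {j // (e j).1 = i} ≃ {x : Σ i, Fin (f i) // x.1 = i} :=
    e.subtypeEquiv fun j => Iff.rfl
  rw [cnt, Nat.card_congr (e'.trans (Equiv.sigmaSubtype i)), Nat.card_fin]

lemma two_le_cnt {I : Fin k → ι} {p q : Fin k} (hpq : p ≠ q) (hI : I p = I q) :
    2 ≤ cnt I (I p) := by
  have : Nontrivial {j // I j = I p} :=
    ⟨⟨p, rfl⟩, ⟨q, hI.symm⟩, fun h => hpq (congrArg Subtype.val h)⟩
  exact Finite.one_lt_card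

lemma exists_of_two_le_cnt {I : Fin k → ι} {i : ι} (h : 2 ≤ cnt I i) :
    ∃ p q, p ≠ q ∧ I p = i ∧ I q = i := by
  obtain ⟨⟨p, q, hpq⟩⟩ := Finite.one_lt_card_iff_nontrivial.1 h
  exact ⟨p.1, q.1, fun h => hpq (Subtype.ext h), p.2, q.2⟩

/-- The exponent vectors of the monomials of word length `k` and degree `n` in the free graded
commutative algebra on generators of degrees `deg`. -/
abbrev Good (deg : ι → ℕ) [Fintype ι] (k n : ℕ) : Type :=
  {f : ι → ℕ // ∑ i, f i = k ∧ (∀ i, Odd (deg i) → f i ≤ 1) ∧ ∑ i, f i * deg i = n}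

instance [Fintype ι] {n : ℕ} : Finite (Good deg k n) :=
  Set.Finite.to_subtype <| (Set.Finite.pi fun _ : ι => Set.finite_Iic k).subset fun _ hf i _ =>
    (single_le_sum (fun _ _ => Nat.zero_le _) (mem_univ i)).trans hf.1.le

variable [LinearOrder ι]

/-- The sign of exchanging two generators that are out of order. -/
def invSign (deg : ι → ℕ) (x y : ι) : ℚ := if Odd (deg x * deg y) ∧ y < x then -1 else 1

/-- The sign of sorting a tuple of generators. -/
def sortSign (deg : ι → ℕ) : (k : ℕ) → (Fin k → ι) → ℚ
  | 0, _ => 1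
  | k + 1, I => (∏ j : Fin k, invSign deg (I 0) (I j.succ)) * sortSign deg k fun j => I j.succ

lemma sortSign_succ (I : Fin (k + 1) → ι) : sortSign deg (k + 1) I =
    (∏ j : Fin k, invSign deg (I 0) (I j.succ)) * sortSign deg k fun j => I j.succ := rfl

lemma invSign_ne_zero (x y : ι) : invSign deg x y ≠ 0 := by
  unfold invSign
  split_ifs <;> norm_num

lemma sortSign_ne_zero (I : Fin k → ι) : sortSign deg k I ≠ 0 := by
  induction k with
  | zero => exact one_ne_zero
  | succ k ih => exact mul_ne_zero (prod_ne_zero_iff.2 fun _ _ => invSign_ne_zero _ _) (ih _)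

lemma invSign_comm {x y : ι} (h : x ≠ y ∨ Even (deg x * deg y)) :
    invSign deg x y = (-1) ^ (deg x * deg y) * invSign deg y x := by
  unfold invSign
  rw [mul_comm (deg y)]
  obtain he | ho := Nat.even_or_odd (deg x * deg y)
  · simp [he, Nat.not_odd_iff_even.2 he]
  · obtain hlt | hlt := (h.resolve_right (Nat.not_even_iff_odd.2 ho)).lt_or_gt
    · simp [ho, hlt, hlt.not_gt]
    · simp [ho, hlt, hlt.not_gt]

theorem sortSign_adjSwap (j : Fin k) (I : Fin (k + 1) → ι)
    (h : I j.castSucc ≠ I j.succ ∨ Even (deg (I j.castSucc) * deg (I j.succ))) :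
    sortSign deg (k + 1) I = (-1) ^ (deg (I j.castSucc) * deg (I j.succ)) *
      sortSign deg (k + 1) (I ∘ adjSwap j) := by
  induction k with
  | zero => exact j.elim0
  | succ k ih =>
    rw [sortSign_succ (k := k + 1) I, sortSign_succ (k := k + 1) (I ∘ adjSwap j)]
    obtain ⟨i, rfl⟩ | rfl := (Fin.eq_zero_or_eq_succ j).symm
    · have h3 : (fun l => (I ∘ adjSwap i.succ) l.succ) = (fun l => I l.succ) ∘ adjSwap i := by
        funext l
        exact congrArg I (adjSwap_succ_succ i l)
      have h4 : (I ∘ adjSwap i.succ) 0 = I 0 := congrArg I (adjSwap_succ_zero i)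
      have h5 : ∏ l, invSign deg (I 0) ((I ∘ adjSwap i.succ) (Fin.succ l)) =
          ∏ l : Fin (k + 1), invSign deg (I 0) (I l.succ) := by
        rw [← Equiv.prod_comp (adjSwap i) fun l => invSign deg (I 0) (I l.succ)]
        exact prod_congr rfl fun (l : Fin (k + 1)) _ => congrArg (fun t => invSign deg (I 0) (I t))
          (adjSwap_succ_succ i l)
      rw [h3, h4, h5, ih i (fun l => I l.succ) h]
      exact mul_left_comm _ _ _
    · have h4 : (fun l : Fin k => (I ∘ adjSwap 0) l.succ.succ) = fun l => I l.succ.succ := by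
        funext l
        exact congrArg I (adjSwap_zero_succ_succ l)
      have h5 : (I ∘ adjSwap 0) 0 = I 1 := congrArg I adjSwap_zero_zero
      have h6 : (I ∘ adjSwap 0) (Fin.succ 0) = I 0 := congrArg I adjSwap_zero_one
      have h7 : ∀ x, ∏ l : Fin k, invSign deg x ((I ∘ adjSwap 0) l.succ.succ) =
          ∏ l : Fin k, invSign deg x (I l.succ.succ) := fun x =>
        prod_congr rfl fun l _ => congrArg (invSign deg x) (congrFun h4 l)
      rw [sortSign_succ fun l => I l.succ, sortSign_succ fun l => (I ∘ adjSwap 0) l.succ,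
        Fin.prod_univ_succ, Fin.prod_univ_succ, h4, h5, h6, h7, h7]
      have h8 := invSign_comm h
      change invSign deg (I 0) (I 1) * _ * _ = _
      change invSign deg (I 0) (I 1) =
        (-1) ^ (deg (I 0) * deg (I 1)) * invSign deg (I 1) (I 0) at h8
      rw [h8]
      change _ = (-1) ^ (deg (I 0) * deg (I 1)) * _
      change _ * _ * ((∏ l : Fin k, invSign deg (I 1) (I l.succ.succ)) * _) = _
      ring

end Symmetry

section Betti

variable {M : Type} [TopologicalSpace M] {ι : Type}
  {deg : ι → ℕ} {a : ι → Cochain M} {d : ℕ} {k n : ℕ}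

lemma IsCohomBasis.gradedSymm_cross (ha : IsCohomBasis deg a) {z : Chain (Fin (k + 1) → M)}
    (hz : bd z = 0) (hf : z ∈ fixC M (⊤ : Subgroup (Equiv.Perm (Fin (k + 1))))) :
    GradedSymm deg fun I => cross a (k + 1) I z := fun j I => by
  have h := ha.cross_push j I hz
  rwa [mem_fixC.1 hf _ (Subgroup.mem_top _)] at h

lemma IsCohomBasis.cross_push_of_gradedSymm (ha : IsCohomBasis deg a)
    {v : (Fin (k + 1) → ι) → ℚ} (hv : GradedSymm deg v) (g : Equiv.Perm (Fin (k + 1))) :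
    ∀ z, bd z = 0 → (∀ I, cross a (k + 1) I z = v I) →
      ∀ I, cross a (k + 1) I (push (permMap M g) z) = v I := by
  refine perm_induction (P := fun g => ∀ z, bd z = 0 → (∀ I, cross a (k + 1) I z = v I) →
      ∀ I, cross a (k + 1) I (push (permMap M g) z) = v I) (fun z hz h I => ?_)
      (fun j z hz h I => ?_) (fun g g' hg hg' z hz h I => ?_) g
  · rw [push_permMap_one, h]
  · rw [ha.cross_push j I hz, h, ← hv j I]
  · rw [push_permMap_mul]
    exact hg' _ (by rw [← push_bd, hz, map_zero]) (hg z hz h) I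

lemma exists_gradedSymm [Fintype ι] [LinearOrder ι]
    (rep : Good deg (k + 1) n → Fin (k + 1) → ι) (hrep : ∀ s, cnt (rep s) = s.1)
    (w : Good deg (k + 1) n → ℚ) :
    ∃ v : (Fin (k + 1) → ι) → ℚ, GradedSymm deg v ∧ ∀ s, v (rep s) = w s := by
  let u : (ι → ℕ) → ℚ :=
    Function.extend Subtype.val (fun s => w s / sortSign deg (k + 1) (rep s)) 0
  refine ⟨fun I => sortSign deg (k + 1) I * u (cnt I), fun j I => ?_, fun s => ?_⟩
  · dsimp only
    rw [cnt_comp]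
    by_cases h : I j.castSucc ≠ I j.succ ∨ Even (deg (I j.castSucc) * deg (I j.succ))
    · rw [sortSign_adjSwap j I h, mul_assoc]
    · rw [not_or, not_not, Nat.not_even_iff_odd, Nat.odd_mul] at h
      have h2 := two_le_cnt (Fin.castSucc_lt_succ (i := j)).ne h.1
      have hu : u (cnt I) = 0 := Function.extend_apply' _ _ _ (by
        rintro ⟨s, hs⟩
        have := s.2.2.1 _ h.2.1
        rw [hs] at this
        omega)
      rw [hu, mul_zero, mul_zero, mul_zero]
  · dsimp only
    have hu : u s.1 = w s / sortSign deg (k + 1) (rep s) :=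
      Subtype.val_injective.extend_apply _ _ _
    rw [hrep, hu, mul_div_cancel₀ _ (sortSign_ne_zero _)]

theorem bettiQ_unorderedConfig [T2Space M] [Fintype ι] [LinearOrder ι]
    (ha : IsCohomBasis deg a) (hd : Odd d)
    (φ : M → OpenPartialHomeomorph M (Fin d → ℝ)) (hφ : ∀ x, x ∈ (φ x).source) (k n : ℕ) :
    bettiQ (unorderedConfig M (k + 1)) n = Nat.card (Good deg (k + 1) n) := by
  classical
  have hb := isCohomBasis_cross ha φ hφ (k + 1)
  choose rep hrep using fun s : Good deg (k + 1) n => exists_cnt_eq s.2.1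
  have hdeg : ∀ s, ∑ j, deg (rep s j) = n := fun s => by
    rw [← sum_cnt_mul, hrep, s.2.2.2]
  have := Fintype.ofFinite (Good deg (k + 1) n)
  let F : Chain (unorderedConfig M (k + 1)) →ₗ[ℚ] Good deg (k + 1) n → ℚ :=
    LinearMap.pi fun s => (cross a (k + 1) (rep s)).comp (configT M (k + 1))
  have hF : IsHomologyMap n F := by
    refine ⟨fun c => funext fun s => ?_, fun c hn hc h0 => ?_, fun w => ?_⟩
    · change cross a (k + 1) (rep s) (configT M (k + 1) (bd c)) = 0
      rw [configT_bd]
      exact hb.cocycle _ _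
    · have hz : bd (configT M (k + 1) c) = 0 := by rw [← configT_bd, hc, map_zero]
      have hf : configT M (k + 1) c ∈ fixC M (⊤ : Subgroup (Equiv.Perm (Fin (k + 1)))) := by
        have h : configT M (k + 1) c ∈ LinearMap.range (configT M (k + 1)) := ⟨c, rfl⟩
        rw [range_configT] at h
        exact h.2
      have hv := ha.gradedSymm_cross hz hf
      have h1 : ∀ I, cross a (k + 1) I (configT M (k + 1) c) = 0 := fun I => by
        by_cases hI : ∑ j, deg (I j) = n
        · by_cases ho : ∀ i, Odd (deg i) → cnt I i ≤ 1
          · let s : Good deg (k + 1) n := ⟨cnt I, by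
              simpa using sum_cnt_mul I fun _ => 1, ho, by rw [sum_cnt_mul, hI]⟩
            obtain ⟨g, hg⟩ := exists_comp_eq (hrep s).symm
            rw [← hg]
            exact (hv.comp_eq_zero g (rep s)).2 (congrFun h0 s)
          · push Not at ho
            obtain ⟨i, hi, h2⟩ := ho
            obtain ⟨p, q, hpq, rfl, hq⟩ := exists_of_two_le_cnt h2
            exact hv.eq_zero hpq hq.symm hi
        · rw [← hn, configT_part, ← hb.homog I, part_part_of_ne hI, map_zero]
      obtain ⟨e, he⟩ := hb.exact _ hz h1
      obtain ⟨e', he'⟩ := exists_bd_of_configT hd φ hφ he.symm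
      exact ⟨e', he'.symm⟩
    · obtain ⟨v, hv, hw⟩ := exists_gradedSymm rep hrep w
      obtain ⟨z, hz, hzv⟩ := hb.surj v
      let y := avgC M (⊤ : Subgroup (Equiv.Perm (Fin (k + 1)))) z
      have hy : ∀ I, cross a (k + 1) I y = v I := fun I => by
        change cross a (k + 1) I (avgC M _ z) = v I
        rw [avgC_apply, map_smul, map_sum, sum_congr rfl fun g _ =>
          ha.cross_push_of_gradedSymm hv g.1 z hz hzv I, sum_const, ← Nat.cast_smul_eq_nsmul ℚ,
          smul_smul, card_univ, inv_mul_cancel₀ (Nat.cast_ne_zero.2 Fintype.card_ne_zero), one_smul]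
      have hbd : bd y = 0 := by
        change bd (avgC M _ z) = 0
        rw [← avgC_bd, hz, map_zero]
      obtain ⟨c, e, hc, hbc, hce⟩ := exists_configT_of_cycle hd φ hφ (z := part n y)
        (mem_fixC.2 fun g hg => (part_push _ n y).symm.trans
          (congrArg (part n) (push_avgC _ hg z))) (bd_part_eq_zero hbd n)
        (part_part n y)
      refine ⟨c, hc, hbc, funext fun s => ?_⟩
      change cross a (k + 1) (rep s) (configT M (k + 1) c) = w s
      rw [hce, map_sub, hb.cocycle, sub_zero, ← hw, ← hy, ← hb.homog (rep s) y]
      rw [hdeg]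
  rw [hF.bettiQ_eq, Module.finrank_fintype_fun_eq_card, Nat.card_eq_fintype_card]

end Betti

end SingularQ

namespace SingularQ

open Finset

section Truncation

open Polynomial

variable {X Y : Type} [TopologicalSpace X] [TopologicalSpace Y] {τ τ' q σ : ℕ}

lemma truncPoincareQ_one (h : IsGreatest {i | bettiQ X i ≠ 0} τ) :
    truncPoincareQ X 1 = monomial τ (bettiQ X τ) := by
  have hτ : cohomDimQ X = τ := h.csSup_eq
  rw [truncPoincareQ, sum_range_one, if_pos (Nat.zero_le _), Nat.sub_zero, hτ]

lemma coeff_truncPoincareQ (h : IsGreatest {i | bettiQ X i ≠ 0} τ) (hq : 1 ≤ q) :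
    (truncPoincareQ X q).coeff τ = bettiQ X τ := by
  have hτ : cohomDimQ X = τ := h.csSup_eq
  rw [truncPoincareQ, hτ, finsetSum_coeff, sum_eq_single_of_mem 0 (mem_range.2 hq)]
  · rw [if_pos (Nat.zero_le _), Nat.sub_zero, coeff_monomial_same]
  · intro j _ hj
    split_ifs with hjτ
    · exact coeff_monomial_of_ne _ (by omega)
    · exact coeff_zero _

lemma natDegree_truncPoincareQ (h : IsGreatest {i | bettiQ X i ≠ 0} τ) (hq : 1 ≤ q) :
    (truncPoincareQ X q).natDegree = τ := by
  refine le_antisymm (natDegree_sum_le_of_forall_le _ _ fun j _ => ?_)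
    (le_natDegree_of_ne_zero (by rw [coeff_truncPoincareQ h hq]; exact h.1))
  have hτ : cohomDimQ X = τ := h.csSup_eq
  rw [hτ]
  split_ifs
  · exact (natDegree_monomial_le _).trans (Nat.sub_le _ _)
  · exact Nat.zero_le _

lemma top_of_truncPoincareQ_eq (hX : IsGreatest {i | bettiQ X i ≠ 0} τ)
    (hY : IsGreatest {i | bettiQ Y i ≠ 0} τ') (hq : 1 ≤ q)
    (h : truncPoincareQ Y q = Polynomial.X ^ σ * truncPoincareQ X q) :
    τ' = τ + σ ∧ bettiQ Y τ' = bettiQ X τ := by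
  have h0 : truncPoincareQ X q ≠ 0 := fun h0 => hX.1 (by
    rw [← coeff_truncPoincareQ hX hq, h0, coeff_zero])
  have h1 : τ' = τ + σ := by
    rw [← natDegree_truncPoincareQ hY hq, h, natDegree_X_pow_mul _ h0,
      natDegree_truncPoincareQ hX hq]
  refine ⟨h1, ?_⟩
  rw [← coeff_truncPoincareQ hY hq, h, h1, coeff_X_pow_mul, coeff_truncPoincareQ hX hq]

end Truncation

section Monomials

variable {ι : Type} [Fintype ι] {deg : ι → ℕ} {k n a : ℕ}

/-- The generators of odd degree larger than `2 * a`. -/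
def HighOdd (deg : ι → ℕ) (a : ℕ) (i : ι) : Prop := Odd (deg i) ∧ 2 * a < deg i

open Classical in
/-- The number of generators of odd degree larger than `2 * a`. -/
noncomputable def highCount (deg : ι → ℕ) (a : ℕ) : ℕ := ∑ i, if HighOdd deg a i then 1 else 0

open Classical in
/-- The total degree of the generators of odd degree larger than `2 * a`. -/
noncomputable def highDegree (deg : ι → ℕ) (a : ℕ) : ℕ :=
  ∑ i, if HighOdd deg a i then deg i else 0

section Bound

variable (ha : ∀ i, Even (deg i) → deg i ≤ 2 * a) (f : Good deg k n)

include ha f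

open Classical in
lemma Good.term_le (i : ι) :
    f.1 i * deg i + (if HighOdd deg a i then 1 else 0) * (2 * a) ≤
      (if HighOdd deg a i then deg i else 0) + f.1 i * (2 * a) := by
  have hodd := f.2.2.1 i
  split_ifs with h
  · have := hodd h.1
    interval_cases f.1 i <;> have := h.2 <;> omega
  · have : deg i ≤ 2 * a := by
      by_contra hlt
      exact (Nat.even_or_odd (deg i)).elim (fun he => hlt (ha i he)) fun ho => h ⟨ho, by omega⟩
    simpa using Nat.mul_le_mul_left (f.1 i) this

lemma Good.le : n + highCount deg a * (2 * a) ≤ highDegree deg a + k * (2 * a) := by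
  have h := sum_le_sum fun i (_ : i ∈ univ) => f.term_le ha i
  rwa [sum_add_distrib, sum_add_distrib, f.2.2.2, ← sum_mul, ← sum_mul, f.2.1] at h

lemma Good.eq_of_top (h : n + highCount deg a * (2 * a) = highDegree deg a + k * (2 * a)) (i : ι) :
    (HighOdd deg a i → f.1 i = 1) ∧ (¬HighOdd deg a i → deg i ≠ 2 * a → f.1 i = 0) := by
  have h1 := (sum_eq_sum_iff_of_le fun i (_ : i ∈ univ) => f.term_le ha i).1 (by
    rwa [sum_add_distrib, sum_add_distrib, f.2.2.2, ← sum_mul, ← sum_mul, f.2.1]) i (mem_univ i)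
  refine ⟨fun hi => ?_, fun hi hne => ?_⟩
  · rw [if_pos hi, if_pos hi] at h1
    have := f.2.2.1 i hi.1
    have := hi.2
    interval_cases hfi : f.1 i
    · omega
    · rfl
  · rw [if_neg hi, if_neg hi] at h1
    by_contra h0
    exact hne (Nat.eq_of_mul_eq_mul_left (Nat.pos_of_ne_zero h0) (by omega))

end Bound

open Classical in
/-- The monomial with all high odd generators once and otherwise only the generator `e`. -/
noncomputable def topMonomial (deg : ι → ℕ) (a k : ℕ) (e i : ι) : ℕ :=
  (if HighOdd deg a i then 1 else 0) + if i = e then k - highCount deg a else 0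

lemma topMonomial_good {e : ι} (he : deg e = 2 * a) (hk : highCount deg a ≤ k)
    (hn : n + highCount deg a * (2 * a) = highDegree deg a + k * (2 * a)) :
    ∑ i, topMonomial deg a k e i = k ∧ (∀ i, Odd (deg i) → topMonomial deg a k e i ≤ 1) ∧
      ∑ i, topMonomial deg a k e i * deg i = n := by
  classical
  refine ⟨?_, fun i hi => ?_, ?_⟩
  · simp only [topMonomial, sum_add_distrib, sum_ite_eq', mem_univ, if_true]
    change highCount deg a + _ = k
    omega
  · have : i ≠ e := fun h => by
      rw [h, he] at hi
      exact absurd hi (by simp)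
    rw [topMonomial, if_neg this]
    split_ifs <;> omega
  · simp only [topMonomial, add_mul, sum_add_distrib, ite_mul, zero_mul, one_mul, sum_ite_eq',
      mem_univ, if_true]
    change highDegree deg a + _ = n
    rw [he]
    obtain ⟨l, rfl⟩ := Nat.exists_eq_add_of_le hk
    rw [Nat.add_sub_cancel_left]
    rw [add_mul] at hn
    omega

/-- The degree of the top monomials. -/
noncomputable def topDegree (deg : ι → ℕ) (a k : ℕ) : ℕ :=
  highDegree deg a + (k - highCount deg a) * (2 * a)

lemma topDegree_add (hk : highCount deg a ≤ k) :
    topDegree deg a k + highCount deg a * (2 * a) = highDegree deg a + k * (2 * a) := by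
  obtain ⟨l, rfl⟩ := Nat.exists_eq_add_of_le hk
  rw [topDegree, Nat.add_sub_cancel_left]
  ring

lemma topDegree_succ (hk : highCount deg a ≤ k) :
    topDegree deg a (k + 1) = topDegree deg a k + 2 * a := by
  rw [topDegree, topDegree, Nat.succ_sub hk, Nat.succ_mul, add_assoc]

lemma card_good_pos {e : ι} (he : deg e = 2 * a) (hk : highCount deg a ≤ k) :
    Nat.card (Good deg k (topDegree deg a k)) ≠ 0 :=
  have : Nonempty (Good deg k (topDegree deg a k)) :=
    ⟨⟨_, topMonomial_good he hk (topDegree_add hk)⟩⟩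
  Nat.card_pos.ne'

lemma isGreatest_topDegree {e : ι} (he : deg e = 2 * a)
    (ha : ∀ i, Even (deg i) → deg i ≤ 2 * a) (hk : highCount deg a ≤ k) :
    IsGreatest {n | Nat.card (Good deg k n) ≠ 0} (topDegree deg a k) := by
  refine ⟨card_good_pos he hk, fun n hn => ?_⟩
  have : Nonempty (Good deg k n) := (Nat.card_ne_zero.1 hn).1
  have h1 := Good.le ha this.some
  have h2 := topDegree_add hk
  omega

lemma card_good_eq_one {e : ι} (he : deg e = 2 * a) (hu : ∀ i, deg i = 2 * a → i = e)
    (ha : ∀ i, Even (deg i) → deg i ≤ 2 * a) (hk : highCount deg a ≤ k) :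
    Nat.card (Good deg k (topDegree deg a k)) = 1 := by
  refine le_antisymm (Finite.card_le_one_iff_subsingleton.2 ⟨fun f g => ?_⟩)
    (Nat.one_le_iff_ne_zero.2 (card_good_pos he hk))
  have h : ∀ i, i ≠ e → f.1 i = g.1 i := fun i hi => by
    have hf := f.eq_of_top ha (topDegree_add hk) i
    have hg := g.eq_of_top ha (topDegree_add hk) i
    by_cases h : HighOdd deg a i
    · rw [hf.1 h, hg.1 h]
    · have hne : deg i ≠ 2 * a := fun h => hi (hu i h)
      rw [hf.2 h hne, hg.2 h hne]
  refine Subtype.ext (funext fun i => ?_)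
  classical
  obtain rfl | hi := eq_or_ne i e
  · have hs := f.2.1.trans g.2.1.symm
    rwa [← add_sum_erase _ _ (mem_univ i), ← add_sum_erase _ g.1 (mem_univ i),
      sum_congr rfl fun j hj => h j (ne_of_mem_erase hj), add_left_inj] at hs
  · exact h i hi

lemma card_good_lt {e₁ e₂ : ι} (hne : e₁ ≠ e₂) (h1 : deg e₁ = 2 * a) (h2 : deg e₂ = 2 * a)
    (hk : highCount deg a ≤ k) :
    Nat.card (Good deg k (topDegree deg a k)) <
      Nat.card (Good deg (k + 1) (topDegree deg a (k + 1))) := by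
  classical
  have hev : Even (deg e₁) := h1 ▸ even_two_mul a
  let F : Good deg k (topDegree deg a k) → Good deg (k + 1) (topDegree deg a (k + 1)) := fun f =>
    ⟨fun i => f.1 i + if i = e₁ then 1 else 0, by
      simp [sum_add_distrib, f.2.1], fun i hi => by
      have : i ≠ e₁ := fun h => Nat.not_even_iff_odd.2 hi (h ▸ hev)
      simpa [this] using f.2.2.1 i hi, by
      simp [add_mul, sum_add_distrib, f.2.2.2, h1, topDegree_succ hk]⟩
  have hF : Function.Injective F := fun f g h => Subtype.ext (funext fun i =>
    Nat.add_right_cancel (congrFun (congrArg Subtype.val h) i))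
  let g : Good deg (k + 1) (topDegree deg a (k + 1)) :=
    ⟨_, topMonomial_good h2 (hk.trans (Nat.le_succ k)) (topDegree_add (hk.trans (Nat.le_succ k)))⟩
  have hg : g ∉ Set.range F := by
    rintro ⟨f, hf⟩
    have h := congrFun (congrArg Subtype.val hf) e₁
    have h0 : ¬HighOdd deg a e₁ := fun h => Nat.not_even_iff_odd.2 h.1 hev
    change f.1 e₁ + (if e₁ = e₁ then 1 else 0) = topMonomial deg a (k + 1) e₂ e₁ at h
    rw [if_pos rfl, topMonomial, if_neg h0, if_neg hne] at h
    omega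
  have := Fintype.ofFinite (Good deg k (topDegree deg a k))
  have := Fintype.ofFinite (Good deg (k + 1) (topDegree deg a (k + 1)))
  rw [Nat.card_eq_fintype_card, Nat.card_eq_fintype_card]
  exact Fintype.card_lt_of_injective_of_notMem F hF hg

lemma exists_isGreatest_good {e : ι} (he : deg e = 0) (k : ℕ) :
    ∃ τ, IsGreatest {n | Nat.card (Good deg k n) ≠ 0} τ := by
  classical
  refine ⟨_, Nat.sSup_mem ⟨0, ?_⟩ ⟨∑ i, k * deg i, ?_⟩, fun n hn =>
    le_csSup ⟨∑ i, k * deg i, ?_⟩ hn⟩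
  · have : Nonempty (Good deg k 0) := ⟨⟨fun i => if i = e then k else 0, by simp, fun i hi => by
      have : i ≠ e := fun h => by simp [h, he] at hi
      simp [this], by simp [he]⟩⟩
    exact Nat.card_pos.ne'
  all_goals
    intro n hn
    have : Nonempty (Good deg k n) := (Nat.card_ne_zero.1 hn).1
    obtain ⟨f, hf, -, rfl⟩ := this
    refine sum_le_sum fun i _ => Nat.mul_le_mul_right _ ?_
    exact (single_le_sum (fun _ _ => Nat.zero_le _) (mem_univ i)).trans hf.le

lemma Good.le_sum (h : ∀ i, Even (deg i) → deg i = 0) (f : Good deg k n) : n ≤ ∑ i, deg i := by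
  rw [← f.2.2.2]
  refine sum_le_sum fun i _ => ?_
  obtain he | ho := Nat.even_or_odd (deg i)
  · simp [h i he]
  · exact (Nat.mul_le_mul_right _ (f.2.2.1 i ho)).trans (one_mul _).le

/-- The combinatorial form of the equivalence: the top monomials of the word length components
shift by a constant degree and keep their number exactly if there is a unique even generator of
top positive degree. -/
theorem exists_unique_top {e : ι} (he : deg e = 0) {r σ : ℕ} (hσ : 1 ≤ σ)
    (h : ∀ k, r ≤ k → ∀ τ τ', IsGreatest {n | Nat.card (Good deg k n) ≠ 0} τ →
      IsGreatest {n | Nat.card (Good deg (k + 1) n) ≠ 0} τ' →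
      τ' = τ + σ ∧ Nat.card (Good deg (k + 1) τ') = Nat.card (Good deg k τ)) :
    ∃ a e, 1 ≤ a ∧ deg e = 2 * a ∧ (∀ i, deg i = 2 * a → i = e) ∧
      ∀ i, Even (deg i) → deg i ≤ 2 * a := by
  classical
  by_cases hp : ∀ i, Even (deg i) → deg i = 0
  · exfalso
    choose τ hτ using exists_isGreatest_good he
    have h1 : ∀ j, j ≤ τ (r + j) := fun j => by
      induction j with
      | zero => exact Nat.zero_le _
      | succ j ih =>
        have := (h (r + j) (Nat.le_add_right _ _) _ _ (hτ _) (hτ (r + j + 1))).1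
        change j + 1 ≤ τ (r + j + 1)
        omega
    have h2 := h1 (∑ i, deg i + 1)
    have : Nonempty (Good deg _ _) := (Nat.card_ne_zero.1 (hτ (r + (∑ i, deg i + 1))).1).1
    have := Good.le_sum hp this.some
    omega
  · push Not at hp
    obtain ⟨i, hi, hi0⟩ := hp
    obtain ⟨e, hem, hmax⟩ := exists_max_image (univ.filter fun i => Even (deg i)) deg
      ⟨i, by simp [hi]⟩
    obtain ⟨a, ha⟩ := (mem_filter.1 hem).2
    have hea : deg e = 2 * a := by omega
    have hle : ∀ i, Even (deg i) → deg i ≤ 2 * a := fun i hi =>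
      hea ▸ hmax i (by simp [hi])
    refine ⟨a, e, ?_, hea, fun i hi => ?_, hle⟩
    · have := hle i hi
      omega
    · by_contra hne
      have hk : highCount deg a ≤ r + highCount deg a := Nat.le_add_left _ _
      have h1 := (h (r + highCount deg a) (Nat.le_add_right _ _) _ _
        (isGreatest_topDegree hea hle hk)
        (isGreatest_topDegree hea hle (hk.trans (Nat.le_succ _)))).2
      exact (card_good_lt hne hi hea hk).ne' h1

end Monomials

section Manifold

lemma IsCohomBasis.exists_deg_eq_zero {X : Type} [TopologicalSpace X] {ι : Type} {deg : ι → ℕ}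
    {a : ι → Cochain X} (h : IsCohomBasis deg a) (x : X) : ∃ i, deg i = 0 := by
  by_contra! h0
  have hd : (pointS x).dim = 0 := rfl
  obtain ⟨e, he⟩ := h.exact (bas (pointS x)) (by rw [bd_bas, bdS_of_dim_zero hd]) fun i => by
    rw [← h.homog i, part_bas_of_ne _ (by rw [hd]; exact (h0 i).symm), map_zero]
  have h1 : aug (bas (pointS x)) = 1 := by
    rw [aug_bas]
    exact if_pos hd
  rw [← he, aug_bd] at h1
  exact zero_ne_one h1

/-- The preferred charts of a manifold, with values in the coordinate space. -/
noncomputable def coordChart {d : ℕ} {M : Type} [TopologicalSpace M]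
    [ChartedSpace (EuclideanSpace ℝ (Fin d)) M] (x : M) :
    OpenPartialHomeomorph M (Fin d → ℝ) :=
  (chartAt (EuclideanSpace ℝ (Fin d)) x).transHomeomorph
    (EuclideanSpace.equiv (Fin d) ℝ).toHomeomorph

lemma mem_coordChart_source {d : ℕ} {M : Type} [TopologicalSpace M]
    [ChartedSpace (EuclideanSpace ℝ (Fin d)) M] (x : M) : x ∈ (coordChart (d := d) x).source :=
  mem_chart_source _ x

end Manifold

end SingularQ

/-- A connected manifold of odd dimension `2m+1` with finite-dimensional
total rational cohomology satisfies the shifted stability condition for its unordered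
configuration spaces (for some range `r ≥ 1`, shift `σ ≥ 1` and length `q ≥ 1`) if and
only if its top positive even Betti number equals one, i.e. there is `a ≥ 1` with
`β_{2a}(M) = 1` and `β_{2i}(M) = 0` for all `i > a`. -/
theorem shifted_stability_odd_dimensional (m : ℕ) (M : Type) [TopologicalSpace M]
    [ChartedSpace (EuclideanSpace ℝ (Fin (2 * m + 1))) M]
    [T2Space M] [SecondCountableTopology M] [ConnectedSpace M]
    (hfin : FiniteTotalCohomologyQ M) :
    (∃ r σ q : ℕ, 1 ≤ r ∧ 1 ≤ σ ∧ 1 ≤ q ∧ ShiftedStabilityQ M r σ q) ↔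
      ∃ a : ℕ, 1 ≤ a ∧ bettiQ M (2 * a) = 1 ∧ ∀ i : ℕ, a < i → bettiQ M (2 * i) = 0 := by
  obtain ⟨N, deg, α, hα, hβ⟩ := SingularQ.exists_isCohomBasis hfin
  have hC : ∀ k n, bettiQ (unorderedConfig M (k + 1)) n =
      Nat.card (SingularQ.Good deg (k + 1) n) :=
    SingularQ.bettiQ_unorderedConfig hα (odd_two_mul_add_one m) SingularQ.coordChart
      SingularQ.mem_coordChart_source
  have hG : ∀ {k τ}, IsGreatest {n | Nat.card (SingularQ.Good deg (k + 1) n) ≠ 0} τ →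
      IsGreatest {n | bettiQ (unorderedConfig M (k + 1)) n ≠ 0} τ := fun h => by
    simpa only [hC] using h
  obtain ⟨e₀, he₀⟩ := hα.exists_deg_eq_zero (Classical.arbitrary M)
  constructor
  · rintro ⟨r, σ, q, hr, hσ, hq, hs⟩
    obtain ⟨a, e, ha, he, hu, hle⟩ := SingularQ.exists_unique_top he₀ (r := r) hσ
      fun k hk τ τ' hτ hτ' => by
        obtain ⟨k, rfl⟩ := Nat.exists_eq_add_of_le' (hr.trans hk)
        have h := SingularQ.top_of_truncPoincareQ_eq (hG hτ) (hG hτ') hq (hs _ hk)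
        rwa [hC, hC] at h
    refine ⟨a, ha, ?_, fun i hi => ?_⟩
    · rw [hβ, Finset.card_eq_one]
      exact ⟨e, by ext i; simpa using ⟨hu i, fun h => h ▸ he⟩⟩
    · rw [hβ, Finset.card_eq_zero, Finset.filter_eq_empty_iff]
      intro j _ hj
      have := hle j (hj ▸ even_two_mul i)
      omega
  · rintro ⟨a, ha, h1, h0⟩
    rw [hβ, Finset.card_eq_one] at h1
    obtain ⟨e, he⟩ := h1
    have hmem : ∀ i, deg i = 2 * a ↔ i = e := fun i => by
      have := Finset.ext_iff.1 he i
      simpa using this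
    have hle : ∀ i, Even (deg i) → deg i ≤ 2 * a := fun i ⟨b, hb⟩ => by
      by_contra hlt
      have h := h0 b (by omega)
      rw [hβ, Finset.card_eq_zero, Finset.filter_eq_empty_iff] at h
      exact h (Finset.mem_univ i) (by omega)
    refine ⟨SingularQ.highCount deg a + 1, 2 * a, 1, by omega, by omega, le_rfl, fun k hk => ?_⟩
    obtain ⟨k, rfl⟩ := Nat.exists_eq_add_of_le' (Nat.one_le_of_lt hk)
    have hk0 : SingularQ.highCount deg a ≤ k + 1 := by omega
    have hk1 : SingularQ.highCount deg a ≤ k + 1 + 1 := by omega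
    have hea := (hmem e).2 rfl
    have hu := fun i => (hmem i).1
    rw [SingularQ.truncPoincareQ_one (hG (SingularQ.isGreatest_topDegree hea hle hk0)),
      SingularQ.truncPoincareQ_one (hG (SingularQ.isGreatest_topDegree hea hle hk1)), hC, hC,
      SingularQ.card_good_eq_one hea hu hle hk0, SingularQ.card_good_eq_one hea hu hle hk1,
      SingularQ.topDegree_succ hk0, Polynomial.monomial_one_right_eq_X_pow,
      Polynomial.monomial_one_right_eq_X_pow, pow_add, mul_comm]
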